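/- Let P ⊂ ℝ^d be a lattice polytope. Then the following are equivalent: (i) P is a zonotope, i.e., a translate of Z(u_1,…,u_n) for some vectors u_1,…,u_n; (ii) for every c ∈ ℚ^d, the Ehrhart quasi-polynomial L_{c+P}(t) = #(t(c+P) ∩ ℤ^d) satisfies the GCD-property with respect to the period den(c). -/

import Mathlib

open Pointwise MeasureTheory
open scoped RealInnerProductSpace

noncomputable section

/-- Cast an integer vector to a real vector. -/
def castVec {d : ℕ} (x : Fin d → ℤ) : Fin d → ℝ := fun i => (x i : ℝ)

/-- Cast a rational vector to a real vector. -/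
def ratVec {d : ℕ} (c : Fin d → ℚ) : Fin d → ℝ := fun i => (c i : ℝ)

/-- `den(c)`: the lcm of the denominators of the coordinates of a rational vector. -/
def denv {d : ℕ} (c : Fin d → ℚ) : ℕ := Finset.univ.lcm fun i => (c i).den

/-- The number of lattice points in a subset of `ℝ^d`. -/
def latCount {d : ℕ} (S : Set (Fin d → ℝ)) : ℕ := {x : Fin d → ℤ | castVec x ∈ S}.ncard

/-- A lattice polytope: the convex hull of a nonempty finite set of integer points. -/
def IsLatticePolytope {d : ℕ} (P : Set (Fin d → ℝ)) : Prop :=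
  ∃ V : Finset (Fin d → ℤ), V.Nonempty ∧ P = convexHull ℝ (castVec '' (V : Set (Fin d → ℤ)))

/-- The zonotope spanned by a finite set of integer vectors. -/
def zonotopeF {d : ℕ} (U : Finset (Fin d → ℤ)) : Set (Fin d → ℝ) :=
  {x | ∃ lam : (Fin d → ℤ) → ℝ, (∀ u, lam u ∈ Set.Icc (0 : ℝ) 1) ∧
    x = ∑ u ∈ U, lam u • castVec u}

/-- The zonotope spanned by integer vectors `u 0, …, u (n-1)`. -/
def zonotopeZ {d n : ℕ} (u : Fin n → Fin d → ℤ) : Set (Fin d → ℝ) :=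
  {x | ∃ lam : Fin n → ℝ, (∀ i, lam i ∈ Set.Icc (0 : ℝ) 1) ∧ x = ∑ i, lam i • castVec (u i)}

/-- The zonotope spanned by real vectors `u 0, …, u (n-1)`. -/
def zonotopeR {d n : ℕ} (u : Fin n → Fin d → ℝ) : Set (Fin d → ℝ) :=
  {x | ∃ lam : Fin n → ℝ, (∀ i, lam i ∈ Set.Icc (0 : ℝ) 1) ∧ x = ∑ i, lam i • u i}

/-- A zonotope: a translate of the Minkowski sum of finitely many segments `[0, uᵢ]`. -/
def IsZonotope {d : ℕ} (P : Set (Fin d → ℝ)) : Prop :=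
  ∃ (n : ℕ) (u : Fin n → Fin d → ℝ) (v : Fin d → ℝ), P = v +ᵥ zonotopeR u

/-- A set is centrally symmetric if it is a translate of its negation. -/
def CentrallySymmetric {d : ℕ} (P : Set (Fin d → ℝ)) : Prop :=
  ∃ v : Fin d → ℝ, P = v +ᵥ (-P)

/-- `f` is a family of constituents of `L` with respect to the period `ρ`. -/
def IsConstituents (L : ℕ → ℚ) (ρ : ℕ) (f : ℕ → Polynomial ℚ) : Prop :=
  ∀ t : ℕ, 0 < t → L t = (f (t % ρ)).eval (t : ℚ)

/-- `ρ` is a period of the quasi-polynomial `L`. -/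
def IsPeriodOf (ρ : ℕ) (L : ℕ → ℚ) : Prop := 0 < ρ ∧ ∃ f, IsConstituents L ρ f

/-- `ρ₀` is the minimal period of the quasi-polynomial `L`. -/
def IsMinimalPeriodOf (ρ₀ : ℕ) (L : ℕ → ℚ) : Prop :=
  IsPeriodOf ρ₀ L ∧ ∀ ρ : ℕ, IsPeriodOf ρ L → ρ₀ ≤ ρ

/-- GCD-property with respect to the period `ρ`: constituents with equal
`gcd(ρ, ·)` coincide. -/
def GCDProperty (L : ℕ → ℚ) (ρ : ℕ) : Prop :=
  ∀ f : ℕ → Polynomial ℚ, IsConstituents L ρ f →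
    ∀ k ℓ : ℕ, Nat.gcd ρ k = Nat.gcd ρ ℓ → f (k % ρ) = f (ℓ % ρ)

/-- Symmetry with respect to the period `ρ`: `f_k = f_{ρ-k}` for `0 ≤ k ≤ ρ`. -/
def SymmetricQP (L : ℕ → ℚ) (ρ : ℕ) : Prop :=
  ∀ f : ℕ → Polynomial ℚ, IsConstituents L ρ f →
    ∀ k : ℕ, k ≤ ρ → f (k % ρ) = f ((ρ - k) % ρ)

/-- The Ehrhart counting function `t ↦ #(t(c + P) ∩ ℤ^d)` of the translate `c + P`. -/
def ehr {d : ℕ} (P : Set (Fin d → ℝ)) (c : Fin d → ℚ) : ℕ → ℚ :=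
  fun t => (latCount ((t : ℝ) • (ratVec c +ᵥ P)) : ℚ)

/-- The dimension of a polytope: the dimension of the direction of its affine hull. -/
def polyDim {d : ℕ} (P : Set (Fin d → ℝ)) : ℕ := Module.finrank ℝ (affineSpan ℝ P).direction

/-- `r` is the relative volume of `P` (of dimension `m`): with respect to any lattice
point `v₀` of `P` and any `ℤ`-basis `b` of the lattice `aff₀(P) ∩ ℤ^d`, `r` is the
Lebesgue measure of `P` in the coordinates determined by `v₀` and `b`. -/
def IsRelVolOf {d : ℕ} (P : Set (Fin d → ℝ)) (m : ℕ) (r : ℝ) : Prop :=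
  ∀ (v₀ : Fin d → ℤ) (b : Fin m → Fin d → ℤ),
    castVec v₀ ∈ P → LinearIndependent ℤ b →
    (∀ x : Fin d → ℤ,
      castVec x ∈ (affineSpan ℝ P).direction ↔ x ∈ Submodule.span ℤ (Set.range b)) →
    r = (volume {lam : Fin m → ℝ | castVec v₀ + ∑ i, lam i • castVec (b i) ∈ P}).toReal

/-- The (real casts of the) elements of `W` are linearly independent over `ℝ`. -/
def LinIndepF {d : ℕ} (W : Finset (Fin d → ℤ)) : Prop :=
  LinearIndependent ℝ fun w : ↥W => castVec w.1

/-- Almost locally constant: locally constant outside a discrete point set. -/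
def AlmostLocallyConstant (f : ℝ → ℝ) : Prop :=
  ∃ D : Set ℝ, DiscreteTopology D ∧ IsLocallyConstant fun x : ↥(Dᶜ) => f ↑x

/-- Almost constant: constant outside a discrete point set. -/
def AlmostConstant (f : ℝ → ℝ) : Prop :=
  ∃ D : Set ℝ, DiscreteTopology D ∧ ∃ r : ℝ, ∀ x ∉ D, f x = r

/-- The face of `P` in the outer normal direction `v`. -/
def normalFace {d : ℕ} (P : Set (EuclideanSpace ℝ (Fin d)))
    (v : EuclideanSpace ℝ (Fin d)) : Set (EuclideanSpace ℝ (Fin d)) :=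
  {x | x ∈ P ∧ ∀ y ∈ P, ⟪y, v⟫ ≤ ⟪x, v⟫}

/-- `F` is a facet of the `d`-polytope `P`: an exposed face of dimension `d - 1`. -/
def IsFacetOf {d : ℕ} (F P : Set (EuclideanSpace ℝ (Fin d))) : Prop :=
  (∃ v : EuclideanSpace ℝ (Fin d), v ≠ 0 ∧ F = normalFace P v) ∧
  Module.finrank ℝ (affineSpan ℝ F).direction = d - 1

namespace ZonotopeGCD

/-- `μ` is negative in the lexicographic order given by the functionals `a 0, …, a (N-1)`. -/
def LexNeg {n : ℕ} (N : ℕ) (a : ℕ → (Fin n → ℝ) →ₗ[ℝ] ℝ) (μ : Fin n → ℝ) : Prop :=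
  ∃ j < N, a j μ < 0 ∧ ∀ i < j, a i μ = 0

/-- No lexicographically negative vector of the kernel of `φ` is nonnegative on `Lo` and
nonpositive on `Up`. -/
def Good {n : ℕ} {F : Type*} [AddCommGroup F] [Module ℝ F] (N : ℕ)
    (a : ℕ → (Fin n → ℝ) →ₗ[ℝ] ℝ) (φ : (Fin n → ℝ) →ₗ[ℝ] F) (Lo Up : Set (Fin n)) : Prop :=
  ∀ μ, φ μ = 0 → (∀ i ∈ Lo, 0 ≤ μ i) → (∀ i ∈ Up, μ i ≤ 0) → ¬ LexNeg N a μ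

section Lex

variable {n : ℕ} {F : Type*} [AddCommGroup F] [Module ℝ F] {N : ℕ}
  {a : ℕ → (Fin n → ℝ) →ₗ[ℝ] ℝ} {φ : (Fin n → ℝ) →ₗ[ℝ] F}

theorem LexNeg.smul_pos {μ : Fin n → ℝ} (h : LexNeg N a μ) {ε : ℝ} (hε : 0 < ε) :
    LexNeg N a (ε • μ) := by
  obtain ⟨j, hj, hneg, hz⟩ := h
  refine ⟨j, hj, ?_, fun i hi => ?_⟩
  · rw [map_smul, smul_eq_mul]; exact mul_neg_of_pos_of_neg hε hneg
  · rw [map_smul, hz i hi, smul_zero]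

theorem exists_lexMin {K : Set (Fin n → ℝ)} (hK : IsCompact K) (hne : K.Nonempty) (N : ℕ)
    (a : ℕ → (Fin n → ℝ) →ₗ[ℝ] ℝ) : ∃ l ∈ K, ∀ μ ∈ K, ¬ LexNeg N a (μ - l) := by
  have hc : ∀ j, Continuous (a j) := fun j => LinearMap.continuous_of_finiteDimensional _
  induction N with
  | zero =>
    obtain ⟨l, hl⟩ := hne
    exact ⟨l, hl, fun μ _ ⟨j, hj, _⟩ => absurd hj (Nat.not_lt_zero _)⟩
  | succ N ih =>
    obtain ⟨l, hl, hmin⟩ := ih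
    have hK' : IsCompact (K ∩ {μ | ∀ i < N, a i μ = a i l}) := by
      refine hK.inter_right ?_
      simp only [Set.ofPred_forall]
      exact isClosed_iInter fun i => isClosed_iInter fun _ =>
        isClosed_eq (hc i) continuous_const
    obtain ⟨l', ⟨hl'K, hl'⟩, hmin'⟩ :=
      hK'.exists_isMinOn ⟨l, hl, fun _ _ => rfl⟩ (hc N).continuousOn
    refine ⟨l', hl'K, fun μ hμ => ?_⟩
    rintro ⟨j, hj, hneg, hz⟩
    rcases Nat.lt_succ_iff_lt_or_eq.1 hj with hj | rfl
    · refine hmin μ hμ ⟨j, hj, ?_, fun i hi => ?_⟩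
      · simpa [hl' j hj] using hneg
      · simpa [hl' i (hi.trans hj)] using hz i hi
    · have : l' ∈ K := hl'K
      have hμ' : μ ∈ K ∩ {μ | ∀ i < j, a i μ = a i l} := by
        refine ⟨hμ, fun i hi => ?_⟩
        have := hz i hi
        rw [map_sub, sub_eq_zero] at this
        rw [this, hl' i hi]
      have := hmin' hμ'
      rw [map_sub] at hneg
      simp only [Set.mem_ofPred_eq] at this
      linarith

/-- Every point of the image of a box under a linear map has a preimage whose set of
active constraints is good. -/
theorem exists_good [TopologicalSpace F] [IsTopologicalAddGroup F] [ContinuousSMul ℝ F]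
    [T2Space F] {τ : ℝ} {l₀ : Fin n → ℝ} (h₀ : ∀ i, l₀ i ∈ Set.Icc 0 τ)
    (N : ℕ) (a : ℕ → (Fin n → ℝ) →ₗ[ℝ] ℝ) (φ : (Fin n → ℝ) →ₗ[ℝ] F) :
    ∃ l : Fin n → ℝ, (∀ i, l i ∈ Set.Icc 0 τ) ∧ φ l = φ l₀ ∧
      Good N a φ {i | l i = 0} {i | l i = τ} := by
  have hφ : Continuous φ := LinearMap.continuous_of_finiteDimensional _
  have hK : IsCompact ((Set.univ.pi fun _ : Fin n => Set.Icc (0 : ℝ) τ) ∩ {l | φ l = φ l₀}) :=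
    (isCompact_univ_pi fun _ => isCompact_Icc).inter_right (isClosed_eq hφ continuous_const)
  obtain ⟨l, ⟨hl, hφl⟩, hmin⟩ := exists_lexMin hK ⟨l₀, fun i _ => h₀ i, rfl⟩ N a
  refine ⟨l, fun i => hl i trivial, hφl, fun μ hμ hLo hUp hneg => ?_⟩
  have hev : ∀ᶠ ε : ℝ in nhdsWithin 0 (Set.Ioi 0), ∀ i, l i + ε * μ i ∈ Set.Icc 0 τ := by
    rw [Filter.eventually_all]
    intro i
    have hc : Filter.Tendsto (fun ε : ℝ => l i + ε * μ i) (nhdsWithin 0 (Set.Ioi 0))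
        (nhds (l i)) := by
      have : Continuous fun ε : ℝ => l i + ε * μ i := by fun_prop
      have := this.tendsto 0
      simp only [zero_mul, add_zero] at this
      exact this.mono_left nhdsWithin_le_nhds
    obtain ⟨h1, h2⟩ := hl i trivial
    have e1 : ∀ᶠ ε : ℝ in nhdsWithin 0 (Set.Ioi 0), 0 ≤ l i + ε * μ i := by
      rcases h1.eq_or_lt with h | h
      · filter_upwards [self_mem_nhdsWithin] with ε hε
        have := hLo i h.symm
        rw [← h]
        have := mul_nonneg (le_of_lt hε) this
        linarith
      · exact (hc.eventually (lt_mem_nhds h)).mono fun _ h => le_of_lt h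
    have e2 : ∀ᶠ ε : ℝ in nhdsWithin 0 (Set.Ioi 0), l i + ε * μ i ≤ τ := by
      rcases h2.eq_or_lt with h | h
      · filter_upwards [self_mem_nhdsWithin] with ε hε
        have := hUp i h
        rw [h]
        have := mul_nonneg (le_of_lt hε) (neg_nonneg.2 this)
        linarith
      · exact (hc.eventually (gt_mem_nhds h)).mono fun _ h => le_of_lt h
    exact (e1.and e2).mono fun _ h => h
  obtain ⟨ε, hε, hpos⟩ := (hev.and self_mem_nhdsWithin).exists
  refine hmin (l + ε • μ) ⟨fun i _ => by simpa using hε i, ?_⟩ ?_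
  · simpa [hμ] using hφl
  · simpa using hneg.smul_pos hpos

theorem eq_zero_of_not_lexNeg (hinj : ∀ μ, (∀ j < N, a j μ = 0) → μ = 0) {μ : Fin n → ℝ}
    (h₁ : ¬ LexNeg N a μ) (h₂ : ¬ LexNeg N a (-μ)) : μ = 0 := by
  classical
  by_contra hne
  have hex : ∃ j, j < N ∧ a j μ ≠ 0 := by
    by_contra! h
    exact hne (hinj μ h)
  obtain ⟨hj, hjne⟩ := Nat.find_spec hex
  have hz : ∀ i < Nat.find hex, a i μ = 0 := by
    intro i hi
    have := Nat.find_min hex hi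
    by_contra h
    exact this ⟨hi.trans hj, h⟩
  rcases lt_or_gt_of_ne hjne with h | h
  · exact h₁ ⟨_, hj, h, hz⟩
  · exact h₂ ⟨_, hj, by simpa using h, fun i hi => by simp [hz i hi]⟩

/-- Good preimages in a box are unique. -/
theorem good_unique (hinj : ∀ μ, (∀ j < N, a j μ = 0) → μ = 0) {τ : ℝ}
    {l l' : Fin n → ℝ} (hl : ∀ i, l i ∈ Set.Icc 0 τ) (hl' : ∀ i, l' i ∈ Set.Icc 0 τ)
    (hg : Good N a φ {i | l i = 0} {i | l i = τ})
    (hg' : Good N a φ {i | l' i = 0} {i | l' i = τ}) (h : φ l = φ l') : l = l' := by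
  have h1 : ¬ LexNeg N a (l' - l) := by
    refine hg _ (by simp [h]) (fun i hi => ?_) (fun i hi => ?_)
    · have := (hl' i).1
      simp only [Set.mem_ofPred_eq] at hi
      simpa [hi] using this
    · have := (hl' i).2
      simp only [Set.mem_ofPred_eq] at hi
      simpa [hi] using this
  have h2 : ¬ LexNeg N a (-(l' - l)) := by
    refine hg' _ (by simp [h]) (fun i hi => ?_) (fun i hi => ?_)
    · have := (hl i).1
      simp only [Set.mem_ofPred_eq] at hi
      simpa [hi] using this
    · have := (hl i).2
      simp only [Set.mem_ofPred_eq] at hi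
      simpa [hi] using this
  exact (sub_eq_zero.1 (eq_zero_of_not_lexNeg hinj h1 h2)).symm

/-- A vector of the kernel supported on the free indices of a good pair vanishes. -/
theorem Good.eq_zero (hinj : ∀ μ, (∀ j < N, a j μ = 0) → μ = 0) {Lo Up : Set (Fin n)}
    (hg : Good N a φ Lo Up) {μ : Fin n → ℝ} (hμ : φ μ = 0) (hLo : ∀ i ∈ Lo, μ i = 0)
    (hUp : ∀ i ∈ Up, μ i = 0) : μ = 0 :=
  eq_zero_of_not_lexNeg hinj
    (hg μ hμ (fun i hi => (hLo i hi).ge) fun i hi => (hUp i hi).le)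
    (hg (-μ) (by simp [hμ]) (fun i hi => by simp [hLo i hi]) fun i hi => by simp [hUp i hi])

end Lex

section Cone

variable {d r : ℕ}

/-- The linear combination of integer vectors with real coefficients. -/
def comb (v : Fin r → Fin d → ℤ) : (Fin r → ℝ) →ₗ[ℝ] (Fin d → ℝ) :=
  Fintype.linearCombination ℝ fun i => castVec (v i)

/-- The linear combination of the vectors `(v i, 1)`. -/
def liftMap (v : Fin r → Fin d → ℤ) : (Fin r → ℝ) →ₗ[ℝ] (Fin d → ℝ) × ℝ :=
  (comb v).prod (Fintype.linearCombination ℝ fun _ => (1 : ℝ))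

/-- The coordinate functionals, preceded by the negative of the coordinate `s`. -/
def starFun (s : Fin r) : ℕ → (Fin r → ℝ) →ₗ[ℝ] ℝ
  | 0 => -LinearMap.proj s
  | j + 1 => if h : j < r then LinearMap.proj ⟨j, h⟩ else 0

/-- The supports of the canonical representations. -/
def Adm (v : Fin r → Fin d → ℤ) (s : Fin r) (S : Set (Fin r)) : Prop :=
  Good (r + 1) (starFun s) (liftMap v) Sᶜ ∅

theorem comb_apply (v : Fin r → Fin d → ℤ) (l : Fin r → ℝ) :
    comb v l = ∑ i, l i • castVec (v i) := rfl

theorem comb_apply_apply (v : Fin r → Fin d → ℤ) (l : Fin r → ℝ) (k : Fin d) :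
    comb v l k = ∑ i, l i * (v i k : ℝ) := by
  simp [comb_apply, castVec]

theorem liftMap_eq_iff (v : Fin r → Fin d → ℤ) (l l' : Fin r → ℝ) :
    liftMap v l = liftMap v l' ↔ comb v l = comb v l' ∧ ∑ i, l i = ∑ i, l' i := by
  simp [liftMap, Fintype.linearCombination_apply, Prod.ext_iff]

theorem liftMap_eq_zero_iff (v : Fin r → Fin d → ℤ) (l : Fin r → ℝ) :
    liftMap v l = 0 ↔ comb v l = 0 ∧ ∑ i, l i = 0 := by
  simp [liftMap, Fintype.linearCombination_apply, Prod.ext_iff]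

theorem starFun_inj (s : Fin r) (μ : Fin r → ℝ) (h : ∀ j < r + 1, starFun s j μ = 0) :
    μ = 0 := by
  ext i
  simpa [starFun] using h (i + 1) (by omega)

theorem Adm.mono {v : Fin r → Fin d → ℤ} {s : Fin r} {S T : Set (Fin r)} (h : Adm v s T)
    (hST : S ⊆ T) : Adm v s S :=
  fun μ hμ hLo hUp => h μ hμ (fun i hi => hLo i fun hS => hi (hST hS)) hUp

theorem Adm.insert {v : Fin r → Fin d → ℤ} {s : Fin r} {S : Set (Fin r)} (h : Adm v s S) :
    Adm v s (insert s S) := by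
  intro μ hμ hLo hUp hneg
  rcases le_or_gt 0 (μ s) with hs | hs
  · refine h μ hμ (fun i hi => ?_) hUp hneg
    by_cases his : i = s
    · rwa [his]
    · exact hLo i (by simp [his]; exact hi)
  · obtain ⟨j, -, hj, hz⟩ := hneg
    rcases Nat.eq_zero_or_pos j with rfl | hpos
    · simp [starFun] at hj
      linarith
    · have := hz 0 hpos
      simp [starFun] at this
      linarith

theorem Adm.eq_zero {v : Fin r → Fin d → ℤ} {s : Fin r} {S : Set (Fin r)} (h : Adm v s S)
    {μ : Fin r → ℝ} (hμ : comb v μ = 0) (hsum : ∑ i, μ i = 0) (hS : ∀ i ∉ S, μ i = 0) :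
    μ = 0 :=
  Good.eq_zero (starFun_inj s) h ((liftMap_eq_zero_iff v μ).2 ⟨hμ, hsum⟩) hS (by simp)

theorem exists_adm (v : Fin r → Fin d → ℤ) (s : Fin r) {l₀ : Fin r → ℝ} (h₀ : ∀ i, 0 ≤ l₀ i) :
    ∃ l : Fin r → ℝ, (∀ i, 0 ≤ l i) ∧ comb v l = comb v l₀ ∧ ∑ i, l i = ∑ i, l₀ i ∧
      Adm v s {i | l i ≠ 0} := by
  obtain ⟨l, hl, hφ, hg⟩ := exists_good (τ := ∑ i, l₀ i + 1) (l₀ := l₀) (fun i => ⟨h₀ i, by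
    have := Finset.single_le_sum (fun j _ => h₀ j) (Finset.mem_univ i)
    linarith⟩) (r + 1) (starFun s) (liftMap v)
  rw [liftMap_eq_iff] at hφ
  refine ⟨l, fun i => (hl i).1, hφ.1, hφ.2, ?_⟩
  have hlt : ∀ i, l i ≠ ∑ i, l₀ i + 1 := fun i hi => by
    have := Finset.single_le_sum (fun j _ => (hl j).1) (Finset.mem_univ i)
    linarith [hφ.2]
  intro μ hμ hLo _
  exact hg μ hμ (fun i hi => hLo i (by simpa using hi)) fun i hi => absurd hi (hlt i)

theorem adm_unique {v : Fin r → Fin d → ℤ} {s : Fin r} {l l' : Fin r → ℝ} (hl : ∀ i, 0 ≤ l i)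
    (hl' : ∀ i, 0 ≤ l' i) (ha : Adm v s {i | l i ≠ 0}) (ha' : Adm v s {i | l' i ≠ 0})
    (h : comb v l = comb v l') (hsum : ∑ i, l i = ∑ i, l' i) : l = l' := by
  have key : ∀ k : Fin r → ℝ, (∀ i, 0 ≤ k i) → ∑ i, k i = ∑ i, l i → Adm v s {i | k i ≠ 0} →
      (∀ i, k i ∈ Set.Icc 0 (∑ i, l i + 1)) ∧ Good (r + 1) (starFun s) (liftMap v)
        {i | k i = 0} {i | k i = ∑ i, l i + 1} := by
    intro k hk hks hka
    have hle : ∀ i, k i ≤ ∑ i, l i := fun i => by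
      rw [← hks]; exact Finset.single_le_sum (fun j _ => hk j) (Finset.mem_univ i)
    refine ⟨fun i => ⟨hk i, (hle i).trans (by linarith)⟩, fun μ hμ hLo _ => ?_⟩
    exact hka μ hμ (fun i hi => hLo i (by simpa using hi)) (by simp)
  obtain ⟨h1, h2⟩ := key l hl rfl ha
  obtain ⟨h1', h2'⟩ := key l' hl' hsum.symm ha'
  exact good_unique (starFun_inj s) h1 h1' h2 h2' ((liftMap_eq_iff v l l').2 ⟨h, hsum⟩)

theorem castVec_injective : Function.Injective (castVec (d := d)) := fun x y h => by
  ext i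
  have := congrFun h i
  simpa [castVec] using this

theorem castVec_add (x y : Fin d → ℤ) : castVec (x + y) = castVec x + castVec y := by
  ext i; simp [castVec]

theorem castVec_sum {ι : Type*} (S : Finset ι) (m : ι → ℕ) (v : ι → Fin d → ℤ) :
    castVec (∑ i ∈ S, m i • v i) = ∑ i ∈ S, (m i : ℝ) • castVec (v i) := by
  ext k; simp [castVec]

theorem finite_castVec_bounded (C : ℝ) : {x : Fin d → ℤ | ∀ k, |castVec x k| ≤ C}.Finite := by
  refine (Set.Finite.pi' fun _ : Fin d => Set.finite_Icc (-⌈C⌉) ⌈C⌉).subset fun x hx k => ?_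
  have := abs_le.1 (hx k)
  simp only [castVec] at this
  refine ⟨?_, ?_⟩
  · have : (-(⌈C⌉ : ℝ)) ≤ x k := by linarith [Int.le_ceil C]
    exact_mod_cast this
  · have : (x k : ℝ) ≤ ⌈C⌉ := by linarith [Int.le_ceil C]
    exact_mod_cast this

/-- The lattice points of `w + n P`, where `P` is the convex hull of the `v i`. -/
def pts (v : Fin r → Fin d → ℤ) (w : Fin d → ℝ) (n : ℕ) : Set (Fin d → ℤ) :=
  {x | ∃ l : Fin r → ℝ, (∀ i, 0 ≤ l i) ∧ ∑ i, l i = n ∧ castVec x = w + comb v l}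

theorem abs_comb_le (v : Fin r → Fin d → ℤ) {l : Fin r → ℝ} {C : ℝ}
    (hl : ∀ i, |l i| ≤ C) (k : Fin d) :
    |comb v l k| ≤ C * ∑ k, ∑ i, |(v i k : ℝ)| := by
  rw [comb_apply_apply]
  have hC : 0 ≤ ∑ i, |(v i k : ℝ)| := Finset.sum_nonneg fun _ _ => abs_nonneg _
  rcases isEmpty_or_nonempty (Fin r) with hr | ⟨⟨i₀⟩⟩
  · simp
  have hC0 : 0 ≤ C := (abs_nonneg _).trans (hl i₀)
  calc |∑ i, l i * (v i k : ℝ)| ≤ ∑ i, |l i * (v i k : ℝ)| := Finset.abs_sum_le_sum_abs _ _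
    _ ≤ ∑ i, C * |(v i k : ℝ)| := Finset.sum_le_sum fun i _ => by
        rw [abs_mul]; exact mul_le_mul_of_nonneg_right (hl i) (abs_nonneg _)
    _ = C * ∑ i, |(v i k : ℝ)| := by rw [Finset.mul_sum]
    _ ≤ _ := mul_le_mul_of_nonneg_left (Finset.single_le_sum
        (f := fun k => ∑ i, |(v i k : ℝ)|)
        (fun k _ => Finset.sum_nonneg fun _ _ => abs_nonneg _) (Finset.mem_univ k)) hC0

theorem finite_lattice_of_coeff_le (v : Fin r → Fin d → ℤ) (w : Fin d → ℝ) (C : ℝ) :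
    {x : Fin d → ℤ | ∃ l : Fin r → ℝ, (∀ i, |l i| ≤ C) ∧ castVec x = w + comb v l}.Finite := by
  refine (finite_castVec_bounded (∑ k, |w k| + C * ∑ k, ∑ i, |(v i k : ℝ)|)).subset ?_
  rintro x ⟨l, hl, hx⟩ k
  rw [hx]
  refine (abs_add_le _ _).trans (add_le_add ?_ (abs_comb_le v hl k))
  exact Finset.single_le_sum (f := fun k => |w k|) (fun _ _ => abs_nonneg _) (Finset.mem_univ k)

theorem pts_finite (v : Fin r → Fin d → ℤ) (w : Fin d → ℝ) (n : ℕ) : (pts v w n).Finite := by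
  refine (finite_lattice_of_coeff_le v w n).subset ?_
  rintro x ⟨l, hl, hs, hx⟩
  refine ⟨l, fun i => ?_, hx⟩
  rw [abs_of_nonneg (hl i), ← hs]
  exact Finset.single_le_sum (fun j _ => hl j) (Finset.mem_univ i)

/-- The canonical representations with coefficients in the unit box. -/
def Box (v : Fin r → Fin d → ℤ) (s : Fin r) (w : Fin d → ℝ) : Set (Fin r → ℝ) :=
  {b | (∀ i, b i ∈ Set.Icc (0 : ℝ) 1) ∧ b s < 1 ∧ Adm v s {i | b i ≠ 0} ∧
    (∃ x : Fin d → ℤ, castVec x = w + comb v b) ∧ ∃ h : ℕ, ∑ i, b i = h}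

/-- The lattice point represented by `b`. -/
def latPt (v : Fin r → Fin d → ℤ) (w : Fin d → ℝ) (b : Fin r → ℝ) : Fin d → ℤ :=
  fun k => ⌊(w + comb v b) k⌋

/-- The height of a representation. -/
def ht (b : Fin r → ℝ) : ℕ := ⌊∑ i, b i⌋₊

/-- The support of a representation, together with the distinguished index. -/
def idx (s : Fin r) (b : Fin r → ℝ) : Finset (Fin r) :=
  Finset.univ.filter fun i => b i ≠ 0 ∨ i = s

theorem castVec_latPt {v : Fin r → Fin d → ℤ} {s : Fin r} {w : Fin d → ℝ} {b : Fin r → ℝ}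
    (hb : b ∈ Box v s w) : castVec (latPt v w b) = w + comb v b := by
  obtain ⟨-, -, -, ⟨x, hx⟩, -⟩ := hb
  ext k
  have hk := congrFun hx k
  simp only [castVec, latPt] at hk ⊢
  rw [← hk, Int.floor_intCast]

theorem cast_ht {v : Fin r → Fin d → ℤ} {s : Fin r} {w : Fin d → ℝ} {b : Fin r → ℝ}
    (hb : b ∈ Box v s w) : (ht b : ℝ) = ∑ i, b i := by
  obtain ⟨-, -, -, -, h, hh⟩ := hb
  simp [ht, hh]

theorem Box_finite (v : Fin r → Fin d → ℤ) (s : Fin r) (w : Fin d → ℝ) :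
    (Box v s w).Finite := by
  refine Set.Finite.of_finite_image (f := fun b => (latPt v w b, ht b)) ?_ ?_
  · refine ((finite_lattice_of_coeff_le v w 1).prod (Set.finite_Iic r)).subset ?_
    rintro _ ⟨b, hb, rfl⟩
    refine ⟨⟨b, fun i => ?_, castVec_latPt hb⟩, ?_⟩
    · rw [abs_of_nonneg (hb.1 i).1]; exact (hb.1 i).2
    · have h1 : (ht b : ℝ) ≤ r := by
        rw [cast_ht hb]
        calc ∑ i, b i ≤ ∑ _i : Fin r, (1 : ℝ) := Finset.sum_le_sum fun i _ => (hb.1 i).2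
          _ = r := by simp
      exact_mod_cast h1
  · intro b hb b' hb' h
    simp only [Prod.mk.injEq] at h
    refine adm_unique (fun i => (hb.1 i).1) (fun i => (hb'.1 i).1) hb.2.2.1 hb'.2.2.1 ?_ ?_
    · have := congrArg castVec h.1
      rwa [castVec_latPt hb, castVec_latPt hb', add_right_inj] at this
    · rw [← cast_ht hb, ← cast_ht hb', h.2]

theorem Adm_idx {v : Fin r → Fin d → ℤ} {s : Fin r} {w : Fin d → ℝ} {b : Fin r → ℝ}
    (hb : b ∈ Box v s w) : Adm v s (idx s b : Set (Fin r)) := by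
  refine (hb.2.2.1.insert).mono fun i hi => ?_
  simp only [idx, Finset.coe_filter, Finset.mem_univ, true_and] at hi
  rcases hi with h | h
  · exact Or.inr h
  · exact Or.inl h

theorem ht_lt_card {v : Fin r → Fin d → ℤ} {s : Fin r} {w : Fin d → ℝ} {b : Fin r → ℝ}
    (hb : b ∈ Box v s w) : ht b < (idx s b).card := by
  have h1 : (ht b : ℝ) < (idx s b).card := by
    rw [cast_ht hb, ← Finset.sum_subset (Finset.subset_univ (idx s b)), Finset.card_eq_sum_ones,
      Nat.cast_sum]
    · exact Finset.sum_lt_sum (fun i _ => by simpa using (hb.1 i).2)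
        ⟨s, by simp [idx], by simpa using hb.2.1⟩
    · intro i _ hi
      simp only [idx, Finset.mem_filter, Finset.mem_univ, true_and, not_or, not_not] at hi
      exact hi.1
  exact_mod_cast h1

/-- The lattice points of `w + n P` are obtained from the points of the boxes by adding
nonnegative integer combinations of the generators. -/
theorem sum_pts {M : Type*} [AddCommMonoid M] (v : Fin r → Fin d → ℤ) (s : Fin r)
    (w : Fin d → ℝ) (n : ℕ) (F : (Fin d → ℤ) → M) :
    ∑ x ∈ (pts_finite v w n).toFinset, F x =
      ∑ b ∈ (Box_finite v s w).toFinset,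
        ∑ m ∈ (if ht b ≤ n then (idx s b).piAntidiag (n - ht b) else ∅),
          F (latPt v w b + ∑ i, m i • v i) := by
  symm
  rw [Finset.sum_sigma']
  have hmem : ∀ b m, (b ∈ Box v s w ∧
      m ∈ (if ht b ≤ n then (idx s b).piAntidiag (n - ht b) else ∅)) ↔
      (b ∈ Box v s w ∧ ht b + ∑ i, m i = n ∧ ∀ i, m i ≠ 0 → i ∈ idx s b) := by
    intro b m
    refine and_congr_right fun _ => ?_
    split_ifs with h
    · rw [Finset.mem_piAntidiag]
      constructor
      · rintro ⟨h1, h2⟩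
        refine ⟨?_, h2⟩
        rw [← Finset.sum_subset (Finset.subset_univ (idx s b)), h1]
        · omega
        · intro i _ hi
          by_contra hne
          exact hi (h2 i hne)
      · rintro ⟨h1, h2⟩
        refine ⟨?_, h2⟩
        rw [Finset.sum_subset (Finset.subset_univ (idx s b))]
        · omega
        · intro i _ hi
          by_contra hne
          exact hi (h2 i hne)
    · simp only [Finset.notMem_empty, false_iff, not_and]
      intro h1; omega
  -- properties of `b + m`
  have hrep : ∀ (b : Fin r → ℝ) (m : Fin r → ℕ), b ∈ Box v s w → ht b + ∑ i, m i = n →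
      (∀ i, m i ≠ 0 → i ∈ idx s b) →
      (∀ i, 0 ≤ b i + m i) ∧ ∑ i, (b i + m i) = n ∧
      castVec (latPt v w b + ∑ i, m i • v i) = w + comb v (fun i => b i + m i) ∧
      Adm v s {i | b i + m i ≠ 0} := by
    intro b m hb hn hm
    refine ⟨fun i => add_nonneg (hb.1 i).1 (Nat.cast_nonneg _), ?_, ?_, ?_⟩
    · rw [Finset.sum_add_distrib, ← cast_ht hb, ← hn]; push_cast; rfl
    · rw [castVec_add, castVec_sum, castVec_latPt hb, comb_apply, comb_apply, add_assoc,
        ← Finset.sum_add_distrib]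
      simp only [add_smul]
    · refine (Adm_idx hb).mono fun i hi => ?_
      by_cases h : m i = 0
      · simp only [Set.mem_ofPred_eq, h, Nat.cast_zero, add_zero] at hi
        simp [idx, hi]
      · exact hm i h
  refine Finset.sum_nbij (fun p => latPt v w p.1 + ∑ i, p.2 i • v i) ?_ ?_ ?_ fun _ _ => rfl
  · rintro ⟨b, m⟩ h
    simp only [Finset.mem_sigma, Set.Finite.mem_toFinset, hmem] at h
    obtain ⟨h1, h2, h3, -⟩ := hrep b m h.1 h.2.1 h.2.2
    rw [Set.Finite.mem_toFinset]
    exact ⟨_, h1, h2, h3⟩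
  · rintro ⟨b, m⟩ h ⟨b', m'⟩ h' heq
    simp only [Finset.mem_coe, Finset.mem_sigma, Set.Finite.mem_toFinset, hmem] at h h'
    obtain ⟨h1, h2, h3, h4⟩ := hrep b m h.1 h.2.1 h.2.2
    obtain ⟨h1', h2', h3', h4'⟩ := hrep b' m' h'.1 h'.2.1 h'.2.2
    simp only at heq
    rw [heq, h3', add_right_inj] at h3
    have hl := adm_unique h1 h1' h4 h4' h3.symm (h2.trans h2'.symm)
    have key : ∀ i, b i = b' i ∧ m i = m' i := by
      intro i
      have hi : b i + m i = b' i + m' i := congrFun hl i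
      have hb := h.1.1 i
      have hb' := h'.1.1 i
      by_cases his : i = s
      · subst his
        have e1 : ((m i : ℤ) : ℝ) = (m i : ℝ) := by simp
        have f1 : ⌊b i + m i⌋₊ = m i := by
          rw [Nat.floor_add_natCast hb.1, Nat.floor_eq_zero.2 h.1.2.1, zero_add]
        have f2 : ⌊b' i + m' i⌋₊ = m' i := by
          rw [Nat.floor_add_natCast hb'.1, Nat.floor_eq_zero.2 h'.1.2.1, zero_add]
        have : m i = m' i := by rw [← f1, ← f2, hi]
        rw [this] at hi
        exact ⟨by linarith, this⟩
      · have g : b i = 0 → m i = 0 := fun h0 => by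
          by_contra hne
          have := h.2.2 i hne
          simp [idx, h0, his] at this
        have g' : b' i = 0 → m' i = 0 := fun h0 => by
          by_contra hne
          have := h'.2.2 i hne
          simp [idx, h0, his] at this
        by_cases h0 : b i = 0
        · rw [h0, g h0] at hi
          simp only [Nat.cast_zero, add_zero] at hi
          have hm' : (0 : ℝ) ≤ m' i := Nat.cast_nonneg _
          have : b' i = 0 := by linarith [hb'.1]
          exact ⟨by rw [h0, this], by rw [g h0, g' this]⟩
        · by_cases h0' : b' i = 0
          · rw [h0', g' h0'] at hi
            simp only [Nat.cast_zero, add_zero] at hi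
            have hm : (0 : ℝ) ≤ m i := Nat.cast_nonneg _
            exact absurd (by linarith [hb.1]) h0
          · have p : 0 < b i := lt_of_le_of_ne hb.1 (Ne.symm h0)
            have p' : 0 < b' i := lt_of_le_of_ne hb'.1 (Ne.symm h0')
            have q1 : (m i : ℝ) < m' i + 1 := by linarith [hb'.2]
            have q2 : (m' i : ℝ) < m i + 1 := by linarith [hb.2]
            have q1' : m i < m' i + 1 := by exact_mod_cast q1
            have q2' : m' i < m i + 1 := by exact_mod_cast q2
            have : m i = m' i := by omega
            rw [this] at hi
            exact ⟨by linarith, this⟩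
    have hbb : b = b' := funext fun i => (key i).1
    have hmm : m = m' := funext fun i => (key i).2
    rw [hbb, hmm]
  · intro x hx
    rw [Finset.mem_coe, Set.Finite.mem_toFinset] at hx
    obtain ⟨l₀, hl₀, hs₀, hx₀⟩ := hx
    obtain ⟨l, hl, hc, hs, ha⟩ := exists_adm v s hl₀
    let m : Fin r → ℕ := fun i => if i = s then ⌊l i⌋₊ else ⌈l i⌉₊ - 1
    let b : Fin r → ℝ := fun i => l i - m i
    have hbi : ∀ i, 0 ≤ b i ∧ b i ≤ 1 ∧ (i = s → b i < 1) ∧ (i ≠ s → b i = 0 → l i = 0) ∧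
        (l i = 0 → m i = 0) := by
      intro i
      simp only [b, m]
      by_cases his : i = s
      · simp only [his, if_true]
        have h1 := Nat.floor_le (hl s)
        have h2 := Nat.lt_floor_add_one (l s)
        refine ⟨by linarith, by linarith, fun _ => by linarith, fun h => absurd rfl h, ?_⟩
        intro h; simp [h]
      · simp only [his, if_false]
        rcases (hl i).eq_or_lt with h0 | h0
        · rw [← h0]; simp
        · have hc1 : 1 ≤ ⌈l i⌉₊ := Nat.one_le_iff_ne_zero.2 (Nat.ceil_pos.2 h0).ne'
          have h1 := Nat.le_ceil (l i)
          have h2 := Nat.ceil_lt_add_one (hl i)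
          rw [Nat.cast_sub hc1]
          push_cast
          refine ⟨by linarith, by linarith, fun h => absurd h id, fun _ h => ?_, fun h => ?_⟩
          · linarith
          · exact absurd h h0.ne'
    have hbm : (fun i => b i + (m i : ℝ)) = l := by ext i; simp [b]
    have hsum : ∑ i, b i = n - (∑ i, m i : ℕ) := by
      simp only [b, Finset.sum_sub_distrib, hs, hs₀]; push_cast; rfl
    have hle : ∑ i, m i ≤ n := by
      have : 0 ≤ ∑ i, b i := Finset.sum_nonneg fun i _ => (hbi i).1
      rw [hsum] at this
      have : ((∑ i, m i : ℕ) : ℝ) ≤ n := by linarith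
      exact_mod_cast this
    have hb : b ∈ Box v s w := by
      refine ⟨fun i => ⟨(hbi i).1, (hbi i).2.1⟩, (hbi s).2.2.1 rfl, ?_, ?_, n - ∑ i, m i, ?_⟩
      · refine ha.mono fun i hi => ?_
        intro h0
        refine hi ?_
        simp only [b]
        rw [(hbi i).2.2.2.2 h0, h0]; simp
      · refine ⟨x - ∑ i, m i • v i, ?_⟩
        have e : castVec (x - ∑ i, m i • v i) = castVec x - castVec (∑ i, m i • v i) := by
          ext k; simp [castVec]
        rw [e, hx₀, ← hc, castVec_sum, comb_apply, comb_apply, add_sub_assoc,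
          ← Finset.sum_sub_distrib]
        simp only [b, sub_smul]
      · rw [hsum, Nat.cast_sub hle]
    have hht : ht b + ∑ i, m i = n := by
      have : ht b = n - ∑ i, m i := by
        have := cast_ht hb
        rw [hsum, ← Nat.cast_sub hle] at this
        exact_mod_cast this
      omega
    have hidx : ∀ i, m i ≠ 0 → i ∈ idx s b := by
      intro i hi
      simp only [idx, Finset.mem_filter, Finset.mem_univ, true_and]
      by_contra! h
      exact hi ((hbi i).2.2.2.2 ((hbi i).2.2.2.1 h.2 h.1))
    refine ⟨⟨b, m⟩, ?_, ?_⟩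
    · rw [Finset.mem_coe, Finset.mem_sigma, Set.Finite.mem_toFinset, hmem]
      exact ⟨hb, hht, hidx⟩
    · obtain ⟨-, -, h3, -⟩ := hrep b m hb hht hidx
      apply castVec_injective
      simp only at h3 ⊢
      rw [h3, hbm, hc, hx₀]

end Cone

section Count

variable {d r : ℕ}

theorem card_piAntidiag_nat {ι : Type*} [DecidableEq ι] (s : Finset ι) (n : ℕ) :
    (s.piAntidiag n).card = (s.card + n - 1).choose n := by
  rw [← Finset.card_finsuppAntidiag_nat_eq_choose]
  symm
  refine Finset.card_nbij (fun f : ι →₀ ℕ => (f : ι → ℕ)) ?_ ?_ ?_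
  · intro f hf
    rw [Finset.mem_coe, Finset.mem_finsuppAntidiag] at hf
    rw [Finset.mem_coe, Finset.mem_piAntidiag]
    exact ⟨hf.1, fun i hi => hf.2 (by simpa using hi)⟩
  · exact DFunLike.coe_injective.injOn
  · intro f hf
    rw [Finset.mem_coe, Finset.mem_piAntidiag] at hf
    refine ⟨Finsupp.onFinset s f hf.2, ?_, rfl⟩
    rw [Finset.mem_coe, Finset.mem_finsuppAntidiag]
    exact ⟨hf.1, Finsupp.support_onFinset_subset⟩

/-- The number of lattice points of `w + n P` is a polynomial in `n`. -/
theorem exists_poly (v : Fin r → Fin d → ℤ) (s : Fin r) (w : Fin d → ℝ) :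
    ∃ q : Polynomial ℚ, ∀ n : ℕ, ((pts v w n).ncard : ℚ) = q.eval (n : ℚ) := by
  refine ⟨∑ b ∈ (Box_finite v s w).toFinset,
    Polynomial.C ((((idx s b).card - 1).factorial : ℚ)⁻¹) *
      (descPochhammer ℚ ((idx s b).card - 1)).comp
        (Polynomial.X + Polynomial.C ((((idx s b).card - 1 - ht b : ℕ)) : ℚ)), fun n => ?_⟩
  have h := sum_pts v s w n (fun _ => (1 : ℚ))
  rw [Finset.sum_const, nsmul_one, ← Set.ncard_eq_toFinset_card _ (pts_finite v w n)] at h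
  rw [h, Polynomial.eval_finsetSum]
  refine Finset.sum_congr rfl fun b hb => ?_
  rw [Set.Finite.mem_toFinset] at hb
  have hlt := ht_lt_card hb
  rw [Finset.sum_const, nsmul_one, Polynomial.eval_mul, Polynomial.eval_C, Polynomial.eval_comp,
    Polynomial.eval_add, Polynomial.eval_X, Polynomial.eval_C, ← Nat.cast_add,
    descPochhammer_eval_eq_descFactorial]
  have hf : (((idx s b).card - 1).factorial : ℚ) ≠ 0 := by
    exact_mod_cast Nat.factorial_ne_zero _
  rw [eq_inv_mul_iff_mul_eq₀ hf, ← Nat.cast_mul, Nat.descFactorial_eq_factorial_mul_choose]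
  congr 2
  split_ifs with hn
  · rw [card_piAntidiag_nat]
    have e1 : (idx s b).card + (n - ht b) - 1 = n + ((idx s b).card - 1 - ht b) := by omega
    rw [e1, ← Nat.choose_symm_of_eq_add]
    omega
  · rw [Finset.card_empty, Nat.choose_eq_zero_of_lt]
    omega

theorem convexHull_range_castVec (v : Fin r → Fin d → ℤ) :
    convexHull ℝ (Set.range fun i => castVec (v i)) = comb v '' stdSimplex ℝ (Fin r) := by
  rw [← convexHull_basis_eq_stdSimplex, LinearMap.image_convexHull, ← Set.range_comp]
  congr 2
  ext i k
  simp [comb_apply_apply, castVec]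

theorem exists_enum {P : Set (Fin d → ℝ)} (hP : IsLatticePolytope P) :
    ∃ (r : ℕ) (v : Fin r → Fin d → ℤ), 0 < r ∧ P = comb v '' stdSimplex ℝ (Fin r) := by
  obtain ⟨V, hV, rfl⟩ := hP
  refine ⟨V.card, fun i => (V.equivFin.symm i : Fin d → ℤ), Finset.card_pos.2 hV, ?_⟩
  rw [← convexHull_range_castVec]
  congr 1
  ext y
  constructor
  · rintro ⟨x, hx, rfl⟩
    exact ⟨V.equivFin ⟨x, hx⟩, by simp⟩
  · rintro ⟨i, rfl⟩
    exact ⟨_, (V.equivFin.symm i).2, rfl⟩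

theorem mem_smul_hull {v : Fin r → Fin d → ℤ} (hr : 0 < r) {t : ℝ} (ht : 0 ≤ t)
    {y : Fin d → ℝ} : y ∈ t • (comb v '' stdSimplex ℝ (Fin r)) ↔
      ∃ l : Fin r → ℝ, (∀ i, 0 ≤ l i) ∧ ∑ i, l i = t ∧ y = comb v l := by
  constructor
  · rintro ⟨_, ⟨l, hl, rfl⟩, rfl⟩
    refine ⟨t • l, fun i => mul_nonneg ht (hl.1 i), ?_, by simp⟩
    simp [← Finset.mul_sum, hl.2]
  · rintro ⟨l, h0, hs, rfl⟩
    rcases ht.eq_or_lt with h | h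
    · subst h
      have hl : l = 0 := by
        ext i
        exact (Finset.sum_eq_zero_iff_of_nonneg fun i _ => h0 i).1 hs i (Finset.mem_univ i)
      refine ⟨comb v (Pi.single ⟨0, hr⟩ 1), ⟨_, single_mem_stdSimplex ℝ _, rfl⟩, ?_⟩
      simp [hl]
    · refine ⟨comb v (t⁻¹ • l), ⟨_, ⟨fun i => ?_, ?_⟩, rfl⟩, ?_⟩
      · exact mul_nonneg (inv_nonneg.2 ht) (h0 i)
      · simp only [Pi.smul_apply, smul_eq_mul, ← Finset.mul_sum, hs]
        exact inv_mul_cancel₀ h.ne'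
      · simp [h.ne']

theorem ehr_eq {v : Fin r → Fin d → ℤ} (hr : 0 < r) (c : Fin d → ℚ) (t : ℕ) :
    ehr (comb v '' stdSimplex ℝ (Fin r)) c t =
      ((pts v ((t : ℝ) • ratVec c) t).ncard : ℚ) := by
  rw [ehr, latCount, pts]
  congr 3
  ext x
  constructor
  · rintro ⟨_, ⟨y, hy, rfl⟩, hx⟩
    obtain ⟨l, h0, hs, hl⟩ := (mem_smul_hull hr t.cast_nonneg).1 (Set.smul_mem_smul_set hy)
    refine ⟨l, h0, hs, ?_⟩
    rw [← hl, ← hx]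
    simp [smul_add]
  · rintro ⟨l, h0, hs, hl⟩
    obtain ⟨y, hy, hyl⟩ := (mem_smul_hull hr t.cast_nonneg).2 ⟨l, h0, hs, rfl⟩
    refine ⟨_, ⟨y, hy, rfl⟩, ?_⟩
    simp only at hyl
    rw [hl, ← hyl]
    simp [smul_add]

theorem ncard_pts_add (v : Fin r → Fin d → ℤ) (w : Fin d → ℝ) (z : Fin d → ℤ) (n : ℕ) :
    (pts v (w + castVec z) n).ncard = (pts v w n).ncard := by
  symm
  refine Set.ncard_congr (fun x _ => x + z) ?_ (fun _ _ _ _ h => add_right_cancel h) ?_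
  · rintro x ⟨l, h0, hs, hl⟩
    exact ⟨l, h0, hs, by rw [castVec_add, hl]; abel⟩
  · rintro x ⟨l, h0, hs, hl⟩
    refine ⟨x - z, ⟨l, h0, hs, ?_⟩, by simp⟩
    have := castVec_add (x - z) z
    rw [sub_add_cancel, hl] at this
    rw [← add_right_cancel_iff (a := castVec z), ← this]
    abel

theorem denv_pos (c : Fin d → ℚ) : 0 < denv c := by
  refine Nat.pos_of_ne_zero fun h => ?_
  rw [denv, Finset.lcm_eq_zero_iff] at h
  obtain ⟨i, -, hi⟩ := h
  exact (c i).den_nz hi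

theorem exists_denv_smul (c : Fin d → ℚ) :
    ∃ z : Fin d → ℤ, (denv c : ℝ) • ratVec c = castVec z := by
  have h : ∀ i, ∃ m : ℕ, denv c = (c i).den * m := fun i => Finset.dvd_lcm (Finset.mem_univ i)
  choose m hm using h
  refine ⟨fun i => (c i).num * m i, ?_⟩
  ext i
  have e : (denv c : ℚ) * c i = (c i).num * m i := by
    rw [hm i]
    push_cast
    rw [mul_right_comm, mul_comm ((c i).den : ℚ), Rat.mul_den_eq_num]
  have e' := congrArg (fun q : ℚ => (q : ℝ)) e
  simpa [castVec, ratVec] using e'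

theorem ncard_pts_period (v : Fin r → Fin d → ℤ) (c : Fin d → ℚ) (k m n : ℕ) :
    (pts v (((k + denv c * m : ℕ) : ℝ) • ratVec c) n).ncard =
      (pts v ((k : ℝ) • ratVec c) n).ncard := by
  obtain ⟨z, hz⟩ := exists_denv_smul c
  rw [← ncard_pts_add v ((k : ℝ) • ratVec c) (m • z)]
  congr 2
  have : castVec (m • z) = (m : ℝ) • castVec z := by ext i; simp [castVec]
  rw [this, ← hz, smul_smul, ← add_smul]
  push_cast
  ring_nf

theorem gcdProperty_iff {v : Fin r → Fin d → ℤ} (hr : 0 < r) (c : Fin d → ℚ) :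
    GCDProperty (ehr (comb v '' stdSimplex ℝ (Fin r)) c) (denv c) ↔
      ∀ k ℓ : ℕ, Nat.gcd (denv c) k = Nat.gcd (denv c) ℓ → ∀ t : ℕ,
        (pts v ((k : ℝ) • ratVec c) t).ncard = (pts v ((ℓ : ℝ) • ratVec c) t).ncard := by
  choose q hq using fun k : ℕ => exists_poly v ⟨0, hr⟩ ((k : ℝ) • ratVec c)
  have hmod : ∀ k n : ℕ, (pts v (((k % denv c : ℕ) : ℝ) • ratVec c) n).ncard =
      (pts v ((k : ℝ) • ratVec c) n).ncard := fun k n => by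
    conv_rhs => rw [← Nat.mod_add_div k (denv c)]
    rw [ncard_pts_period]
  have hpos := denv_pos c
  have hf : ∀ f, IsConstituents (ehr (comb v '' stdSimplex ℝ (Fin r)) c) (denv c) f →
      ∀ k, f (k % denv c) = q k := by
    intro f hf k
    refine Polynomial.eq_of_infinite_eval_eq _ _ ?_
    refine Set.infinite_of_injective_forall_mem
      (f := fun m : ℕ => ((k + denv c * (m + 1) : ℕ) : ℚ)) ?_ ?_
    · intro m m' h
      simp only [Nat.cast_inj, Nat.add_left_cancel_iff] at h
      have := Nat.eq_of_mul_eq_mul_left hpos h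
      omega
    · intro m
      have h1 := hf (k + denv c * (m + 1)) (by positivity)
      rw [Nat.add_mul_mod_self_left, ehr_eq hr, ncard_pts_period] at h1
      simp only [Set.mem_ofPred_eq]
      rw [← h1, hq]
  constructor
  · intro h k ℓ hkl t
    have hc : IsConstituents (ehr (comb v '' stdSimplex ℝ (Fin r)) c) (denv c) q := by
      intro t _
      rw [ehr_eq hr, ← hmod, hq]
    have := h q hc k ℓ hkl
    rw [hf q hc, hf q hc] at this
    have h1 := hq k t
    rw [this, ← hq ℓ t] at h1
    exact_mod_cast h1
  · intro h f hc k ℓ hkl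
    rw [hf f hc, hf f hc]
    refine Polynomial.eq_of_infinite_eval_eq _ _ ?_
    refine Set.infinite_of_injective_forall_mem (f := fun m : ℕ => (m : ℚ)) Nat.cast_injective ?_
    intro m
    simp only [Set.mem_ofPred_eq]
    rw [← hq, ← hq, h k ℓ hkl]

end Count

section Edges

variable {d r : ℕ}

/-- Two integer vectors span the same rational subspace. -/
def Par (x y : Fin d → ℤ) : Prop := ∃ a b : ℤ, a ≠ 0 ∧ b ≠ 0 ∧ a • x = b • y

theorem Par.refl (x : Fin d → ℤ) : Par x x := ⟨1, 1, one_ne_zero, one_ne_zero, rfl⟩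

theorem Par.symm {x y : Fin d → ℤ} (h : Par x y) : Par y x := by
  obtain ⟨a, b, ha, hb, h⟩ := h
  exact ⟨b, a, hb, ha, h.symm⟩

theorem Par.trans {x y z : Fin d → ℤ} (h : Par x y) (h' : Par y z) : Par x z := by
  obtain ⟨a, b, ha, hb, h⟩ := h
  obtain ⟨a', b', ha', hb', h'⟩ := h'
  refine ⟨a' * a, b * b', mul_ne_zero ha' ha, mul_ne_zero hb hb', ?_⟩
  rw [mul_smul, h, smul_comm, h', mul_smul]

theorem Par.dotProduct_eq_zero {x y : Fin d → ℤ} (h : Par x y) {ℓ : Fin d → ℤ}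
    (hy : ℓ ⬝ᵥ y = 0) : ℓ ⬝ᵥ x = 0 := by
  obtain ⟨a, b, ha, -, h⟩ := h
  have := congrArg (fun z => ℓ ⬝ᵥ z) h
  simp only [dotProduct_smul, hy, smul_zero] at this
  exact (smul_eq_zero.1 this).resolve_left ha

theorem Par.ne_zero {x y : Fin d → ℤ} (h : Par x y) (hx : x ≠ 0) : y ≠ 0 := by
  obtain ⟨a, b, ha, -, h⟩ := h
  rintro rfl
  rw [smul_zero] at h
  exact hx ((smul_eq_zero.1 h).resolve_left ha)

/-- Parallelism as an equivalence relation. -/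
def parSetoid (d : ℕ) : Setoid (Fin d → ℤ) := ⟨Par, Par.refl, Par.symm, Par.trans⟩

/-- A representative of the parallelism class. -/
def rep (x : Fin d → ℤ) : Fin d → ℤ := (Quotient.mk (parSetoid d) x).out

theorem par_rep (x : Fin d → ℤ) : Par x (rep x) :=
  Par.symm (Quotient.exact (s := parSetoid d) (Quotient.out_eq (Quotient.mk (parSetoid d) x)))

theorem rep_eq {x y : Fin d → ℤ} (h : Par x y) : rep x = rep y := by
  rw [rep, rep, Quotient.sound (s := parSetoid d) h]

theorem dotProduct_self_pos_int {x : Fin d → ℤ} (hx : x ≠ 0) : 0 < x ⬝ᵥ x := by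
  refine lt_of_le_of_ne (Finset.sum_nonneg fun i _ => mul_self_nonneg _) (Ne.symm ?_)
  rwa [Ne, dotProduct_self_eq_zero]

/-- Large multiples dominate a fixed perturbation. -/
theorem exists_dominating {W : Finset (Fin d → ℤ)} (m : Fin d → ℤ) :
    ∃ M₀ : ℤ, 0 < M₀ ∧ ∀ M ≥ M₀, ∀ w ∈ W, ∀ a : Fin d → ℤ,
      (0 < a ⬝ᵥ w → 0 < (M • a + m) ⬝ᵥ w) ∧ (a ⬝ᵥ w < 0 → (M • a + m) ⬝ᵥ w < 0) := by
  refine ⟨1 + ∑ w ∈ W, |m ⬝ᵥ w|, ?_, fun M hM w hw a => ?_⟩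
  · have : 0 ≤ ∑ w ∈ W, |m ⬝ᵥ w| := Finset.sum_nonneg fun _ _ => abs_nonneg _
    linarith
  · have h1 := Finset.single_le_sum (f := fun w => |m ⬝ᵥ w|) (fun _ _ => abs_nonneg _) hw
    have h2 := neg_abs_le (m ⬝ᵥ w)
    have h3 := le_abs_self (m ⬝ᵥ w)
    have h4 := abs_nonneg (m ⬝ᵥ w)
    simp only [add_dotProduct, smul_dotProduct, smul_eq_mul]
    constructor <;> intro h <;> nlinarith

theorem exists_generic (W : Finset (Fin d → ℤ)) (hW : ∀ w ∈ W, w ≠ 0) :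
    ∃ m : Fin d → ℤ, ∀ w ∈ W, m ⬝ᵥ w ≠ 0 := by
  classical
  induction W using Finset.induction_on with
  | empty => exact ⟨0, by simp⟩
  | insert w W hwW ih =>
    obtain ⟨m, hm⟩ := ih fun x hx => hW x (Finset.mem_insert_of_mem hx)
    obtain ⟨M₀, -, h⟩ := exists_dominating (W := insert w W) w
    refine ⟨M₀ • m + w, fun x hx => ?_⟩
    have hx' := h M₀ le_rfl x hx m
    rcases lt_trichotomy (m ⬝ᵥ x) 0 with hc | hc | hc
    · exact (hx'.2 hc).ne
    · rcases Finset.mem_insert.1 hx with rfl | hxW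
      · simp only [add_dotProduct, smul_dotProduct, smul_eq_mul, hc, mul_zero, zero_add]
        exact (dotProduct_self_pos_int (hW x hx)).ne'
      · exact absurd hc (hm x hxW)
    · exact (hx'.1 hc).ne.symm

/-- Every integer functional can be perturbed to a generic one. -/
theorem exists_generic_perturbation (W : Finset (Fin d → ℤ)) (hW : ∀ w ∈ W, w ≠ 0) :
    ∃ (m : Fin d → ℤ) (M₀ : ℤ), 0 < M₀ ∧ ∀ M ≥ M₀, ∀ w ∈ W, ∀ a : Fin d → ℤ,
      (M • a + m) ⬝ᵥ w ≠ 0 ∧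
      (0 < a ⬝ᵥ w → 0 < (M • a + m) ⬝ᵥ w) ∧ (a ⬝ᵥ w < 0 → (M • a + m) ⬝ᵥ w < 0) := by
  obtain ⟨m, hm⟩ := exists_generic W hW
  obtain ⟨M₀, h0, h⟩ := exists_dominating (W := W) m
  refine ⟨m, M₀, h0, fun M hM w hw a => ⟨?_, h M hM w hw a⟩⟩
  rcases lt_trichotomy (a ⬝ᵥ w) 0 with hc | hc | hc
  · exact ((h M hM w hw a).2 hc).ne
  · rw [add_dotProduct, smul_dotProduct, hc, smul_zero, zero_add]
    exact hm w hw
  · exact ((h M hM w hw a).1 hc).ne.symm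

/-- The index `i` maximizes `ℓ`. -/
def Top (v : Fin r → Fin d → ℤ) (ℓ : Fin d → ℤ) (i : Fin r) : Prop :=
  ∀ j, ℓ ⬝ᵥ v j ≤ ℓ ⬝ᵥ v i

/-- The index `i` maximizes `ℓ`, and `e` among the maximizers of `ℓ`. -/
def LexTop (v : Fin r → Fin d → ℤ) (ℓ e : Fin d → ℤ) (i : Fin r) : Prop :=
  Top v ℓ i ∧ ∀ j, Top v ℓ j → e ⬝ᵥ v j ≤ e ⬝ᵥ v i

/-- The functional `ℓ` vanishes on `e` and on no other direction of the configuration. -/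
def Gen (v : Fin r → Fin d → ℤ) (e ℓ : Fin d → ℤ) : Prop :=
  ℓ ⬝ᵥ e = 0 ∧ ∀ i j, ℓ ⬝ᵥ (v i - v j) = 0 → v i = v j ∨ Par (v i - v j) e

/-- All parallel edges of the configuration are translates of each other. -/
def EdgeProp (v : Fin r → Fin d → ℤ) : Prop :=
  ∀ e : Fin d → ℤ, e ≠ 0 → ∀ ℓ ℓ' i j i' j', Gen v e ℓ → Gen v e ℓ' →
    LexTop v ℓ e i → LexTop v ℓ (-e) j → LexTop v ℓ' e i' → LexTop v ℓ' (-e) j' →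
    v i - v j = v i' - v j'

theorem exists_top (v : Fin r → Fin d → ℤ) (hr : 0 < r) (ℓ : Fin d → ℤ) : ∃ i, Top v ℓ i := by
  have : Nonempty (Fin r) := ⟨⟨0, hr⟩⟩
  obtain ⟨i, -, hi⟩ := Finset.exists_max_image Finset.univ (fun i => ℓ ⬝ᵥ v i)
    Finset.univ_nonempty
  exact ⟨i, fun j => hi j (Finset.mem_univ j)⟩

theorem exists_lexTop (v : Fin r → Fin d → ℤ) (hr : 0 < r) (ℓ e : Fin d → ℤ) :
    ∃ i, LexTop v ℓ e i := by
  classical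
  obtain ⟨i₀, h₀⟩ := exists_top v hr ℓ
  obtain ⟨i, hi, hmax⟩ := Finset.exists_max_image (Finset.univ.filter (Top v ℓ))
    (fun i => e ⬝ᵥ v i) ⟨i₀, by simpa using h₀⟩
  simp only [Finset.mem_filter, Finset.mem_univ, true_and] at hi hmax
  exact ⟨i, hi, hmax⟩

theorem EdgeProp.exists_edge {v : Fin r → Fin d → ℤ} (hv : EdgeProp v) {e : Fin d → ℤ}
    (he : e ≠ 0) : ∃ u : Fin d → ℤ,
      (∀ ℓ i j, Gen v e ℓ → LexTop v ℓ e i → LexTop v ℓ (-e) j → v i - v j = u) ∧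
      ∀ ℓ : Fin d → ℤ, (0 < ℓ ⬝ᵥ e → 0 ≤ ℓ ⬝ᵥ u) ∧ (ℓ ⬝ᵥ e < 0 → ℓ ⬝ᵥ u ≤ 0) := by
  by_cases h : ∃ ℓ i j, Gen v e ℓ ∧ LexTop v ℓ e i ∧ LexTop v ℓ (-e) j
  · obtain ⟨ℓ, i, j, hg, hi, hj⟩ := h
    refine ⟨v i - v j, fun ℓ' i' j' hg' hi' hj' =>
      hv e he ℓ' ℓ i' j' i j hg' hg hi' hj' hi hj, fun m => ?_⟩
    have heq : ℓ ⬝ᵥ v i = ℓ ⬝ᵥ v j := le_antisymm (hj.1 i) (hi.1 j)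
    have h0 : ℓ ⬝ᵥ (v i - v j) = 0 := by rw [dotProduct_sub, heq, sub_self]
    rcases hg.2 i j h0 with h1 | ⟨a, b, ha, hb, hab⟩
    · simp [h1]
    · have h1 := hi.2 j hj.1
      have h2 : 0 ≤ e ⬝ᵥ (v i - v j) := by rw [dotProduct_sub]; linarith
      have h3 := congrArg (fun z => e ⬝ᵥ z) hab
      have h4 := congrArg (fun z => m ⬝ᵥ z) hab
      simp only [dotProduct_smul, smul_eq_mul] at h3 h4
      have h5 := dotProduct_self_pos_int he
      have h6 : 0 ≤ a * b := by
        have : a * (a * (e ⬝ᵥ (v i - v j))) = a * b * (e ⬝ᵥ e) := by rw [h3]; ring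
        nlinarith [mul_self_nonneg a]
      have h7 : a * a * (m ⬝ᵥ (v i - v j)) = a * b * (m ⬝ᵥ e) := by
        rw [mul_assoc, h4]; ring
      have h8 : 0 < a * a := mul_self_pos.2 ha
      constructor <;> intro h <;> nlinarith
  · push Not at h
    exact ⟨0, fun ℓ i j hg hi hj => absurd hj (h ℓ i j hg hi), by simp⟩

/-- Representatives of the directions of the configuration. -/
def dirs (v : Fin r → Fin d → ℤ) : Finset (Fin d → ℤ) :=
  ((Finset.univ.image fun p : Fin r × Fin r => v p.1 - v p.2).filter (· ≠ 0)).image rep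

theorem ne_zero_of_mem_dirs {v : Fin r → Fin d → ℤ} {e : Fin d → ℤ} (he : e ∈ dirs v) :
    e ≠ 0 := by
  simp only [dirs, Finset.mem_image, Finset.mem_filter] at he
  obtain ⟨x, ⟨-, hx⟩, rfl⟩ := he
  exact (par_rep x).ne_zero hx

theorem eq_of_par_dirs {v : Fin r → Fin d → ℤ} {e f : Fin d → ℤ} (he : e ∈ dirs v)
    (hf : f ∈ dirs v) (h : Par e f) : e = f := by
  simp only [dirs, Finset.mem_image] at he hf
  obtain ⟨x, -, rfl⟩ := he
  obtain ⟨y, -, rfl⟩ := hf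
  exact rep_eq (((par_rep x).trans h).trans (par_rep y).symm)

theorem exists_dir (v : Fin r → Fin d → ℤ) {i j : Fin r} (h : v i ≠ v j) :
    ∃ e ∈ dirs v, Par (v i - v j) e := by
  refine ⟨rep (v i - v j), ?_, par_rep _⟩
  simp only [dirs, Finset.mem_image, Finset.mem_filter]
  exact ⟨_, ⟨⟨(i, j), Finset.mem_univ _, rfl⟩, sub_ne_zero.2 h⟩, rfl⟩

/-- Two functionals have the same nonzero sign on `x`. -/
def SameSign (ℓ ℓ' x : Fin d → ℤ) : Prop := 0 < (ℓ ⬝ᵥ x) * (ℓ' ⬝ᵥ x)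

theorem Par.sameSign {x y ℓ ℓ' : Fin d → ℤ} (h : Par x y) (hs : SameSign ℓ ℓ' y) :
    SameSign ℓ ℓ' x := by
  obtain ⟨a, b, ha, hb, h⟩ := h
  have h1 := congrArg (fun z => ℓ ⬝ᵥ z) h
  have h2 := congrArg (fun z => ℓ' ⬝ᵥ z) h
  simp only [dotProduct_smul, smul_eq_mul] at h1 h2
  unfold SameSign at *
  have h3 : a * a * ((ℓ ⬝ᵥ x) * (ℓ' ⬝ᵥ x)) = b * b * ((ℓ ⬝ᵥ y) * (ℓ' ⬝ᵥ y)) := by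
    calc _ = (a * (ℓ ⬝ᵥ x)) * (a * (ℓ' ⬝ᵥ x)) := by ring
      _ = _ := by rw [h1, h2]; ring
  have h4 : 0 < a * a := mul_self_pos.2 ha
  have h5 : 0 < b * b := mul_self_pos.2 hb
  have h6 : 0 < a * a * ((ℓ ⬝ᵥ x) * (ℓ' ⬝ᵥ x)) := by rw [h3]; positivity
  exact (pos_iff_pos_of_mul_pos h6).1 h4

theorem SameSign.pos_iff {ℓ ℓ' x : Fin d → ℤ} (h : SameSign ℓ ℓ' x) :
    0 < ℓ ⬝ᵥ x ↔ 0 < ℓ' ⬝ᵥ x := by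
  unfold SameSign at h
  constructor <;> intro h' <;> nlinarith

theorem top_unique {v : Fin r → Fin d → ℤ} {ℓ ℓ' : Fin d → ℤ}
    (h : ∀ e ∈ dirs v, SameSign ℓ ℓ' e) {i j : Fin r} (hi : Top v ℓ i) (hj : Top v ℓ' j) :
    v i = v j := by
  by_contra hne
  obtain ⟨e, he, hpar⟩ := exists_dir v hne
  have hs := hpar.sameSign (h e he)
  have h1 := hi j
  have h2 := hj i
  unfold SameSign at hs
  rw [dotProduct_sub, dotProduct_sub] at hs
  nlinarith

theorem top_crossing {v : Fin r → Fin d → ℤ} {ℓ ℓ' e : Fin d → ℤ} (he : e ∈ dirs v)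
    (hpos : 0 < ℓ ⬝ᵥ e) (hneg : ℓ' ⬝ᵥ e < 0) (h : ∀ f ∈ dirs v, f ≠ e → SameSign ℓ ℓ' f)
    {u : Fin d → ℤ}
    (hu : ∀ m i j, Gen v e m → LexTop v m e i → LexTop v m (-e) j → v i - v j = u)
    {i j : Fin r} (hi : Top v ℓ i) (hj : Top v ℓ' j) : v i - v j = u := by
  have hr : 0 < r := i.pos
  set m : Fin d → ℤ := (-(ℓ' ⬝ᵥ e)) • ℓ + (ℓ ⬝ᵥ e) • ℓ' with hm
  have hmd : ∀ x, m ⬝ᵥ x = -(ℓ' ⬝ᵥ e) * (ℓ ⬝ᵥ x) + (ℓ ⬝ᵥ e) * (ℓ' ⬝ᵥ x) := by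
    intro x
    rw [hm, add_dotProduct, smul_dotProduct, smul_dotProduct, smul_eq_mul, smul_eq_mul]
  have hme : m ⬝ᵥ e = 0 := by rw [hmd]; ring
  have hgen : Gen v e m := by
    refine ⟨hme, fun a b hab => ?_⟩
    by_contra! hcon
    obtain ⟨f, hf, hpar⟩ := exists_dir v hcon.1
    have hfe : f ≠ e := by rintro rfl; exact hcon.2 hpar
    have hs := hpar.sameSign (h f hf hfe)
    have hs' := hs.pos_iff
    unfold SameSign at hs
    rw [hmd] at hab
    rcases lt_trichotomy (ℓ ⬝ᵥ (v a - v b)) 0 with hc | hc | hc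
    · have : ℓ' ⬝ᵥ (v a - v b) < 0 := by nlinarith
      nlinarith
    · rw [hc, zero_mul] at hs; exact lt_irrefl _ hs
    · have := hs'.1 hc
      nlinarith
  obtain ⟨a, ha⟩ := exists_lexTop v hr m e
  obtain ⟨b, hb⟩ := exists_lexTop v hr m (-e)
  have hia : v i = v a := by
    by_contra hne
    obtain ⟨f, hf, hpar⟩ := exists_dir v hne
    have h1 := hi a
    have h2 := ha.1 i
    by_cases hfe : f = e
    · subst hfe
      have h3 : m ⬝ᵥ v i = m ⬝ᵥ v a := by
        have := hpar.dotProduct_eq_zero hme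
        rw [dotProduct_sub] at this; linarith
      have h4 := ha.2 i fun k => by rw [h3]; exact ha.1 k
      have h5 : SameSign ℓ f (v i - v a) := hpar.sameSign
        (mul_pos hpos (dotProduct_self_pos_int (ne_zero_of_mem_dirs he)))
      unfold SameSign at h5
      rw [dotProduct_sub, dotProduct_sub] at h5
      nlinarith
    · have hs := hpar.sameSign (h f hf hfe)
      have h3 : m ⬝ᵥ (v i - v a) ≤ 0 := by rw [dotProduct_sub]; linarith
      have h4 : 0 ≤ ℓ ⬝ᵥ (v i - v a) := by rw [dotProduct_sub]; linarith
      rw [hmd] at h3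
      unfold SameSign at hs
      rcases h4.eq_or_lt with h5 | h5
      · rw [← h5, zero_mul] at hs; exact lt_irrefl _ hs
      · have h6 : 0 < ℓ' ⬝ᵥ (v i - v a) := (pos_iff_pos_of_mul_pos hs).1 h5
        nlinarith
  have hjb : v j = v b := by
    by_contra hne
    obtain ⟨f, hf, hpar⟩ := exists_dir v hne
    have h1 := hj b
    have h2 := hb.1 j
    by_cases hfe : f = e
    · subst hfe
      have h3 : m ⬝ᵥ v j = m ⬝ᵥ v b := by
        have := hpar.dotProduct_eq_zero hme
        rw [dotProduct_sub] at this; linarith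
      have h4 := hb.2 j fun k => by rw [h3]; exact hb.1 k
      have h5 : SameSign (-ℓ') f (v j - v b) := hpar.sameSign
        (mul_pos (by rw [neg_dotProduct]; linarith)
          (dotProduct_self_pos_int (ne_zero_of_mem_dirs he)))
      unfold SameSign at h5
      rw [neg_dotProduct, dotProduct_sub, dotProduct_sub] at h5
      rw [neg_dotProduct, neg_dotProduct] at h4
      nlinarith
    · have hs := hpar.sameSign (h f hf hfe)
      have h3 : m ⬝ᵥ (v j - v b) ≤ 0 := by rw [dotProduct_sub]; linarith
      have h4 : 0 ≤ ℓ' ⬝ᵥ (v j - v b) := by rw [dotProduct_sub]; linarith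
      rw [hmd] at h3
      unfold SameSign at hs
      rcases h4.eq_or_lt with h5 | h5
      · rw [← h5, mul_zero] at hs; exact lt_irrefl _ hs
      · have h6 : 0 < ℓ ⬝ᵥ (v j - v b) := (pos_iff_pos_of_mul_pos hs).2 h5
        nlinarith
  rw [hia, hjb]
  exact hu m a b hgen ha hb

end Edges

section Vertices

variable {d r : ℕ}

theorem SameSign.symm {ℓ ℓ' x : Fin d → ℤ} (h : SameSign ℓ ℓ' x) : SameSign ℓ' ℓ x := by
  unfold SameSign at *
  rwa [mul_comm]

theorem SameSign.trans {ℓ ℓ' ℓ'' x : Fin d → ℤ} (h : SameSign ℓ ℓ' x)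
    (h' : SameSign ℓ' ℓ'' x) : SameSign ℓ ℓ'' x := by
  unfold SameSign at *
  rcases lt_trichotomy (ℓ' ⬝ᵥ x) 0 with hc | hc | hc
  · have h1 : ℓ ⬝ᵥ x < 0 := by nlinarith
    have h2 : ℓ'' ⬝ᵥ x < 0 := by nlinarith
    exact mul_pos_of_neg_of_neg h1 h2
  · rw [hc, mul_zero] at h; exact absurd h (lt_irrefl _)
  · exact mul_pos ((pos_iff_pos_of_mul_pos h).2 hc) ((pos_iff_pos_of_mul_pos h').1 hc)

/-- The vertex of the zonotope spanned by the `u e` in the direction `ℓ`. -/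
def zvert (v : Fin r → Fin d → ℤ) (u : (Fin d → ℤ) → Fin d → ℤ) (ℓ : Fin d → ℤ) : Fin d → ℤ :=
  ∑ e ∈ dirs v, if 0 < ℓ ⬝ᵥ e then u e else 0

/-- The vectors `u e` are the edges of the configuration in the direction `e`. -/
def IsEdges (v : Fin r → Fin d → ℤ) (u : (Fin d → ℤ) → Fin d → ℤ) : Prop :=
  ∀ e ∈ dirs v, ∀ m i j, Gen v e m → LexTop v m e i → LexTop v m (-e) j → v i - v j = u e

theorem zvert_congr {v : Fin r → Fin d → ℤ} (u : (Fin d → ℤ) → Fin d → ℤ) {ℓ ℓ' : Fin d → ℤ}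
    (h : ∀ e ∈ dirs v, SameSign ℓ ℓ' e) : zvert v u ℓ = zvert v u ℓ' :=
  Finset.sum_congr rfl fun e he => by simp only [(h e he).pos_iff]

theorem vertex_crossing {v : Fin r → Fin d → ℤ} {u : (Fin d → ℤ) → Fin d → ℤ}
    (hu : IsEdges v u) {ℓ ℓ' e : Fin d → ℤ} (he : e ∈ dirs v) (hpos : 0 < ℓ ⬝ᵥ e)
    (hneg : ℓ' ⬝ᵥ e < 0) (h : ∀ f ∈ dirs v, f ≠ e → SameSign ℓ ℓ' f) {i j : Fin r}
    (hi : Top v ℓ i) (hj : Top v ℓ' j) : v i - zvert v u ℓ = v j - zvert v u ℓ' := by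
  classical
  have h1 := top_crossing he hpos hneg h (hu e he) hi hj
  have h2 : zvert v u ℓ - zvert v u ℓ' = u e := by
    rw [zvert, zvert, ← Finset.sum_sub_distrib, Finset.sum_eq_single_of_mem e he]
    · simp [hpos, hneg.le]
    · intro f hf hfe
      simp only [(h f hf hfe).pos_iff, sub_self]
  rw [sub_eq_sub_iff_sub_eq_sub, h1, h2]

theorem vertex_of_general_position {v : Fin r → Fin d → ℤ} {u : (Fin d → ℤ) → Fin d → ℤ}
    (hu : IsEdges v u) {ℓ' : Fin d → ℤ} (hℓ' : ∀ e ∈ dirs v, ℓ' ⬝ᵥ e ≠ 0) {j : Fin r}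
    (hj : Top v ℓ' j) (n : ℕ) : ∀ ℓ : Fin d → ℤ, (∀ e ∈ dirs v, ℓ ⬝ᵥ e ≠ 0) →
      (∀ e ∈ dirs v, ∀ f ∈ dirs v, e ≠ f → (ℓ ⬝ᵥ e) * (ℓ' ⬝ᵥ f) ≠ (ℓ ⬝ᵥ f) * (ℓ' ⬝ᵥ e)) →
      {e | e ∈ dirs v ∧ ¬ SameSign ℓ ℓ' e}.ncard = n → ∀ i, Top v ℓ i →
      v i - zvert v u ℓ = v j - zvert v u ℓ' := by
  classical
  have hr : 0 < r := j.pos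
  have hfin : ∀ ℓ : Fin d → ℤ, {e | e ∈ dirs v ∧ ¬ SameSign ℓ ℓ' e}.Finite := fun ℓ =>
    (dirs v).finite_toSet.subset fun e he => he.1
  induction n with
  | zero =>
    intro ℓ _ _ hn i hi
    rw [Set.ncard_eq_zero (hfin ℓ)] at hn
    have h : ∀ e ∈ dirs v, SameSign ℓ ℓ' e := fun e he => by
      by_contra hs
      exact Set.eq_empty_iff_forall_notMem.1 hn e ⟨he, hs⟩
    rw [top_unique h hi hj, zvert_congr u h]
  | succ n ih =>
    intro ℓ hℓ hgp hn i hi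
    have hne : {e | e ∈ dirs v ∧ ¬ SameSign ℓ ℓ' e}.Nonempty := by
      rw [← Set.ncard_pos (hfin ℓ)]; omega
    obtain ⟨e, ⟨he, hse⟩, hmin⟩ := Set.exists_min_image _
      (fun g : Fin d → ℤ => ((|ℓ ⬝ᵥ g| : ℤ) : ℚ) / (|ℓ' ⬝ᵥ g| : ℤ)) (hfin ℓ) hne
    set m₀ : Fin d → ℤ := |ℓ' ⬝ᵥ e| • ℓ + |ℓ ⬝ᵥ e| • ℓ' with hm₀
    have hm₀d : ∀ x, m₀ ⬝ᵥ x = |ℓ' ⬝ᵥ e| * (ℓ ⬝ᵥ x) + |ℓ ⬝ᵥ e| * (ℓ' ⬝ᵥ x) := by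
      intro x
      rw [hm₀, add_dotProduct, smul_dotProduct, smul_dotProduct, smul_eq_mul, smul_eq_mul]
    have ha : 0 < |ℓ ⬝ᵥ e| := abs_pos.2 (hℓ e he)
    have hb : 0 < |ℓ' ⬝ᵥ e| := abs_pos.2 (hℓ' e he)
    have hopp : ∀ g ∈ dirs v, ¬ SameSign ℓ ℓ' g → (ℓ ⬝ᵥ g) * (ℓ' ⬝ᵥ g) < 0 := by
      intro g hg hs
      unfold SameSign at hs
      exact lt_of_le_of_ne (not_lt.1 hs) (mul_ne_zero (hℓ g hg) (hℓ' g hg))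
    have hm₀e : m₀ ⬝ᵥ e = 0 := by
      rw [hm₀d]
      rcases mul_neg_iff.1 (hopp e he hse) with ⟨h1, h2⟩ | ⟨h1, h2⟩
      · rw [abs_of_pos h1, abs_of_neg h2]; ring
      · rw [abs_of_neg h1, abs_of_pos h2]; ring
    have hm₀s : ∀ g ∈ dirs v, g ≠ e → SameSign ℓ m₀ g := by
      intro g hg hge
      unfold SameSign
      rw [hm₀d]
      by_cases hs : SameSign ℓ ℓ' g
      · unfold SameSign at hs
        have h1 : 0 < (ℓ ⬝ᵥ g) * (ℓ ⬝ᵥ g) := mul_self_pos.2 (hℓ g hg)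
        have h2 := mul_pos hb h1
        have h3 := mul_pos ha hs
        linarith
      · have hle := hmin g ⟨hg, hs⟩
        have hb' : 0 < |ℓ' ⬝ᵥ g| := abs_pos.2 (hℓ' g hg)
        have ha' : 0 < |ℓ ⬝ᵥ g| := abs_pos.2 (hℓ g hg)
        rw [div_le_div_iff₀ (by exact_mod_cast hb) (by exact_mod_cast hb')] at hle
        have hle' : |ℓ ⬝ᵥ e| * |ℓ' ⬝ᵥ g| ≤ |ℓ ⬝ᵥ g| * |ℓ' ⬝ᵥ e| := by exact_mod_cast hle
        have hopg := hopp g hg hs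
        have hope := hopp e he hse
        have hne' := hgp e he g hg (Ne.symm hge)
        have hlt : |ℓ ⬝ᵥ e| * |ℓ' ⬝ᵥ g| < |ℓ ⬝ᵥ g| * |ℓ' ⬝ᵥ e| := by
          refine lt_of_le_of_ne hle' fun heq => hne' ?_
          rcases mul_neg_iff.1 hope with ⟨h1, h2⟩ | ⟨h1, h2⟩ <;>
          rcases mul_neg_iff.1 hopg with ⟨h3, h4⟩ | ⟨h3, h4⟩ <;>
          simp only [abs_of_pos, abs_of_neg, h1, h2, h3, h4] at heq <;> linarith
        rcases mul_neg_iff.1 hopg with ⟨h3, h4⟩ | ⟨h3, h4⟩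
        · rw [abs_of_pos h3, abs_of_neg h4] at hlt
          refine mul_pos h3 ?_
          linarith
        · rw [abs_of_neg h3, abs_of_pos h4] at hlt
          refine mul_pos_of_neg_of_neg h3 ?_
          linarith
    obtain ⟨K, hK, hdom⟩ := exists_dominating (W := dirs v) ℓ'
    set m : Fin d → ℤ := K • m₀ + ℓ' with hm
    have hmd : ∀ x, m ⬝ᵥ x = K * (m₀ ⬝ᵥ x) + ℓ' ⬝ᵥ x := by
      intro x
      rw [hm, add_dotProduct, smul_dotProduct, smul_eq_mul]
    have hms : ∀ g ∈ dirs v, g ≠ e → SameSign ℓ m g := by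
      intro g hg hge
      refine (hm₀s g hg hge).trans ?_
      have h1 := hm₀s g hg hge
      have h2 := hdom K le_rfl g hg m₀
      unfold SameSign at h1 ⊢
      rcases lt_trichotomy (m₀ ⬝ᵥ g) 0 with hc | hc | hc
      · exact mul_pos_of_neg_of_neg hc (h2.2 hc)
      · rw [hc, mul_zero] at h1; exact absurd h1 (lt_irrefl _)
      · exact mul_pos hc (h2.1 hc)
    have hme : m ⬝ᵥ e = ℓ' ⬝ᵥ e := by rw [hmd, hm₀e, mul_zero, zero_add]
    have hmne : ∀ g ∈ dirs v, m ⬝ᵥ g ≠ 0 := by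
      intro g hg
      by_cases hge : g = e
      · rw [hge, hme]; exact hℓ' e he
      · have := hms g hg hge
        unfold SameSign at this
        exact (mul_ne_zero_iff.1 this.ne').2
    obtain ⟨k, hk⟩ := exists_top v hr m
    have hshift : v i - zvert v u ℓ = v k - zvert v u m := by
      rcases mul_neg_iff.1 (hopp e he hse) with ⟨h1, h2⟩ | ⟨h1, h2⟩
      · exact vertex_crossing hu he h1 (hme ▸ h2) hms hi hk
      · exact (vertex_crossing hu he (hme ▸ h2) h1 (fun f hf hfe => (hms f hf hfe).symm)
          hk hi).symm
    rw [hshift]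
    refine ih m hmne ?_ ?_ k hk
    · intro g hg h hh hgh heq
      refine hgp g hg h hh hgh ?_
      rw [hmd, hmd, hm₀d, hm₀d] at heq
      have h1 : (K * |ℓ' ⬝ᵥ e|) * ((ℓ ⬝ᵥ g) * (ℓ' ⬝ᵥ h)) =
          (K * |ℓ' ⬝ᵥ e|) * ((ℓ ⬝ᵥ h) * (ℓ' ⬝ᵥ g)) := by linarith
      exact mul_left_cancel₀ (mul_pos hK hb).ne' h1
    · have hset : {g | g ∈ dirs v ∧ ¬ SameSign m ℓ' g} =
          {g | g ∈ dirs v ∧ ¬ SameSign ℓ ℓ' g} \ {e} := by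
        ext g
        simp only [Set.mem_ofPred_eq, Set.mem_sdiff, Set.mem_singleton_iff]
        constructor
        · rintro ⟨hg, hs⟩
          have hge : g ≠ e := by
            rintro rfl
            refine hs ?_
            unfold SameSign
            rw [hme]
            exact mul_self_pos.2 (hℓ' g hg)
          exact ⟨⟨hg, fun h => hs ((hms g hg hge).symm.trans h)⟩, hge⟩
        · rintro ⟨⟨hg, hs⟩, hge⟩
          exact ⟨hg, fun h => hs ((hms g hg hge).trans h)⟩
      rw [hset, Set.ncard_sdiff_singleton_of_mem (Set.mem_ofPred_eq ▸ ⟨he, hse⟩), hn]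
      rfl

theorem vertex_constant {v : Fin r → Fin d → ℤ} {u : (Fin d → ℤ) → Fin d → ℤ}
    (hu : IsEdges v u) {ℓ ℓ' : Fin d → ℤ} (hℓ : ∀ e ∈ dirs v, ℓ ⬝ᵥ e ≠ 0)
    (hℓ' : ∀ e ∈ dirs v, ℓ' ⬝ᵥ e ≠ 0) {i j : Fin r} (hi : Top v ℓ i) (hj : Top v ℓ' j) :
    v i - zvert v u ℓ = v j - zvert v u ℓ' := by
  classical
  by_cases hd : dirs v = ∅
  · have h : ∀ e ∈ dirs v, SameSign ℓ ℓ' e := by simp [hd]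
    rw [top_unique h hi hj, zvert_congr u h]
  let W : Finset (Fin d → ℤ) := dirs v ∪
    ((dirs v ×ˢ dirs v).filter fun p => p.1 ≠ p.2).image
      fun p => (ℓ ⬝ᵥ p.1) • p.2 - (ℓ ⬝ᵥ p.2) • p.1
  have hW : ∀ w ∈ W, w ≠ 0 := by
    intro w hw
    rcases Finset.mem_union.1 hw with hw | hw
    · exact ne_zero_of_mem_dirs hw
    · obtain ⟨⟨e, f⟩, hp, rfl⟩ := Finset.mem_image.1 hw
      simp only [Finset.mem_filter, Finset.mem_product] at hp
      intro h
      refine hp.2 (eq_of_par_dirs hp.1.1 hp.1.2 ?_)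
      exact ⟨ℓ ⬝ᵥ f, ℓ ⬝ᵥ e, hℓ f hp.1.2, hℓ e hp.1.1, (sub_eq_zero.1 h).symm⟩
  obtain ⟨m, M₀, -, hm⟩ := exists_generic_perturbation W hW
  set ℓ'' : Fin d → ℤ := M₀ • ℓ' + m with hℓ''
  have hs : ∀ e ∈ dirs v, SameSign ℓ' ℓ'' e := by
    intro e he
    have := (hm M₀ le_rfl e (Finset.mem_union_left _ he) ℓ').2
    unfold SameSign
    rcases lt_or_gt_of_ne (hℓ' e he) with h | h
    · exact mul_pos_of_neg_of_neg h (this.2 h)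
    · exact mul_pos h (this.1 h)
  obtain ⟨k, hk⟩ := exists_top v i.pos ℓ''
  rw [top_unique hs hj hk, zvert_congr u hs]
  refine vertex_of_general_position hu
    (fun e he => (hm M₀ le_rfl e (Finset.mem_union_left _ he) ℓ').1) hk _ ℓ hℓ ?_ rfl i hi
  intro e he f hf hef heq
  have hmem : (ℓ ⬝ᵥ e) • f - (ℓ ⬝ᵥ f) • e ∈ W := by
    refine Finset.mem_union_right _ (Finset.mem_image.2 ⟨(e, f), ?_, rfl⟩)
    exact Finset.mem_filter.2 ⟨Finset.mem_product.2 ⟨he, hf⟩, hef⟩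
  have := (hm M₀ le_rfl _ hmem ℓ').1
  refine this ?_
  rw [← hℓ'']
  simp only [dotProduct_sub, dotProduct_smul, smul_eq_mul]
  linarith

end Vertices

section Hull

variable {d r : ℕ}

theorem castVec_dotProduct (x y : Fin d → ℤ) :
    castVec x ⬝ᵥ castVec y = ((x ⬝ᵥ y : ℤ) : ℝ) := by
  simp [castVec, dotProduct]

theorem dotProduct_comb {r : ℕ} (a : Fin d → ℝ) (v : Fin r → Fin d → ℤ) (l : Fin r → ℝ) :
    a ⬝ᵥ comb v l = ∑ i, l i * (a ⬝ᵥ castVec (v i)) := by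
  rw [comb_apply, dotProduct_sum]
  simp [dotProduct_smul]

theorem subset_of_support {A B : Set (Fin d → ℝ)} (hB : Convex ℝ B) (hBc : IsCompact B)
    (W : Finset (Fin d → ℤ)) (hW : ∀ w ∈ W, w ≠ 0)
    (h : ∀ ℓ : Fin d → ℤ, (∀ w ∈ W, ℓ ⬝ᵥ w ≠ 0) → ∀ x ∈ A, ∃ b ∈ B,
      castVec ℓ ⬝ᵥ x ≤ castVec ℓ ⬝ᵥ b) : A ⊆ B := by
  intro x hx
  by_contra hxB
  obtain ⟨f, s, hf, hs⟩ := geometric_hahn_banach_closed_point hB hBc.isClosed hxB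
  obtain ⟨C, hC⟩ := (hBc.isBounded.insert x).exists_norm_le
  obtain ⟨m, M₀, hM₀, hm⟩ := exists_generic_perturbation W hW
  have hC0 : 0 ≤ C := (norm_nonneg x).trans (hC x (Set.mem_insert _ _))
  set δ := f x - s with hδ
  have hδ0 : 0 < δ := by linarith
  obtain ⟨K, hK⟩ := exists_nat_gt (4 * C * d / δ)
  rw [div_lt_iff₀ hδ0] at hK
  set M : ℤ := M₀ + ∑ k, |m k| with hM
  have hsum : 0 ≤ ∑ k, |m k| := Finset.sum_nonneg fun _ _ => abs_nonneg _
  have hMm : ∀ k, |(m k : ℝ)| ≤ M := fun k => by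
    have := Finset.single_le_sum (f := fun k => |m k|) (fun _ _ => abs_nonneg _)
      (Finset.mem_univ k)
    have : |m k| ≤ M := by omega
    exact_mod_cast this
  have hM0 : (0 : ℝ) < M := by
    have : 0 < M := by omega
    exact_mod_cast this
  let g : Fin d → ℝ := fun k => f (Pi.single k 1)
  have hfg : ∀ y, f y = ∑ k, g k * y k := by
    intro y
    have : y = ∑ k, y k • (Pi.single k 1 : Fin d → ℝ) := by
      ext j; simp [Finset.sum_apply, Pi.single_apply]
    conv_lhs => rw [this, map_sum]
    simp only [map_smul, smul_eq_mul, g, mul_comm]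
  let a : Fin d → ℤ := fun k => ⌊K * g k⌋
  obtain ⟨b, hb, hle⟩ := h (M • a + m) (fun w hw => (hm M (by omega) w hw a).1) x hx
  have hy : ∀ k, |x k - b k| ≤ 2 * C := by
    intro k
    have h1 := (norm_le_pi_norm x k).trans (hC x (Set.mem_insert _ _))
    have h2 := (norm_le_pi_norm b k).trans (hC b (Set.mem_insert_of_mem _ hb))
    rw [Real.norm_eq_abs] at h1 h2
    calc |x k - b k| ≤ |x k| + |b k| := abs_sub _ _
      _ ≤ _ := by linarith
  have h1 : f x - f b = ∑ k, g k * (x k - b k) := by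
    rw [hfg, hfg, ← Finset.sum_sub_distrib]
    simp only [mul_sub]
  have h2 : castVec (M • a + m) ⬝ᵥ x - castVec (M • a + m) ⬝ᵥ b =
      ∑ k, (M * a k + m k : ℝ) * (x k - b k) := by
    rw [← dotProduct_sub, dotProduct]
    simp [castVec]
  have h3 : M * K * (f x - f b) - (castVec (M • a + m) ⬝ᵥ x - castVec (M • a + m) ⬝ᵥ b) ≤
      d * (M * 2 * (2 * C)) := by
    rw [h1, h2, Finset.mul_sum, ← Finset.sum_sub_distrib]
    calc _ ≤ ∑ _k : Fin d, (M * 2 * (2 * C) : ℝ) := Finset.sum_le_sum fun k _ => ?_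
      _ = _ := by simp
    have e : (M : ℝ) * K * (g k * (x k - b k)) - (M * a k + m k) * (x k - b k) =
        (M * (K * g k - a k) - m k) * (x k - b k) := by ring
    rw [e]
    refine (le_abs_self _).trans ?_
    rw [abs_mul]
    refine mul_le_mul ?_ (hy k) (abs_nonneg _) (by positivity)
    have f1 := Int.floor_le (K * g k)
    have f2 := Int.lt_floor_add_one (K * g k)
    have f3 := hMm k
    rw [abs_le] at f3 ⊢
    simp only [a]
    constructor <;> nlinarith
  have h4 : f b < s := hf b hb
  have h5 : M * (K * δ) < M * (K * (f x - f b)) := by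
    rcases Nat.eq_zero_or_pos K with h0 | h0
    · rw [h0] at hK
      have : 0 ≤ 4 * C * d := by positivity
      simp at hK
      linarith
    · have : (0 : ℝ) < K := by exact_mod_cast h0
      refine mul_lt_mul_of_pos_left (mul_lt_mul_of_pos_left ?_ this) hM0
      linarith
  have h6 : M * (4 * C * d) < M * (K * δ) := mul_lt_mul_of_pos_left hK hM0
  linarith

theorem zonotopeZ_eq {n : ℕ} (u : Fin n → Fin d → ℤ) :
    zonotopeZ u = comb u '' Set.Icc 0 1 := by
  ext x
  constructor
  · rintro ⟨l, hl, rfl⟩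
    exact ⟨l, ⟨fun i => (hl i).1, fun i => (hl i).2⟩, rfl⟩
  · rintro ⟨l, hl, rfl⟩
    exact ⟨l, fun i => ⟨hl.1 i, hl.2 i⟩, rfl⟩

theorem zonotope_of_edgeProp {v : Fin r → Fin d → ℤ} (hr : 0 < r) (hv : EdgeProp v) :
    ∃ (n : ℕ) (u : Fin n → Fin d → ℤ) (p : Fin d → ℤ),
      comb v '' stdSimplex ℝ (Fin r) = castVec p +ᵥ zonotopeZ u := by
  classical
  have hu : ∀ e : Fin d → ℤ, ∃ u : Fin d → ℤ, e ∈ dirs v →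
      (∀ ℓ i j, Gen v e ℓ → LexTop v ℓ e i → LexTop v ℓ (-e) j → v i - v j = u) ∧
      ∀ ℓ : Fin d → ℤ, (0 < ℓ ⬝ᵥ e → 0 ≤ ℓ ⬝ᵥ u) ∧ (ℓ ⬝ᵥ e < 0 → ℓ ⬝ᵥ u ≤ 0) := by
    intro e
    by_cases he : e ∈ dirs v
    · obtain ⟨u, hu⟩ := hv.exists_edge (ne_zero_of_mem_dirs he)
      exact ⟨u, fun _ => hu⟩
    · exact ⟨0, fun h => absurd h he⟩
  choose u hu using hu
  have hedge : IsEdges v u := fun e he => (hu e he).1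
  obtain ⟨ℓ₀, hℓ₀⟩ := exists_generic (dirs v) fun _ => ne_zero_of_mem_dirs
  obtain ⟨i₀, hi₀⟩ := exists_top v hr ℓ₀
  set p := v i₀ - zvert v u ℓ₀ with hp
  let E : Fin (dirs v).card → Fin d → ℤ := fun i => ((dirs v).equivFin.symm i : Fin d → ℤ)
  have hE : ∀ i, E i ∈ dirs v := fun i => ((dirs v).equivFin.symm i).2
  have hsum : ∀ (f : (Fin d → ℤ) → Fin d → ℤ), ∑ e ∈ dirs v, f e = ∑ i, f (E i) := by
    intro f
    rw [← Finset.sum_coe_sort]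
    exact (Equiv.sum_comp (dirs v).equivFin.symm fun x : {x // x ∈ dirs v} => f x).symm
  refine ⟨(dirs v).card, fun i => u (E i), p, ?_⟩
  -- the vertex in a generic direction
  have hvert : ∀ ℓ : Fin d → ℤ, (∀ e ∈ dirs v, ℓ ⬝ᵥ e ≠ 0) → ∀ i, Top v ℓ i →
      v i = p + ∑ j, if 0 < ℓ ⬝ᵥ E j then u (E j) else 0 := by
    intro ℓ hℓ i hi
    have := vertex_constant hedge hℓ hℓ₀ hi hi₀
    rw [← hp, zvert, hsum] at this
    rw [← this]; abel
  rw [zonotopeZ_eq]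
  refine Set.Subset.antisymm ?_ ?_
  · refine subset_of_support ((convex_Icc _ _).linear_image _ |>.vadd _) ?_ (dirs v)
      (fun _ => ne_zero_of_mem_dirs) ?_
    · exact (isCompact_Icc.image (LinearMap.continuous_of_finiteDimensional _)).vadd _
    · rintro ℓ hℓ _ ⟨l, hl, rfl⟩
      obtain ⟨i, hi⟩ := exists_top v hr ℓ
      refine ⟨castVec (v i), ?_, ?_⟩
      · refine ⟨_, ⟨fun j => if 0 < ℓ ⬝ᵥ E j then 1 else 0, ⟨fun j => ?_, fun j => ?_⟩, rfl⟩, ?_⟩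
        · simp only; split_ifs <;> simp
        · simp only; split_ifs <;> simp
        · rw [hvert ℓ hℓ i hi, castVec_add]
          ext k
          simp only [vadd_eq_add, Pi.add_apply, comb_apply_apply, castVec, Finset.sum_apply]
          congr 1
          push_cast
          refine Finset.sum_congr rfl fun j _ => ?_
          split_ifs <;> simp
      · rw [dotProduct_comb, ← one_mul (castVec ℓ ⬝ᵥ castVec (v i)), ← hl.2, Finset.sum_mul]
        refine Finset.sum_le_sum fun j _ => mul_le_mul_of_nonneg_left ?_ (hl.1 j)
        rw [castVec_dotProduct, castVec_dotProduct]
        exact_mod_cast hi j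
  · refine subset_of_support ((convex_stdSimplex ℝ (Fin r)).linear_image _) ?_ (dirs v)
      (fun _ => ne_zero_of_mem_dirs) ?_
    · exact (isCompact_stdSimplex ℝ (Fin r)).image (LinearMap.continuous_of_finiteDimensional _)
    · rintro ℓ hℓ _ ⟨_, ⟨l, hl, rfl⟩, rfl⟩
      obtain ⟨i, hi⟩ := exists_top v hr ℓ
      refine ⟨castVec (v i), ⟨Pi.single i 1, single_mem_stdSimplex ℝ _, ?_⟩, ?_⟩
      · simp [comb, Fintype.linearCombination_apply_single]
      · change castVec ℓ ⬝ᵥ (castVec p + comb (fun i => u (E i)) l) ≤ _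
        rw [hvert ℓ hℓ i hi, castVec_add, dotProduct_add, dotProduct_add,
          castVec_dotProduct _ (∑ j, _), dotProduct_sum, dotProduct_comb]
        push_cast
        refine add_le_add le_rfl (Finset.sum_le_sum fun j _ => ?_)
        rw [castVec_dotProduct]
        have h1 := (hu (E j) (hE j)).2 ℓ
        have h2 := hl.1 j
        have h3 := hl.2 j
        simp only [Pi.zero_apply, Pi.one_apply] at h2 h3
        rcases lt_or_gt_of_ne (hℓ (E j) (hE j)) with h | h
        · rw [if_neg (not_lt.2 h.le)]
          have : ((ℓ ⬝ᵥ u (E j) : ℤ) : ℝ) ≤ 0 := by exact_mod_cast h1.2 h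
          simp only [dotProduct_zero, Int.cast_zero]
          nlinarith
        · rw [if_pos h]
          have : (0 : ℝ) ≤ ((ℓ ⬝ᵥ u (E j) : ℤ) : ℝ) := by exact_mod_cast h1.1 h
          nlinarith

end Hull

section EdgesOfZonotope

variable {d r : ℕ}

theorem castVec_mem_hull (v : Fin r → Fin d → ℤ) (i : Fin r) :
    castVec (v i) ∈ comb v '' stdSimplex ℝ (Fin r) :=
  ⟨Pi.single i 1, single_mem_stdSimplex ℝ _, by simp [comb, Fintype.linearCombination_apply_single]⟩

theorem castVec_sub (x y : Fin d → ℤ) : castVec (x - y) = castVec x - castVec y := by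
  ext i; simp [castVec]

/-- A convex combination attaining the maximum of `f` uses only maximizers. -/
theorem eq_of_weighted_max {f : Fin r → ℝ} {l : Fin r → ℝ} (hl : l ∈ stdSimplex ℝ (Fin r))
    {M : ℝ} (hM : ∀ i, l i ≠ 0 → f i ≤ M) (h : M ≤ ∑ i, l i * f i) {i : Fin r} (hi : l i ≠ 0) :
    f i = M := by
  have h0 : ∀ j ∈ Finset.univ, 0 ≤ l j * (M - f j) := fun j _ => by
    by_cases hj : l j = 0
    · simp [hj]
    · exact mul_nonneg (hl.1 j) (sub_nonneg.2 (hM j hj))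
  have h1 : ∑ j, l j * (M - f j) ≤ 0 := by
    simp only [mul_sub, Finset.sum_sub_distrib, ← Finset.sum_mul, hl.2]
    linarith
  have h2 := (Finset.sum_eq_zero_iff_of_nonneg h0).1 (le_antisymm h1 (Finset.sum_nonneg h0)) i
    (Finset.mem_univ i)
  have := (mul_eq_zero.1 h2).resolve_left hi
  linarith

theorem LexTop.eq {v : Fin r → Fin d → ℤ} {e ℓ : Fin d → ℤ} (he : e ≠ 0) (hg : Gen v e ℓ)
    {i j : Fin r} (hi : LexTop v ℓ e i) (hj : LexTop v ℓ e j) : v i = v j := by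
  have h1 : ℓ ⬝ᵥ (v i - v j) = 0 := by
    rw [dotProduct_sub]; have := hi.1 j; have := hj.1 i; linarith
  refine (hg.2 i j h1).resolve_right fun ⟨a, b, _, hb, hab⟩ => ?_
  have h2 : e ⬝ᵥ (v i - v j) = 0 := by
    rw [dotProduct_sub]; have := hi.2 j hj.1; have := hj.2 i hi.1; linarith
  have h3 := congrArg (fun z => e ⬝ᵥ z) hab
  simp only [dotProduct_smul, h2, smul_eq_mul, mul_zero] at h3
  exact (mul_ne_zero hb (dotProduct_self_pos_int he).ne') h3.symm

theorem par_castVec {x e : Fin d → ℤ} (h : Par x e) : ∃ s : ℝ, castVec x = s • castVec e := by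
  obtain ⟨a, b, ha, -, hab⟩ := h
  refine ⟨b / a, ?_⟩
  ext k
  have h1 := congrFun hab k
  simp only [Pi.smul_apply, smul_eq_mul] at h1
  have h2 : (a : ℝ) * x k = b * e k := by exact_mod_cast h1
  have h3 : (a : ℝ) ≠ 0 := by exact_mod_cast ha
  simp only [castVec, Pi.smul_apply, smul_eq_mul]
  field_simp
  linarith

/-- Points of the hull maximizing a functional are combinations of maximizers. -/
theorem top_of_max {v : Fin r → Fin d → ℤ} {ℓ : Fin d → ℤ} {l : Fin r → ℝ}
    (hl : l ∈ stdSimplex ℝ (Fin r))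
    (h : ∀ i, castVec ℓ ⬝ᵥ castVec (v i) ≤ castVec ℓ ⬝ᵥ comb v l) {i : Fin r} (hi : l i ≠ 0) :
    Top v ℓ i := by
  have h1 := eq_of_weighted_max hl (fun i _ => h i) (dotProduct_comb _ _ _).le hi
  intro j
  have h2 := h j
  rw [← h1, castVec_dotProduct, castVec_dotProduct] at h2
  exact_mod_cast h2

theorem eq_comb_of_lexMax {v : Fin r → Fin d → ℤ} {e ℓ : Fin d → ℤ} (he : e ≠ 0)
    (hg : Gen v e ℓ) {i : Fin r} (hi : LexTop v ℓ e i) {l : Fin r → ℝ}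
    (hl : l ∈ stdSimplex ℝ (Fin r))
    (h : ∀ i, castVec ℓ ⬝ᵥ castVec (v i) ≤ castVec ℓ ⬝ᵥ comb v l)
    (h' : ∀ i, Top v ℓ i → castVec e ⬝ᵥ castVec (v i) ≤ castVec e ⬝ᵥ comb v l) :
    comb v l = castVec (v i) := by
  have h1 : ∀ j, l j ≠ 0 → v j = v i := fun j hj => by
    refine LexTop.eq he hg ⟨top_of_max hl h hj, fun k hk => ?_⟩ hi
    have h2 := eq_of_weighted_max hl (fun k hk => h' k (top_of_max hl h hk))
      (dotProduct_comb _ _ _).le hj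
    have h3 := h' k hk
    rw [← h2, castVec_dotProduct, castVec_dotProduct] at h3
    exact_mod_cast h3
  rw [comb_apply, ← one_smul ℝ (castVec (v i)), ← hl.2, Finset.sum_smul]
  refine Finset.sum_congr rfl fun j _ => ?_
  by_cases hj : l j = 0
  · simp [hj]
  · rw [h1 j hj]

theorem exists_smul_of_top {v : Fin r → Fin d → ℤ} {e ℓ : Fin d → ℤ}
    (hg : Gen v e ℓ) {l : Fin r → ℝ} (hl : l ∈ stdSimplex ℝ (Fin r))
    (h : ∀ i, castVec ℓ ⬝ᵥ castVec (v i) ≤ castVec ℓ ⬝ᵥ comb v l) {i : Fin r}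
    (hi : Top v ℓ i) : ∃ s : ℝ, comb v l = castVec (v i) + s • castVec e := by
  have h1 : ∀ j, ∃ s : ℝ, l j • castVec (v j) = l j • castVec (v i) + s • castVec e := fun j => by
    by_cases hj : l j = 0
    · exact ⟨0, by simp [hj]⟩
    · have hj' := top_of_max hl h hj
      have h2 : ℓ ⬝ᵥ (v j - v i) = 0 := by
        rw [dotProduct_sub]; have := hi j; have := hj' i; linarith
      rcases hg.2 j i h2 with h3 | h3
      · exact ⟨0, by simp [h3]⟩
      · obtain ⟨s, hs⟩ := par_castVec h3
        refine ⟨l j * s, ?_⟩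
        rw [castVec_sub, sub_eq_iff_eq_add] at hs
        rw [hs, smul_add, smul_smul, add_comm]
  choose s hs using h1
  refine ⟨∑ j, s j, ?_⟩
  rw [comb_apply, Finset.sum_congr rfl fun j _ => hs j, Finset.sum_add_distrib,
    ← Finset.sum_smul, ← Finset.sum_smul, hl.2, one_smul]

/-- The coefficients of the lexicographic maximum of a zonotope. -/
def lexCoeff {n : ℕ} (u : Fin n → Fin d → ℝ) (x y : Fin d → ℝ) (j : Fin n) : ℝ :=
  if 0 < x ⬝ᵥ u j ∨ (x ⬝ᵥ u j = 0 ∧ 0 < y ⬝ᵥ u j) then 1 else 0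

theorem edgeProp_of_zonotope {n : ℕ} {v : Fin r → Fin d → ℤ} {u : Fin n → Fin d → ℝ}
    {p : Fin d → ℝ} (h : comb v '' stdSimplex ℝ (Fin r) = p +ᵥ zonotopeR u) : EdgeProp v := by
  have hmem : ∀ x, x ∈ comb v '' stdSimplex ℝ (Fin r) ↔
      ∃ lam : Fin n → ℝ, (∀ i, lam i ∈ Set.Icc (0 : ℝ) 1) ∧ x = p + ∑ i, lam i • u i := by
    intro x
    rw [h]
    constructor
    · rintro ⟨_, ⟨lam, h1, rfl⟩, rfl⟩; exact ⟨lam, h1, rfl⟩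
    · rintro ⟨lam, h1, rfl⟩; exact ⟨_, ⟨lam, h1, rfl⟩, rfl⟩
  have hdot : ∀ (x : Fin d → ℝ) (lam : Fin n → ℝ),
      x ⬝ᵥ (p + ∑ i, lam i • u i) = x ⬝ᵥ p + ∑ i, lam i * (x ⬝ᵥ u i) := by
    intro x lam
    simp [dotProduct_add, dotProduct_sum, dotProduct_smul]
  have hcoeff : ∀ x y j, lexCoeff u x y j ∈ Set.Icc (0 : ℝ) 1 := by
    intro x y j; unfold lexCoeff; split_ifs <;> simp
  -- a point of the zonotope maximizing `x`
  have hmax : ∀ (x : Fin d → ℝ) (lam : Fin n → ℝ),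
      (∀ j, 0 < x ⬝ᵥ u j → lam j = 1) → (∀ j, x ⬝ᵥ u j < 0 → lam j = 0) →
      ∀ i, x ⬝ᵥ castVec (v i) ≤ x ⬝ᵥ (p + ∑ j, lam j • u j) := by
    intro x lam h1 h2 i
    obtain ⟨lam', h3, h4⟩ := (hmem _).1 (castVec_mem_hull v i)
    rw [h4, hdot, hdot]
    refine add_le_add le_rfl (Finset.sum_le_sum fun j _ => ?_)
    rcases lt_trichotomy (x ⬝ᵥ u j) 0 with hc | hc | hc
    · rw [h2 j hc, zero_mul]; exact mul_nonpos_of_nonneg_of_nonpos (h3 j).1 hc.le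
    · simp [hc]
    · rw [h1 j hc]; exact mul_le_mul_of_nonneg_right (h3 j).2 hc.le
  have hcp : ∀ x y j, 0 < x ⬝ᵥ u j → lexCoeff u x y j = 1 := fun x y j hj => by
    simp [lexCoeff, hj]
  have hcn : ∀ x y j, x ⬝ᵥ u j < 0 → lexCoeff u x y j = 0 := fun x y j hj => by
    simp [lexCoeff, hj.le, hj.ne]
  -- the lexicographic maximum
  have hlex : ∀ {e ℓ : Fin d → ℤ} {i}, e ≠ 0 → Gen v e ℓ → LexTop v ℓ e i →
      castVec (v i) = p + ∑ j, lexCoeff u (castVec ℓ) (castVec e) j • u j := by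
    intro e ℓ i he hg hi
    obtain ⟨l, hl, hle⟩ := (hmem _).2 ⟨_, hcoeff (castVec ℓ) (castVec e), rfl⟩
    have h1 := hmax (castVec ℓ) _ (hcp _ (castVec e)) (hcn _ (castVec e))
    rw [← hle] at h1 ⊢
    refine (eq_comb_of_lexMax he hg hi hl h1 fun k hk => ?_).symm
    obtain ⟨lam', h3, h4⟩ := (hmem _).1 (castVec_mem_hull v k)
    have h5 : castVec ℓ ⬝ᵥ castVec (v k) = castVec ℓ ⬝ᵥ comb v l := by
      refine le_antisymm (h1 k) ?_
      rw [dotProduct_comb, ← one_mul (castVec ℓ ⬝ᵥ castVec (v k)), ← hl.2, Finset.sum_mul]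
      refine Finset.sum_le_sum fun j _ => mul_le_mul_of_nonneg_left ?_ (hl.1 j)
      rw [castVec_dotProduct, castVec_dotProduct]
      exact_mod_cast hk j
    rw [hle, h4, hdot, hdot, add_right_inj] at h5
    have h6 : ∀ j ∈ Finset.univ, lam' j * (castVec ℓ ⬝ᵥ u j) ≤
        lexCoeff u (castVec ℓ) (castVec e) j * (castVec ℓ ⬝ᵥ u j) := by
      intro j _
      rcases lt_trichotomy (castVec ℓ ⬝ᵥ u j) 0 with hc | hc | hc
      · rw [hcn _ _ j hc, zero_mul]; exact mul_nonpos_of_nonneg_of_nonpos (h3 j).1 hc.le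
      · simp [hc]
      · rw [hcp _ _ j hc]; exact mul_le_mul_of_nonneg_right (h3 j).2 hc.le
    have h7 := (Finset.sum_eq_sum_iff_of_le h6).1 h5
    rw [hle, h4, hdot, hdot]
    refine add_le_add le_rfl (Finset.sum_le_sum fun j hj => ?_)
    by_cases hc : castVec ℓ ⬝ᵥ u j = 0
    · by_cases hc' : 0 < castVec e ⬝ᵥ u j
      · simp only [lexCoeff, hc, hc']
        simpa using mul_le_mul_of_nonneg_right (h3 j).2 hc'.le
      · simp only [lexCoeff, hc, hc']
        simpa using mul_nonpos_of_nonneg_of_nonpos (h3 j).1 (not_lt.1 hc')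
    · rw [mul_right_cancel₀ hc (h7 j hj)]
  -- generators orthogonal to a generic functional are parallel to the edge
  have hpar : ∀ {e ℓ : Fin d → ℤ} {i}, Gen v e ℓ → Top v ℓ i → ∀ j, castVec ℓ ⬝ᵥ u j = 0 →
      ∃ s : ℝ, u j = s • castVec e := by
    intro e ℓ i hg hi j hj
    have key : ∀ c : ℝ, c ∈ Set.Icc (0 : ℝ) 1 → ∃ s : ℝ,
        p + ∑ k, Function.update (lexCoeff u (castVec ℓ) 0) j c k • u k =
          castVec (v i) + s • castVec e := by
      intro c hc
      obtain ⟨l, hl, hle⟩ := (hmem _).2 ⟨Function.update (lexCoeff u (castVec ℓ) 0) j c, by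
        intro k
        by_cases hk : k = j
        · subst hk; simpa using hc
        · simpa [hk] using hcoeff _ _ _, rfl⟩
      rw [← hle]
      refine exists_smul_of_top hg hl ?_ hi
      rw [hle]
      refine hmax _ _ (fun k hk => ?_) fun k hk => ?_
      · have : k ≠ j := by rintro rfl; exact hk.ne' hj
        simp [this, hcp _ _ _ hk]
      · have : k ≠ j := by rintro rfl; exact hk.ne hj
        simp [this, hcn _ _ _ hk]
    obtain ⟨s, hs⟩ := key 1 (by simp)
    obtain ⟨s', hs'⟩ := key 0 (by simp)
    refine ⟨s - s', ?_⟩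
    have h1 : ∀ c : ℝ, ∑ k, Function.update (lexCoeff u (castVec ℓ) 0) j c k • u k =
        c • u j + ∑ k ∈ Finset.univ.erase j, lexCoeff u (castVec ℓ) 0 k • u k := by
      intro c
      rw [← Finset.add_sum_erase _ _ (Finset.mem_univ j), Function.update_self]
      congr 1
      refine Finset.sum_congr rfl fun k hk => ?_
      rw [Function.update_of_ne (Finset.ne_of_mem_erase hk)]
    rw [h1, one_smul] at hs
    rw [h1, zero_smul, zero_add] at hs'
    rw [sub_smul]
    linear_combination hs - hs'
  intro e he ℓ ℓ' i j i' j' hg hg' hi hj hi' hj'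
  have hneg : ∀ {m : Fin d → ℤ}, Gen v e m → Gen v (-e) m := fun {m} hm =>
    ⟨by rw [dotProduct_neg, hm.1, neg_zero], fun a b hab => (hm.2 a b hab).imp_right fun hp =>
      hp.trans ⟨1, -1, one_ne_zero, by norm_num, by simp⟩⟩
  have he' : -e ≠ 0 := neg_ne_zero.2 he
  have hcneg : castVec (-e) = -castVec e := by ext k; simp [castVec]
  have hdiff : ∀ {m : Fin d → ℤ} {a b}, Gen v e m → LexTop v m e a → LexTop v m (-e) b →
      castVec (v a - v b) = ∑ k, if castVec m ⬝ᵥ u k = 0 then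
        ((if 0 < castVec e ⬝ᵥ u k then (1 : ℝ) else 0) -
          if castVec e ⬝ᵥ u k < 0 then 1 else 0) • u k else 0 := by
    intro m a b hm ha hb
    rw [castVec_sub, hlex he hm ha, hlex he' (hneg hm) hb, add_sub_add_left_eq_sub,
      ← Finset.sum_sub_distrib]
    refine Finset.sum_congr rfl fun k _ => ?_
    rw [← sub_smul, hcneg]
    rcases lt_trichotomy (castVec m ⬝ᵥ u k) 0 with hc | hc | hc
    · rw [hcn _ _ _ hc, hcn _ _ _ hc, if_neg hc.ne]; simp
    · simp [lexCoeff, hc]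
    · rw [hcp _ _ _ hc, hcp _ _ _ hc, if_neg hc.ne']; simp
  apply castVec_injective
  rw [hdiff hg hi hj, hdiff hg' hi' hj']
  refine Finset.sum_congr rfl fun k _ => ?_
  have hzero : ∀ {m m' : Fin d → ℤ} {a}, Gen v e m → Gen v e m' → Top v m a →
      castVec m ⬝ᵥ u k = 0 → castVec m' ⬝ᵥ u k = 0 := by
    intro m m' a hm hm' ha hk
    obtain ⟨s, hs⟩ := hpar hm ha k hk
    rw [hs, dotProduct_smul, castVec_dotProduct, hm'.1]; simp
  by_cases hc : castVec ℓ ⬝ᵥ u k = 0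
  · rw [if_pos hc, if_pos (hzero hg hg' hi.1 hc)]
  · rw [if_neg hc, if_neg fun hc' => hc (hzero hg' hg hi'.1 hc')]

end EdgesOfZonotope

section Counting

variable {d n : ℕ}

/-- The integer lattice in `ℝ^d`. -/
def lat (d : ℕ) : AddSubgroup (Fin d → ℝ) where
  carrier := Set.range castVec
  add_mem' := by
    rintro _ _ ⟨x, rfl⟩ ⟨y, rfl⟩
    exact ⟨x + y, castVec_add x y⟩
  zero_mem' := ⟨0, by ext; simp [castVec]⟩
  neg_mem' := by
    rintro _ ⟨x, rfl⟩
    exact ⟨-x, by ext; simp [castVec]⟩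

theorem castVec_mem_lat (x : Fin d → ℤ) : castVec x ∈ lat d := ⟨x, rfl⟩

theorem comb_int_mem_lat (u : Fin n → Fin d → ℤ) (m : Fin n → ℤ) :
    comb u (fun i => (m i : ℝ)) ∈ lat d := by
  rw [comb_apply]
  exact (lat d).sum_mem fun i _ => by
    rw [Int.cast_smul_eq_zsmul]; exact (lat d).zsmul_mem (castVec_mem_lat _) _

/-- Half-open cell over `A`. -/
def halfOpen (u : Fin n → Fin d → ℤ) (t : ℕ) (w : Fin d → ℝ) (A : Finset (Fin n)) :
    Set (Fin n → ℝ) :=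
  {l | (∀ i ∉ A, l i = 0) ∧ (∀ i ∈ A, l i ∈ Set.Ico (0 : ℝ) t) ∧ w + comb u l ∈ lat d}

/-- Open cell over `A`. -/
def opn (u : Fin n → Fin d → ℤ) (t : ℕ) (w : Fin d → ℝ) (A : Finset (Fin n)) :
    Set (Fin n → ℝ) :=
  {l | (∀ i ∉ A, l i = 0) ∧ (∀ i ∈ A, l i ∈ Set.Ioo (0 : ℝ) t) ∧ w + comb u l ∈ lat d}

/-- The generators indexed by `A` are linearly independent. -/
def Indep (u : Fin n → Fin d → ℤ) (A : Finset (Fin n)) : Prop :=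
  ∀ μ : Fin n → ℝ, comb u μ = 0 → (∀ i ∉ A, μ i = 0) → μ = 0

theorem Indep.mono {u : Fin n → Fin d → ℤ} {A B : Finset (Fin n)} (h : Indep u A)
    (hB : B ⊆ A) : Indep u B :=
  fun μ hμ h0 => h μ hμ fun i hi => h0 i fun hi' => hi (hB hi')

theorem halfOpen_finite {u : Fin n → Fin d → ℤ} {A : Finset (Fin n)} (h : Indep u A) (t : ℕ)
    (w : Fin d → ℝ) : (halfOpen u t w A).Finite := by
  have hfin := (finite_lattice_of_coeff_le u w t).image castVec
  refine Set.Finite.of_finite_image (f := fun l => w + comb u l) (hfin.subset ?_) ?_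
  · rintro _ ⟨l, ⟨h0, h1, x, hx⟩, rfl⟩
    refine ⟨x, ⟨l, fun i => ?_, hx⟩, hx⟩
    by_cases hi : i ∈ A
    · rw [abs_of_nonneg (h1 i hi).1]; exact (h1 i hi).2.le
    · simp [h0 i hi]
  · intro l hl l' hl' heq
    simp only [add_right_inj] at heq
    refine sub_eq_zero.1 (h _ (by rw [map_sub, heq, sub_self]) fun i hi => ?_)
    simp [hl.1 i hi, hl'.1 i hi]

theorem ncard_halfOpen_le {u : Fin n → Fin d → ℤ} {A : Finset (Fin n)} (h : Indep u A) {t : ℕ}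
    (ht : 0 < t) {w w' : Fin d → ℝ} {j : ℤ} (hw : w' - j • w ∈ lat d) :
    (halfOpen u t w A).ncard ≤ (halfOpen u t w' A).ncard := by
  have ht' : (0 : ℝ) < t := by exact_mod_cast ht
  rcases (halfOpen u t w A).eq_empty_or_nonempty with h0 | ⟨l₀, hl₀⟩
  · simp [h0]
  have hmod : ∀ x : ℝ, ∃ m : ℤ, toIcoMod ht' 0 x = x - m * t := fun x =>
    ⟨toIcoDiv ht' 0 x, by rw [toIcoMod, zsmul_eq_mul]⟩
  refine Set.ncard_le_ncard_of_injOn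
    (fun l i => toIcoMod ht' 0 (l i + (j - 1) * l₀ i)) ?_ ?_ (halfOpen_finite h t w')
  · intro l hl
    refine ⟨fun i hi => ?_, fun i _ => ?_, ?_⟩
    · simp [hl.1 i hi, hl₀.1 i hi]
    · simpa using toIcoMod_mem_Ico ht' 0 (l i + (j - 1) * l₀ i)
    · choose m hm using fun i => hmod (l i + (j - 1) * l₀ i)
      have e : (fun i => toIcoMod ht' 0 (l i + (j - 1) * l₀ i)) =
          l + ((j : ℝ) - 1) • l₀ - fun i => ((m i * t : ℤ) : ℝ) := by
        ext i; rw [hm]; simp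
      rw [e, map_sub, map_add, map_smul]
      have e2 : w' + (comb u l + ((j : ℝ) - 1) • comb u l₀ - comb u fun i => ((m i * t : ℤ) : ℝ))
          = (w' - j • w) + (w + comb u l) + (j - 1) • (w + comb u l₀) -
            comb u fun i => ((m i * t : ℤ) : ℝ) := by
        ext k
        simp
        ring
      rw [e2]
      exact (lat d).sub_mem ((lat d).add_mem ((lat d).add_mem hw hl.2.2)
        ((lat d).zsmul_mem hl₀.2.2 _)) (comb_int_mem_lat u _)
  · intro l hl l' hl' heq
    ext i
    by_cases hi : i ∈ A
    · have h1 := congrFun heq i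
      simp only at h1
      obtain ⟨m, hm⟩ := hmod (l i + (j - 1) * l₀ i)
      obtain ⟨m', hm'⟩ := hmod (l' i + (j - 1) * l₀ i)
      rw [hm, hm'] at h1
      have h2 : l i - l' i = (m - m') * t := by linarith
      have h3 := hl.2.1 i hi
      have h4 := hl'.2.1 i hi
      have h5 : ((m - m' : ℤ) : ℝ) < 1 := by
        push_cast; refine lt_of_mul_lt_mul_right ?_ ht'.le; linarith [h3.2, h4.1]
      have h6 : (-1 : ℝ) < (m - m' : ℤ) := by
        push_cast; refine lt_of_mul_lt_mul_right ?_ ht'.le; linarith [h4.2, h3.1]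
      have h7 : m - m' < 1 := by exact_mod_cast h5
      have h8 : -1 < m - m' := by exact_mod_cast h6
      have h9 : m = m' := by omega
      rw [h9] at h2
      linarith
    · rw [hl.1 i hi, hl'.1 i hi]

theorem ncard_eq_sum_fiber {α β : Type*} [DecidableEq β] {S : Set α} (hS : S.Finite)
    (f : α → β) (T : Finset β) (h : ∀ x ∈ S, f x ∈ T) :
    S.ncard = ∑ b ∈ T, {x ∈ S | f x = b}.ncard := by
  classical
  rw [Set.ncard_eq_toFinset_card S hS,
    Finset.card_eq_sum_card_fiberwise (f := f) (t := T) fun x hx => h x (by simpa using hx)]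
  refine Finset.sum_congr rfl fun b _ => ?_
  rw [← Set.ncard_coe_finset]
  congr 1
  ext x
  simp

theorem ncard_halfOpen {u : Fin n → Fin d → ℤ} {A : Finset (Fin n)} (h : Indep u A) {t : ℕ}
    (ht : 0 < t) (w : Fin d → ℝ) :
    (halfOpen u t w A).ncard = ∑ S ∈ A.powerset, (opn u t w S).ncard := by
  classical
  have ht' : (0 : ℝ) < t := by exact_mod_cast ht
  rw [ncard_eq_sum_fiber (halfOpen_finite h t w)
    (fun l => Finset.univ.filter fun i => l i ≠ 0) A.powerset]
  · refine Finset.sum_congr rfl fun S hS => ?_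
    rw [Finset.mem_powerset] at hS
    congr 1
    ext l
    constructor
    · rintro ⟨⟨h0, h1, h2⟩, rfl⟩
      refine ⟨fun i hi => by simpa using hi, fun i hi => ?_, h2⟩
      have hi' : l i ≠ 0 := by simpa using hi
      have := h1 i (hS hi)
      exact ⟨lt_of_le_of_ne this.1 hi'.symm, this.2⟩
    · rintro ⟨h0, h1, h2⟩
      refine ⟨⟨fun i hi => h0 i fun hi' => hi (hS hi'), fun i _ => ?_, h2⟩, ?_⟩
      · by_cases hi : i ∈ S
        · exact ⟨(h1 i hi).1.le, (h1 i hi).2⟩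
        · rw [h0 i hi]; exact ⟨le_rfl, ht'⟩
      · ext i
        simp only [Finset.mem_filter, Finset.mem_univ, true_and]
        refine ⟨fun hi => by_contra fun hi' => hi (h0 i hi'), fun hi => (h1 i hi).1.ne'⟩
  · intro l hl
    rw [Finset.mem_powerset]
    intro i hi
    by_contra hi'
    simp [hl.1 i hi'] at hi

/-- Two translation classes generate the same cyclic group modulo the lattice. -/
def Equi (w w' : Fin d → ℝ) : Prop :=
  (∃ j : ℤ, w' - j • w ∈ lat d) ∧ ∃ j : ℤ, w - j • w' ∈ lat d

theorem ncard_opn {u : Fin n → Fin d → ℤ} {A : Finset (Fin n)} (h : Indep u A) {t : ℕ}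
    (ht : 0 < t) {w w' : Fin d → ℝ} (hw : Equi w w') :
    (opn u t w A).ncard = (opn u t w' A).ncard := by
  classical
  obtain ⟨⟨j, hj⟩, j', hj'⟩ := hw
  induction A using Finset.strongInduction with
  | H A ih =>
    have h1 : (halfOpen u t w A).ncard = (halfOpen u t w' A).ncard :=
      le_antisymm (ncard_halfOpen_le h ht hj) (ncard_halfOpen_le h ht hj')
    rw [ncard_halfOpen h ht, ncard_halfOpen h ht,
      ← Finset.add_sum_erase _ _ (Finset.mem_powerset_self A),
      ← Finset.add_sum_erase _ _ (Finset.mem_powerset_self A)] at h1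
    have h2 : ∑ S ∈ A.powerset.erase A, (opn u t w S).ncard =
        ∑ S ∈ A.powerset.erase A, (opn u t w' S).ncard := by
      refine Finset.sum_congr rfl fun S hS => ?_
      rw [Finset.mem_erase, Finset.mem_powerset] at hS
      exact ih S (lt_of_le_of_ne hS.2 hS.1) (h.mono hS.2)
    omega

/-- The coordinate functionals. -/
def coordFun (n : ℕ) (j : ℕ) : (Fin n → ℝ) →ₗ[ℝ] ℝ :=
  if h : j < n then LinearMap.proj ⟨j, h⟩ else 0

theorem coordFun_inj (μ : Fin n → ℝ) (h : ∀ j < n, coordFun n j μ = 0) : μ = 0 := by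
  ext i
  simpa [coordFun] using h i i.2

/-- Canonical coefficient vectors of the lattice points of a translated zonotope. -/
def canon (u : Fin n → Fin d → ℤ) (t : ℕ) (w : Fin d → ℝ) : Set (Fin n → ℝ) :=
  {l | (∀ i, l i ∈ Set.Icc (0 : ℝ) t) ∧
    Good n (coordFun n) (comb u) {i | l i = 0} {i | l i = t} ∧ w + comb u l ∈ lat d}

/-- Lattice points of a translated dilated zonotope. -/
def zpts (u : Fin n → Fin d → ℤ) (t : ℕ) (w : Fin d → ℝ) : Set (Fin d → ℤ) :=
  {x | ∃ l : Fin n → ℝ, (∀ i, l i ∈ Set.Icc (0 : ℝ) t) ∧ castVec x = w + comb u l}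

theorem ncard_zpts (u : Fin n → Fin d → ℤ) (t : ℕ) (w : Fin d → ℝ) :
    (zpts u t w).ncard = (canon u t w).ncard ∧ (canon u t w).Finite := by
  have hinj : Set.InjOn (fun l => w + comb u l) (canon u t w) := by
    intro l hl l' hl' heq
    simp only [add_right_inj] at heq
    exact good_unique coordFun_inj hl.1 hl'.1 hl.2.1 hl'.2.1 heq
  have himg : (fun l => w + comb u l) '' canon u t w = castVec '' zpts u t w := by
    ext y
    constructor
    · rintro ⟨l, ⟨h1, h2, x, hx⟩, rfl⟩
      exact ⟨x, ⟨l, h1, hx⟩, hx⟩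
    · rintro ⟨x, ⟨l₀, h1, hx⟩, rfl⟩
      obtain ⟨l, hl, he, hg⟩ := exists_good h1 n (coordFun n) (comb u)
      exact ⟨l, ⟨hl, hg, x, by rw [he, hx]⟩, by simp only [he, hx]⟩
  have hfin : (zpts u t w).Finite := by
    refine (finite_lattice_of_coeff_le u w t).subset ?_
    rintro x ⟨l, hl, hx⟩
    exact ⟨l, fun i => by rw [abs_of_nonneg (hl i).1]; exact (hl i).2, hx⟩
  refine ⟨?_, Set.Finite.of_finite_image (himg ▸ hfin.image _) hinj⟩
  rw [← Set.ncard_image_of_injective _ castVec_injective, ← himg, hinj.ncard_image]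

theorem ncard_canon_fiber {u : Fin n → Fin d → ℤ} {t : ℕ} (ht : 0 < t) {w w' : Fin d → ℝ}
    (hw : Equi w w') (A U : Finset (Fin n)) :
    {l ∈ canon u t w | (Finset.univ.filter fun i => l i ≠ 0 ∧ l i ≠ t,
        Finset.univ.filter fun i => l i = t) = (A, U)}.ncard =
      {l ∈ canon u t w' | (Finset.univ.filter fun i => l i ≠ 0 ∧ l i ≠ t,
        Finset.univ.filter fun i => l i = t) = (A, U)}.ncard := by
  classical
  have ht' : (0 : ℝ) < t := by exact_mod_cast ht
  set a : Fin n → ℝ := fun i => if i ∈ U then (t : ℝ) else 0 with ha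
  by_cases hgood : Disjoint A U ∧
      Good n (coordFun n) (comb u) {i | i ∉ A ∧ i ∉ U} {i | i ∈ U}
  · obtain ⟨hdisj, hgood⟩ := hgood
    have hind : Indep u A := by
      intro μ hμ h0
      refine hgood.eq_zero coordFun_inj hμ (fun i hi => h0 i hi.1) fun i hi => h0 i ?_
      exact fun hi' => Finset.disjoint_left.1 hdisj hi' hi
    have hacomb : comb u a ∈ lat d := by
      have : a = fun i => ((if i ∈ U then (t : ℤ) else 0 : ℤ) : ℝ) := by
        ext i; simp only [ha]; split_ifs <;> simp
      rw [this]; exact comb_int_mem_lat u _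
    have key : ∀ w : Fin d → ℝ, {l ∈ canon u t w |
        (Finset.univ.filter fun i => l i ≠ 0 ∧ l i ≠ t,
        Finset.univ.filter fun i => l i = t) = (A, U)} = (fun l => l + a) '' opn u t w A := by
      intro w
      ext l
      constructor
      · rintro ⟨⟨h1, h2, h3⟩, h4⟩
        rw [Prod.mk.injEq] at h4
        have hA : ∀ i, i ∈ A ↔ l i ≠ 0 ∧ l i ≠ t := fun i => by rw [← h4.1]; simp
        have hU : ∀ i, i ∈ U ↔ l i = t := fun i => by rw [← h4.2]; simp
        refine ⟨l - a, ⟨fun i hi => ?_, fun i hi => ?_, ?_⟩, sub_add_cancel l a⟩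
        · rw [hA] at hi
          by_cases hi' : i ∈ U
          · simp [ha, hi', (hU i).1 hi']
          · rw [hU] at hi'
            have : l i = 0 := by tauto
            simp [ha, hU, this, ht'.ne]
        · have hi' : i ∉ U := Finset.disjoint_left.1 hdisj hi
          have h5 := (hA i).1 hi
          simp only [ha, Pi.sub_apply, hi', if_false, sub_zero]
          exact ⟨lt_of_le_of_ne (h1 i).1 h5.1.symm, lt_of_le_of_ne (h1 i).2 h5.2⟩
        · rw [map_sub, ← add_sub_assoc]
          exact (lat d).sub_mem h3 hacomb
      · rintro ⟨l, ⟨h0, h1, h2⟩, rfl⟩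
        beta_reduce
        have e1 : ∀ i ∈ A, (l + a) i = l i := fun i hi => by
          simp [ha, Finset.disjoint_left.1 hdisj hi]
        have e2 : ∀ i ∈ U, (l + a) i = t := fun i hi => by
          simp [ha, hi, h0 i (Finset.disjoint_right.1 hdisj hi)]
        have e3 : ∀ i, i ∉ A → i ∉ U → (l + a) i = 0 := fun i hi hi' => by
          simp [ha, hi', h0 i hi]
        have eU : ∀ i, (l + a) i = t ↔ i ∈ U := fun i => by
          refine ⟨fun h => ?_, e2 i⟩
          by_contra hi
          by_cases hi' : i ∈ A
          · rw [e1 i hi'] at h; exact (h1 i hi').2.ne h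
          · rw [e3 i hi' hi] at h; exact ht'.ne h
        have e0 : ∀ i, (l + a) i = 0 ↔ i ∉ A ∧ i ∉ U := fun i => by
          refine ⟨fun h => ⟨fun hi => ?_, fun hi => ?_⟩, fun h => e3 i h.1 h.2⟩
          · rw [e1 i hi] at h; exact (h1 i hi).1.ne' h
          · rw [e2 i hi] at h; exact ht'.ne' h
        refine ⟨⟨fun i => ?_, ?_, ?_⟩, ?_⟩
        · by_cases hi : i ∈ A
          · rw [e1 i hi]; exact ⟨(h1 i hi).1.le, (h1 i hi).2.le⟩
          · by_cases hi' : i ∈ U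
            · rw [e2 i hi']; exact ⟨ht'.le, le_rfl⟩
            · rw [e3 i hi hi']; exact ⟨le_rfl, ht'.le⟩
        · simpa only [e0, eU] using hgood
        · rw [map_add, ← add_assoc]; exact (lat d).add_mem h2 hacomb
        · rw [Prod.mk.injEq]
          constructor
          · ext i
            simp only [Finset.mem_filter, Finset.mem_univ, true_and, ne_eq, e0, eU]
            have := fun hi : i ∈ A => Finset.disjoint_left.1 hdisj hi
            tauto
          · ext i
            simp only [Finset.mem_filter, Finset.mem_univ, true_and, eU]
    rw [key, key, Set.ncard_image_of_injective _ (add_left_injective a),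
      Set.ncard_image_of_injective _ (add_left_injective a), ncard_opn hind ht hw]
  · have key : ∀ w : Fin d → ℝ, {l ∈ canon u t w |
        (Finset.univ.filter fun i => l i ≠ 0 ∧ l i ≠ t,
        Finset.univ.filter fun i => l i = t) = (A, U)} = ∅ := by
      intro w
      refine Set.eq_empty_of_forall_notMem ?_
      rintro l ⟨⟨h1, h2, h3⟩, h4⟩
      rw [Prod.mk.injEq] at h4
      have hA : ∀ i, i ∈ A ↔ l i ≠ 0 ∧ l i ≠ t := fun i => by rw [← h4.1]; simp
      have hU : ∀ i, i ∈ U ↔ l i = t := fun i => by rw [← h4.2]; simp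
      refine hgood ⟨Finset.disjoint_left.2 fun i hi hi' => ?_, ?_⟩
      · exact ((hA i).1 hi).2 ((hU i).1 hi')
      · convert h2 using 2
        · ext i
          simp only [hA, hU]
          have : l i = 0 → l i ≠ t := fun h => by rw [h]; exact ht'.ne
          tauto
        · ext i
          simp only [hU]
    rw [key, key]

theorem ncard_zpts_eq (u : Fin n → Fin d → ℤ) {t : ℕ} (ht : 0 < t) {w w' : Fin d → ℝ}
    (hw : Equi w w') : (zpts u t w).ncard = (zpts u t w').ncard := by
  classical
  rw [(ncard_zpts u t w).1, (ncard_zpts u t w').1,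
    ncard_eq_sum_fiber (ncard_zpts u t w).2 (fun l => (Finset.univ.filter fun i => l i ≠ 0 ∧ l i ≠ t,
        Finset.univ.filter fun i => l i = t)) Finset.univ fun _ _ => Finset.mem_univ _,
    ncard_eq_sum_fiber (ncard_zpts u t w').2 (fun l => (Finset.univ.filter fun i => l i ≠ 0 ∧ l i ≠ t,
        Finset.univ.filter fun i => l i = t)) Finset.univ fun _ _ => Finset.mem_univ _]
  exact Finset.sum_congr rfl fun _ _ => ncard_canon_fiber ht hw _ _

theorem exists_int_combination {ρ k ℓ : ℕ} (h : Nat.gcd ρ k = Nat.gcd ρ ℓ) :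
    ∃ j m : ℤ, (ℓ : ℤ) - j * k = m * ρ := by
  have h1 : ((Nat.gcd ρ k : ℕ) : ℤ) ∣ ℓ := by
    rw [h]; exact_mod_cast Nat.gcd_dvd_right ρ ℓ
  obtain ⟨q, hq⟩ := h1
  refine ⟨q * Nat.gcdB ρ k, q * Nat.gcdA ρ k, ?_⟩
  rw [hq, Nat.gcd_eq_gcd_ab]
  ring

theorem smul_ratVec_sub_mem {c : Fin d → ℚ} {k ℓ : ℕ}
    (h : Nat.gcd (denv c) k = Nat.gcd (denv c) ℓ) :
    ∃ j : ℤ, (ℓ : ℝ) • ratVec c - j • ((k : ℝ) • ratVec c) ∈ lat d := by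
  obtain ⟨j, m, hjm⟩ := exists_int_combination h
  obtain ⟨z, hz⟩ := exists_denv_smul c
  refine ⟨j, ?_⟩
  have h1 : (ℓ : ℝ) - j * k = m * denv c := by exact_mod_cast hjm
  have h2 : (ℓ : ℝ) • ratVec c - j • ((k : ℝ) • ratVec c) = m • castVec z := by
    rw [← hz, ← Int.cast_smul_eq_zsmul ℝ, ← Int.cast_smul_eq_zsmul ℝ, smul_smul, smul_smul,
      ← sub_smul, h1]
  rw [h2]
  exact (lat d).zsmul_mem (castVec_mem_lat z) m

theorem equi_of_gcd {c : Fin d → ℚ} {k ℓ : ℕ} (h : Nat.gcd (denv c) k = Nat.gcd (denv c) ℓ) :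
    Equi ((k : ℝ) • ratVec c) ((ℓ : ℝ) • ratVec c) :=
  ⟨smul_ratVec_sub_mem h, smul_ratVec_sub_mem h.symm⟩

theorem pts_zero {r : ℕ} (v : Fin r → Fin d → ℤ) (w : Fin d → ℝ) :
    pts v w 0 = {x | castVec x = w} := by
  ext x
  constructor
  · rintro ⟨l, h0, hs, hx⟩
    have : l = 0 := by
      ext i
      exact (Finset.sum_eq_zero_iff_of_nonneg fun i _ => h0 i).1 (by simpa using hs) i
        (Finset.mem_univ i)
    simpa [this] using hx
  · intro hx
    exact ⟨0, by simp, by simp, by simpa using hx⟩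

theorem ncard_pts_zero_eq {r : ℕ} (v : Fin r → Fin d → ℤ) {w w' : Fin d → ℝ} (hw : Equi w w') :
    (pts v w 0).ncard = (pts v w' 0).ncard := by
  have hlat : w ∈ lat d ↔ w' ∈ lat d := by
    obtain ⟨⟨j, hj⟩, j', hj'⟩ := hw
    constructor
    · intro h
      simpa using (lat d).add_mem hj ((lat d).zsmul_mem h j)
    · intro h
      simpa using (lat d).add_mem hj' ((lat d).zsmul_mem h j')
  have key : ∀ w : Fin d → ℝ, (w ∈ lat d → (pts v w 0).ncard = 1) ∧
      (w ∉ lat d → (pts v w 0).ncard = 0) := by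
    intro w
    rw [pts_zero]
    constructor
    · rintro ⟨x, rfl⟩
      rw [Set.ncard_eq_one]
      exact ⟨x, by ext y; simp [castVec_injective.eq_iff]⟩
    · intro h
      have : {x : Fin d → ℤ | castVec x = w} = ∅ :=
        Set.eq_empty_of_forall_notMem fun x hx => h ⟨x, hx⟩
      rw [this, Set.ncard_empty]
  by_cases h : w ∈ lat d
  · rw [(key w).1 h, (key w').1 (hlat.1 h)]
  · rw [(key w).2 h, (key w').2 fun h' => h (hlat.2 h')]

theorem pts_eq_zpts {r : ℕ} (hr : 0 < r) {v : Fin r → Fin d → ℤ} {u : Fin n → Fin d → ℤ}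
    {p : Fin d → ℤ} (h : comb v '' stdSimplex ℝ (Fin r) = castVec p +ᵥ zonotopeZ u)
    (w : Fin d → ℝ) {t : ℕ} (ht : 0 < t) : pts v w t = zpts u t (w + castVec (t • p)) := by
  have ht' : (0 : ℝ) < t := by exact_mod_cast ht
  have hp : castVec (t • p) = (t : ℝ) • castVec p := by ext; simp [castVec]
  ext x
  have h1 : x ∈ pts v w t ↔ castVec x - w ∈ (t : ℝ) • (comb v '' stdSimplex ℝ (Fin r)) := by
    rw [mem_smul_hull hr ht'.le]
    exact exists_congr fun l => and_congr_right fun _ => and_congr_right fun _ =>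
      sub_eq_iff_eq_add'.symm
  rw [h1, h, zonotopeZ_eq]
  constructor
  · rintro ⟨_, ⟨_, ⟨l, hl, rfl⟩, rfl⟩, hx⟩
    refine ⟨(t : ℝ) • l, fun i => ⟨mul_nonneg ht'.le (hl.1 i), ?_⟩, ?_⟩
    · simpa using mul_le_mul_of_nonneg_left (hl.2 i) ht'.le
    · change (t : ℝ) • (castVec p + comb u l) = _ at hx
      rw [hp, map_smul, add_assoc, ← smul_add, hx]; abel
  · rintro ⟨l, hl, hx⟩
    refine ⟨_, ⟨_, ⟨(t : ℝ)⁻¹ • l, ⟨fun i => ?_, fun i => ?_⟩, rfl⟩, rfl⟩, ?_⟩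
    · exact mul_nonneg (inv_nonneg.2 ht'.le) (hl i).1
    · simpa [inv_mul_le_iff₀ ht'] using (hl i).2
    · change (t : ℝ) • (castVec p + comb u ((t : ℝ)⁻¹ • l)) = _
      rw [hx, hp, map_smul, smul_add, smul_smul, mul_inv_cancel₀ ht'.ne', one_smul]; abel

theorem gcdProperty_of_zonotopeZ {r : ℕ} (hr : 0 < r) {v : Fin r → Fin d → ℤ}
    {u : Fin n → Fin d → ℤ} {p : Fin d → ℤ}
    (h : comb v '' stdSimplex ℝ (Fin r) = castVec p +ᵥ zonotopeZ u) (c : Fin d → ℚ) :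
    GCDProperty (ehr (comb v '' stdSimplex ℝ (Fin r)) c) (denv c) := by
  rw [gcdProperty_iff hr]
  intro k ℓ hkl t
  have he := equi_of_gcd hkl
  rcases Nat.eq_zero_or_pos t with rfl | ht
  · exact ncard_pts_zero_eq v he
  · rw [← ncard_pts_add v _ (-(t • p)), ← ncard_pts_add v ((ℓ : ℝ) • ratVec c) (-(t • p)),
      pts_eq_zpts hr h _ ht, pts_eq_zpts hr h _ ht, add_assoc, add_assoc, ← castVec_add,
      neg_add_cancel]
    refine ncard_zpts_eq u ht ?_
    have : castVec (0 : Fin d → ℤ) = 0 := by ext; simp [castVec]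
    rwa [this, add_zero, add_zero]

end Counting

section CharacterSums

variable {d r : ℕ}

/-- Power sums over the lattice points of a dilate. -/
def charSum (v : Fin r → Fin d → ℤ) (n : ℕ) (ℓ : Fin d → ℤ) (z : ℂ) : ℂ :=
  ∑ y ∈ (pts_finite v 0 n).toFinset, z ^ (ℓ ⬝ᵥ y)

/-- Lift of a residue class. -/
def liftMod {p : ℕ} (α : Fin d → ZMod p) : Fin d → ℤ := fun i => ((α i).val : ℤ)

/-- The rational translation vector of a residue class. -/
def transMod {p : ℕ} (α : Fin d → ZMod p) : Fin d → ℚ := fun i => ((-(liftMod α i) : ℤ) : ℚ) / (p : ℤ)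

theorem exists_eq_liftMod_add {p : ℕ} [NeZero p] {y : Fin d → ℤ} {α : Fin d → ZMod p}
    (h : (fun i => (y i : ZMod p)) = α) : ∃ x : Fin d → ℤ, y = liftMod α + (p : ℤ) • x := by
  have h1 : ∀ i, ∃ x : ℤ, y i - liftMod α i = p * x := fun i => by
    have : ((y i - liftMod α i : ℤ) : ZMod p) = 0 := by
      rw [← h]; simp [liftMod]
    exact (ZMod.intCast_zmod_eq_zero_iff_dvd _ _).1 this
  choose x hx using h1
  refine ⟨x, funext fun i => ?_⟩
  have := hx i
  simp only [Pi.add_apply, Pi.smul_apply, smul_eq_mul]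
  omega

theorem castVec_liftMod {p : ℕ} [NeZero p] (α : Fin d → ZMod p) :
    castVec (liftMod α) = -((p : ℝ) • ratVec (transMod α)) := by
  have hp : (p : ℝ) ≠ 0 := by exact_mod_cast NeZero.ne p
  ext i
  simp only [castVec, ratVec, transMod, Pi.neg_apply, Pi.smul_apply, smul_eq_mul]
  push_cast
  field_simp

theorem ncard_pts_class {p : ℕ} [NeZero p] (v : Fin r → Fin d → ℤ) (t : ℕ)
    (α : Fin d → ZMod p) :
    {y ∈ pts v 0 (p * t) | (fun i => (y i : ZMod p)) = α}.ncard =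
      (pts v (ratVec (transMod α)) t).ncard := by
  have hp : (p : ℝ) ≠ 0 := by exact_mod_cast NeZero.ne p
  have hp' : (p : ℤ) ≠ 0 := by exact_mod_cast NeZero.ne p
  have hp0 : (0 : ℝ) ≤ p := Nat.cast_nonneg p
  symm
  have hcast : ∀ x : Fin d → ℤ, castVec (liftMod α + (p : ℤ) • x) =
      (p : ℝ) • (castVec x - ratVec (transMod α)) := fun x => by
    rw [castVec_add, castVec_liftMod, smul_sub]
    have : castVec ((p : ℤ) • x) = (p : ℝ) • castVec x := by ext; simp [castVec]
    rw [this]; abel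
  refine Set.ncard_congr (fun x _ => liftMod α + (p : ℤ) • x) ?_ ?_ ?_
  · rintro x ⟨l, h0, hs, hx⟩
    refine ⟨⟨(p : ℝ) • l, fun i => mul_nonneg hp0 (h0 i), ?_, ?_⟩, ?_⟩
    · simp [← Finset.mul_sum, hs]
    · rw [hcast, hx, map_smul]; simp
    · ext i; simp [liftMod]
  · intro x y _ _ h
    exact smul_right_injective _ hp' (add_left_cancel h)
  · rintro y ⟨⟨l, h0, hs, hy⟩, hα⟩
    obtain ⟨x, rfl⟩ := exists_eq_liftMod_add hα
    refine ⟨x, ⟨(p : ℝ)⁻¹ • l, fun i => mul_nonneg (inv_nonneg.2 hp0) (h0 i), ?_, ?_⟩, rfl⟩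
    · simp only [Pi.smul_apply, smul_eq_mul, ← Finset.mul_sum, hs]
      push_cast
      field_simp
    · rw [hcast, zero_add] at hy
      rw [map_smul, ← hy, smul_smul, inv_mul_cancel₀ hp, one_smul]; abel

theorem zpow_add_mul {p : ℕ} {z : ℂ} (hz : z ^ p = 1) (a b : ℤ) : z ^ (a + p * b) = z ^ a := by
  rcases Nat.eq_zero_or_pos p with rfl | hp
  · simp
  · have h0 : z ≠ 0 := by rintro rfl; simp [hp.ne'] at hz
    rw [zpow_add₀ h0, zpow_mul, zpow_natCast, hz, one_zpow, mul_one]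

theorem charSum_eq {p : ℕ} [NeZero p] (v : Fin r → Fin d → ℤ) (t : ℕ) (ℓ : Fin d → ℤ) {z : ℂ}
    (hz : z ^ p = 1) : charSum v (p * t) ℓ z =
      ∑ α : Fin d → ZMod p, ((pts v (ratVec (transMod α)) t).ncard : ℂ) * z ^ (ℓ ⬝ᵥ liftMod α) := by
  classical
  rw [charSum, ← Finset.sum_fiberwise_of_maps_to (g := fun y : Fin d → ℤ => fun i => (y i : ZMod p))
    (t := Finset.univ) fun _ _ => Finset.mem_univ _]
  refine Finset.sum_congr rfl fun α _ => ?_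
  rw [← ncard_pts_class, ← nsmul_eq_mul]
  have hset : {y ∈ pts v 0 (p * t) | (fun i => (y i : ZMod p)) = α} =
      (((pts_finite v 0 (p * t)).toFinset.filter fun y => (fun i => (y i : ZMod p)) = α :
        Finset (Fin d → ℤ)) : Set (Fin d → ℤ)) := by
    ext y; simp
  rw [hset, Set.ncard_coe_finset]
  refine Finset.sum_eq_card_nsmul fun y hy => ?_
  obtain ⟨x, rfl⟩ := exists_eq_liftMod_add (Finset.mem_filter.1 hy).2
  rw [dotProduct_add, dotProduct_smul, smul_eq_mul, zpow_add_mul hz]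

theorem charSum_congr {p : ℕ} (v : Fin r → Fin d → ℤ) (n : ℕ) {ℓ ℓ' : Fin d → ℤ} {z : ℂ}
    (hz : z ^ p = 1) {x : Fin d → ℤ} (h : ℓ' = ℓ + (p : ℤ) • x) :
    charSum v n ℓ' z = charSum v n ℓ z := by
  refine Finset.sum_congr rfl fun y _ => ?_
  rw [h, add_dotProduct, smul_dotProduct, smul_eq_mul, zpow_add_mul hz]

/-- The counting form of the GCD-property. -/
def GCDCount (v : Fin r → Fin d → ℤ) : Prop :=
  ∀ (c : Fin d → ℚ) (k ℓ : ℕ), Nat.gcd (denv c) k = Nat.gcd (denv c) ℓ → ∀ t : ℕ,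
    (pts v ((k : ℝ) • ratVec c) t).ncard = (pts v ((ℓ : ℝ) • ratVec c) t).ncard

theorem denv_transMod_dvd {p : ℕ} (α : Fin d → ZMod p) : denv (transMod α) ∣ p :=
  Finset.lcm_dvd fun i _ => by
    have := Rat.den_dvd (-(liftMod α i)) (p : ℤ)
    rw [Rat.divInt_eq_div] at this
    exact Int.natCast_dvd_natCast.1 this

theorem ncard_pts_smul {v : Fin r → Fin d → ℤ} (hv : GCDCount v) {p j : ℕ} [NeZero p]
    (hj : p.Coprime j) (α : Fin d → ZMod p) (t : ℕ) :
    (pts v (ratVec (transMod ((j : ZMod p) • α))) t).ncard =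
      (pts v (ratVec (transMod α)) t).ncard := by
  have hp : (p : ℝ) ≠ 0 := by exact_mod_cast NeZero.ne p
  obtain ⟨x, hx⟩ := exists_eq_liftMod_add (y := (j : ℤ) • liftMod α)
    (α := (j : ZMod p) • α) (by ext i; simp [liftMod])
  have h1 := congrArg castVec hx
  have h2 : castVec ((j : ℤ) • liftMod α) = (j : ℝ) • castVec (liftMod α) := by
    ext; simp [castVec]
  have h3 : castVec ((p : ℤ) • x) = (p : ℝ) • castVec x := by ext; simp [castVec]
  rw [castVec_add, h2, h3, castVec_liftMod, castVec_liftMod] at h1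
  have h4 : (p : ℝ) • ratVec (transMod ((j : ZMod p) • α)) =
      (p : ℝ) • ((j : ℝ) • ratVec (transMod α) + castVec x) := by
    rw [smul_add, smul_comm (p : ℝ) (j : ℝ)]
    rw [smul_neg] at h1
    linear_combination h1
  rw [smul_right_injective _ hp h4, ncard_pts_add]
  have h5 := hv (transMod α) j 1 (by
    rw [Nat.gcd_one_right]
    exact Nat.Coprime.coprime_dvd_left (denv_transMod_dvd α) hj) t
  rwa [Nat.cast_one, one_smul] at h5

theorem charSum_pow {v : Fin r → Fin d → ℤ} (hv : GCDCount v) {p : ℕ} (hp : p.Prime) {j : ℕ}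
    (hj : p.Coprime j) {n : ℕ} (hn : p ∣ n) (ℓ : Fin d → ℤ) {z : ℂ} (hz : z ^ p = 1) :
    charSum v n ℓ (z ^ j) = charSum v n ℓ z := by
  have : Fact p.Prime := ⟨hp⟩
  obtain ⟨t, rfl⟩ := hn
  rw [charSum_eq v t ℓ hz, charSum_eq v t ℓ (z := z ^ j) (by rw [← pow_mul, mul_comm, pow_mul, hz,
    one_pow])]
  have hj0 : (j : ZMod p) ≠ 0 := fun h => by
    rw [ZMod.natCast_eq_zero_iff] at h
    exact hp.one_lt.ne' (Nat.Coprime.eq_one_of_dvd hj h)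
  have hinj : Function.Injective fun α : Fin d → ZMod p => (j : ZMod p) • α :=
    smul_right_injective _ hj0
  refine Fintype.sum_bijective _ (Finite.injective_iff_bijective.1 hinj) _ _ fun α => ?_
  rw [ncard_pts_smul hv hj]
  congr 1
  obtain ⟨x, hx⟩ := exists_eq_liftMod_add (y := (j : ℤ) • liftMod α)
    (α := (j : ZMod p) • α) (by ext i; simp [liftMod])
  have h1 : (j : ℤ) * (ℓ ⬝ᵥ liftMod α) = ℓ ⬝ᵥ liftMod ((j : ZMod p) • α) + p * (ℓ ⬝ᵥ x) := by
    have := congrArg (fun y => ℓ ⬝ᵥ y) hx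
    simpa only [dotProduct_add, dotProduct_smul, smul_eq_mul] using this
  rw [← zpow_natCast z j, ← zpow_mul, h1, zpow_add_mul hz]

end CharacterSums

section GeneratingFunction

open Filter Topology

variable {d r : ℕ}

theorem hasSum_piAntidiag {ι : Type*} [DecidableEq ι] (s : Finset ι) {y : ι → ℂ}
    (hy : ∀ i, ‖y i‖ < 1) :
    (Summable fun n : ℕ => ‖∑ m ∈ s.piAntidiag n, ∏ i ∈ s, y i ^ m i‖) ∧
      HasSum (fun n : ℕ => ∑ m ∈ s.piAntidiag n, ∏ i ∈ s, y i ^ m i) (∏ i ∈ s, (1 - y i)⁻¹) := by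
  induction s using Finset.cons_induction with
  | empty =>
    have h : ∀ n : ℕ, n ≠ 0 →
        ∑ m ∈ (∅ : Finset ι).piAntidiag n, ∏ i ∈ (∅ : Finset ι), y i ^ m i = 0 := fun n hn => by
      simp [hn]
    refine ⟨summable_of_ne_finset_zero (s := {0}) fun n hn => ?_, ?_⟩
    · rw [h n (by simpa using hn), norm_zero]
    · have := hasSum_single 0 h
      simpa using this
  | cons j s hj ih =>
    have hgeo : Summable fun n : ℕ => ‖y j ^ n‖ := by
      simpa only [norm_pow] using summable_geometric_of_lt_one (norm_nonneg _) (hy j)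
    have hsplit : ∀ n : ℕ, ∑ m ∈ (Finset.cons j s hj).piAntidiag n,
        ∏ i ∈ Finset.cons j s hj, y i ^ m i = ∑ q ∈ Finset.HasAntidiagonal.antidiagonal n,
          y j ^ q.1 * ∑ m ∈ s.piAntidiag q.2, ∏ i ∈ s, y i ^ m i := fun n => by
      rw [Finset.piAntidiag_cons, Finset.sum_disjiUnion]
      refine Finset.sum_congr rfl fun q _ => ?_
      rw [Finset.sum_map, Finset.mul_sum]
      refine Finset.sum_congr rfl fun m hm => ?_
      have hmj : m j = 0 := by
        by_contra h
        exact hj ((Finset.mem_piAntidiag.1 hm).2 j h)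
      rw [Finset.prod_cons]
      congr 1
      · simp [hmj]
      · refine Finset.prod_congr rfl fun i hi => ?_
        have : i ≠ j := by rintro rfl; exact hj hi
        simp [this]
    simp only [hsplit]
    have hs := summable_norm_sum_mul_antidiagonal_of_summable_norm hgeo ih.1
    refine ⟨hs, ?_⟩
    have ht := tsum_mul_tsum_eq_tsum_sum_antidiagonal_of_summable_norm hgeo ih.1
    rw [Finset.prod_cons, ← tsum_geometric_of_norm_lt_one (hy j), ← ih.2.tsum_eq, ht]
    exact hs.of_norm.hasSum

/-- The generating function of the power sums. -/
def genFun (v : Fin r → Fin d → ℤ) (s : Fin r) (ℓ : Fin d → ℤ) (z T : ℂ) : ℂ :=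
  ∑ b ∈ (Box_finite v s 0).toFinset, z ^ (ℓ ⬝ᵥ latPt v 0 b) *
    (T ^ ht b * ∏ i ∈ idx s b, (1 - z ^ (ℓ ⬝ᵥ v i) * T)⁻¹)

theorem hasSum_charSum (v : Fin r → Fin d → ℤ) (s : Fin r) (ℓ : Fin d → ℤ) {z T : ℂ}
    (hz : ‖z‖ = 1) (hT : ‖T‖ < 1) :
    HasSum (fun n => charSum v n ℓ z * T ^ n) (genFun v s ℓ z T) := by
  have hz0 : z ≠ 0 := by rintro rfl; simp at hz
  have hf : (fun n => charSum v n ℓ z * T ^ n) = fun n =>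
      ∑ b ∈ (Box_finite v s 0).toFinset, z ^ (ℓ ⬝ᵥ latPt v 0 b) *
        if ht b ≤ n then T ^ ht b * ∑ m ∈ (idx s b).piAntidiag (n - ht b),
          ∏ i ∈ idx s b, (z ^ (ℓ ⬝ᵥ v i) * T) ^ m i else 0 := by
    ext n
    rw [charSum, sum_pts v s, Finset.sum_mul]
    refine Finset.sum_congr rfl fun b _ => ?_
    by_cases hn : ht b ≤ n
    · rw [if_pos hn, if_pos hn, Finset.mul_sum, Finset.mul_sum, Finset.sum_mul]
      refine Finset.sum_congr rfl fun m hm => ?_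
      rw [Finset.mem_piAntidiag] at hm
      have h1 : ∏ i ∈ idx s b, (z ^ (ℓ ⬝ᵥ v i) * T) ^ m i =
          z ^ (∑ i ∈ idx s b, (m i : ℤ) * (ℓ ⬝ᵥ v i)) * T ^ (n - ht b) := by
        simp only [mul_pow, Finset.prod_mul_distrib]
        rw [Finset.prod_pow_eq_pow_sum, hm.1]
        congr 1
        have h2 : ∀ t : Finset (Fin r), ∏ i ∈ t, (z ^ (ℓ ⬝ᵥ v i)) ^ m i =
            z ^ (∑ i ∈ t, (m i : ℤ) * (ℓ ⬝ᵥ v i)) := fun t => by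
          induction t using Finset.cons_induction with
          | empty => simp
          | cons i t hi ih =>
            rw [Finset.prod_cons, Finset.sum_cons, zpow_add₀ hz0, ih, ← zpow_natCast, ← zpow_mul,
              mul_comm (m i : ℤ)]
        exact h2 _
      have h3 : ∑ i ∈ idx s b, (m i : ℤ) * (ℓ ⬝ᵥ v i) = ℓ ⬝ᵥ ∑ i, m i • v i := by
        rw [dotProduct_sum, ← Finset.sum_subset (Finset.subset_univ (idx s b))]
        · refine Finset.sum_congr rfl fun i _ => ?_
          rw [dotProduct_smul, nsmul_eq_mul]
        · intro i _ hi
          have : m i = 0 := by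
            by_contra h
            exact hi (hm.2 i h)
          simp [this]
      rw [h1, h3, dotProduct_add, zpow_add₀ hz0]
      have h4 : T ^ n = T ^ ht b * T ^ (n - ht b) := by rw [← pow_add]; congr 1; omega
      rw [h4]; ring
    · simp [hn]
  rw [hf]
  refine hasSum_sum fun b _ => HasSum.mul_left _ ?_
  have hinj : Function.Injective fun n : ℕ => n + ht b := add_left_injective _
  rw [← hinj.hasSum_iff]
  · have : ((fun n => if ht b ≤ n then T ^ ht b * ∑ m ∈ (idx s b).piAntidiag (n - ht b),
          ∏ i ∈ idx s b, (z ^ (ℓ ⬝ᵥ v i) * T) ^ m i else 0) ∘ fun n : ℕ => n + ht b) =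
        fun n => T ^ ht b * ∑ m ∈ (idx s b).piAntidiag n,
          ∏ i ∈ idx s b, (z ^ (ℓ ⬝ᵥ v i) * T) ^ m i := by
      ext n; simp
    rw [this]
    refine ((hasSum_piAntidiag (idx s b) fun i => ?_).2).mul_left _
    rw [norm_mul, norm_zpow, hz, one_zpow, one_mul]
    exact hT
  · intro n hn
    rw [if_neg]
    intro h
    exact hn ⟨n - ht b, by simp only; omega⟩

/-- The generating function of the power sums over the multiples of `p`. -/
def filtGen (v : Fin r → Fin d → ℤ) (s : Fin r) (ℓ : Fin d → ℤ) (p : ℕ) (z T : ℂ) : ℂ :=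
  ∑ a ∈ Finset.range p, genFun v s ℓ z (z ^ a * T)

theorem sum_pow_mul {p : ℕ} {z : ℂ} (hz : IsPrimitiveRoot z p) (n : ℕ) :
    ∑ a ∈ Finset.range p, (z ^ a) ^ n = if p ∣ n then (p : ℂ) else 0 := by
  have h1 : ∀ a, (z ^ a) ^ n = (z ^ n) ^ a := fun a => by rw [← pow_mul, ← pow_mul, mul_comm]
  simp only [h1]
  split_ifs with h
  · simp [(hz.pow_eq_one_iff_dvd n).2 h]
  · have h2 : z ^ n ≠ 1 := fun h' => h ((hz.pow_eq_one_iff_dvd n).1 h')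
    rw [geom_sum_eq h2, ← pow_mul, mul_comm, pow_mul, hz.pow_eq_one, one_pow, sub_self, zero_div]

theorem hasSum_filtGen (v : Fin r → Fin d → ℤ) (s : Fin r) (ℓ : Fin d → ℤ) {p : ℕ} (hp : p ≠ 0)
    {z T : ℂ} (hz : IsPrimitiveRoot z p) (hT : ‖T‖ < 1) :
    HasSum (fun n => (if p ∣ n then (p : ℂ) * charSum v n ℓ z else 0) * T ^ n)
      (filtGen v s ℓ p z T) := by
  have hz1 : ‖z‖ = 1 := hz.norm'_eq_one hp
  have h := hasSum_sum (s := Finset.range p) fun a _ =>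
    hasSum_charSum v s ℓ (T := z ^ a * T) hz1 (by rwa [norm_mul, norm_pow, hz1, one_pow, one_mul])
  rw [filtGen]
  convert h using 2 with n
  simp only [mul_pow, ← mul_assoc, ← Finset.sum_mul, ← Finset.mul_sum, sum_pow_mul hz]
  split_ifs <;> simp [mul_comm]

theorem filtGen_congr {v : Fin r → Fin d → ℤ} {s s' : Fin r} {ℓ ℓ' : Fin d → ℤ} {p : ℕ}
    (hp : p ≠ 0) {z z' T : ℂ} (hz : IsPrimitiveRoot z p) (hz' : IsPrimitiveRoot z' p)
    (hT : ‖T‖ < 1) (h : ∀ n, p ∣ n → charSum v n ℓ z = charSum v n ℓ' z') :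
    filtGen v s ℓ p z T = filtGen v s' ℓ' p z' T := by
  refine (hasSum_filtGen v s ℓ hp hz hT).unique ?_
  convert hasSum_filtGen v s' ℓ' hp hz' hT using 2 with n
  split_ifs with hn
  · rw [h n hn]
  · rfl

/-- The members of the support on which `ℓ` has value `κ`. -/
def fib (v : Fin r → Fin d → ℤ) (s : Fin r) (ℓ : Fin d → ℤ) (b : Fin r → ℝ) (κ : ℤ) :
    Finset (Fin r) :=
  (idx s b).filter fun i => ℓ ⬝ᵥ v i = κ

/-- The contribution of a double pole. -/
def poleTerm (v : Fin r → Fin d → ℤ) (s : Fin r) (ℓ : Fin d → ℤ) (z : ℂ) (b : Fin r → ℝ)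
    (κ : ℤ) : ℂ :=
  if (fib v s ℓ b κ).card = 2 then
    z ^ (ℓ ⬝ᵥ latPt v 0 b - κ * ht b) *
      ∏ i ∈ (idx s b).filter (fun i => ℓ ⬝ᵥ v i ≠ κ), (1 - z ^ (ℓ ⬝ᵥ v i - κ))⁻¹ else 0

/-- The coefficient of the double pole of the filtered generating function. -/
def poleSum (v : Fin r → Fin d → ℤ) (s : Fin r) (ℓ : Fin d → ℤ) (z : ℂ) : ℂ :=
  ∑ b ∈ (Box_finite v s 0).toFinset, ∑ κ ∈ Finset.univ.image fun i => ℓ ⬝ᵥ v i,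
    poleTerm v s ℓ z b κ

theorem tendsto_pole (m : ℕ) (hm : m ≤ 2) :
    Tendsto (fun x : ℝ => (1 - (x : ℂ)) ^ 2 * ((1 - (x : ℂ))⁻¹) ^ m) (𝓝[<] 1)
      (𝓝 (if m = 2 then 1 else 0)) := by
  have hne : ∀ᶠ x : ℝ in 𝓝[<] 1, (1 - (x : ℂ)) ≠ 0 := by
    filter_upwards [self_mem_nhdsWithin] with x hx
    rw [sub_ne_zero]
    exact_mod_cast (ne_of_lt hx).symm
  have h0 : ∀ k : ℕ, Tendsto (fun x : ℝ => (1 - (x : ℂ)) ^ (k + 1)) (𝓝[<] 1) (𝓝 0) := fun k => by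
    have : Continuous fun x : ℝ => (1 - (x : ℂ)) ^ (k + 1) := by fun_prop
    have := (this.tendsto 1).mono_left (nhdsWithin_le_nhds (s := Set.Iio 1))
    simpa using this
  interval_cases m
  · simpa using h0 1
  · refine (Tendsto.congr' ?_ (h0 0))
    filter_upwards [hne] with x hx
    simp [pow_two, hx]
  · refine (Tendsto.congr' ?_ tendsto_const_nhds)
    filter_upwards [hne] with x hx
    simp only [if_true]
    field_simp

theorem tendsto_filtGen {v : Fin r → Fin d → ℤ} {s : Fin r} {ℓ : Fin d → ℤ} {p : ℕ}
    (hp : 0 < p) {z : ℂ} (hz : IsPrimitiveRoot z p)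
    (hpk : ∀ i j, (p : ℤ) ∣ ℓ ⬝ᵥ v i - ℓ ⬝ᵥ v j → ℓ ⬝ᵥ v i = ℓ ⬝ᵥ v j)
    (hfib : ∀ b ∈ Box v s 0, ∀ κ, (fib v s ℓ b κ).card ≤ 2) :
    Tendsto (fun x : ℝ => (1 - (x : ℂ)) ^ 2 * filtGen v s ℓ p z x) (𝓝[<] 1)
      (𝓝 (poleSum v s ℓ z)) := by
  have hz0 : z ≠ 0 := hz.ne_zero hp.ne'
  have hsum : poleSum v s ℓ z = ∑ a ∈ Finset.range p, ∑ b ∈ (Box_finite v s 0).toFinset,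
      ∑ κ ∈ Finset.univ.image fun i => ℓ ⬝ᵥ v i,
        if (p : ℤ) ∣ κ + a then poleTerm v s ℓ z b κ else 0 := by
    rw [Finset.sum_comm]
    refine Finset.sum_congr rfl fun b _ => ?_
    rw [Finset.sum_comm]
    refine Finset.sum_congr rfl fun κ _ => ?_
    have hp' : (0 : ℤ) < p := by exact_mod_cast hp
    have h1 := Int.emod_nonneg (-κ) hp'.ne'
    have h2 := Int.emod_lt_of_pos (-κ) hp'
    have h3 := Int.mul_ediv_add_emod (-κ) p
    rw [Finset.sum_eq_single ((-κ) % p).toNat]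
    · rw [if_pos]
      refine ⟨-(-κ / p), ?_⟩
      rw [Int.toNat_of_nonneg h1]
      linarith
    · intro a ha hne
      rw [if_neg]
      rintro ⟨c, hc⟩
      apply hne
      have h4 : -κ % p = a := by
        rw [show -κ = a + p * (-c) by linarith, Int.add_mul_emod_self_left]
        exact Int.emod_eq_of_lt (by positivity) (by exact_mod_cast Finset.mem_range.1 ha)
      rw [h4, Int.toNat_natCast]
    · intro h
      refine absurd (Finset.mem_range.2 ?_) h
      omega
  rw [hsum]
  simp only [filtGen, genFun, Finset.mul_sum]
  refine tendsto_finsetSum _ fun a _ => tendsto_finsetSum _ fun b hb => ?_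
  have hb' : b ∈ Box v s 0 := by simpa using hb
  set F := (idx s b).filter fun i => (p : ℤ) ∣ ℓ ⬝ᵥ v i + a with hF
  set F' := (idx s b).filter fun i => ¬ (p : ℤ) ∣ ℓ ⬝ᵥ v i + a with hF'
  have hcard : ∀ κ ∈ Finset.univ.image fun i => ℓ ⬝ᵥ v i, (p : ℤ) ∣ κ + a →
      F = fib v s ℓ b κ ∧ F' = (idx s b).filter fun i => ℓ ⬝ᵥ v i ≠ κ := by
    intro κ hκ hdvd
    obtain ⟨i, -, rfl⟩ := Finset.mem_image.1 hκ
    have key : ∀ j, (p : ℤ) ∣ ℓ ⬝ᵥ v j + a ↔ ℓ ⬝ᵥ v j = ℓ ⬝ᵥ v i := fun j => by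
      constructor
      · intro h
        refine hpk j i ?_
        have := dvd_sub h hdvd
        rwa [add_sub_add_right_eq_sub] at this
      · intro h; rwa [h]
    constructor
    · rw [hF, fib]; exact Finset.filter_congr fun j _ => key j
    · rw [hF']; exact Finset.filter_congr fun j _ => (key j).not
  have hFcard : F.card ≤ 2 := by
    rcases F.eq_empty_or_nonempty with h | ⟨i, hi⟩
    · simp [h]
    · rw [(hcard (ℓ ⬝ᵥ v i) (Finset.mem_image_of_mem _ (Finset.mem_univ i))
        (Finset.mem_filter.1 hi).2).1]
      exact hfib b hb' _
  have hone : ∀ m : ℤ, z ^ m * z ^ a = z ^ (m + a) := fun m => by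
    rw [zpow_add₀ hz0, zpow_natCast]
  have hprod : ∀ x : ℝ, ∏ i ∈ idx s b, (1 - z ^ (ℓ ⬝ᵥ v i) * (z ^ a * (x : ℂ)))⁻¹ =
      (1 - (x : ℂ))⁻¹ ^ F.card * ∏ i ∈ F', (1 - z ^ (ℓ ⬝ᵥ v i + a) * (x : ℂ))⁻¹ := fun x => by
    rw [← Finset.prod_filter_mul_prod_filter_not (idx s b) fun i => (p : ℤ) ∣ ℓ ⬝ᵥ v i + a]
    congr 1
    · rw [← Finset.prod_const]
      refine Finset.prod_congr rfl fun i hi => ?_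
      rw [← mul_assoc, hone, (hz.zpow_eq_one_iff_dvd _).2 (Finset.mem_filter.1 hi).2, one_mul]
    · refine Finset.prod_congr rfl fun i _ => ?_
      rw [← mul_assoc, hone]
  have hlim : Tendsto (fun x : ℝ => (1 - (x : ℂ)) ^ 2 * (z ^ (ℓ ⬝ᵥ latPt v 0 b) *
      ((z ^ a * (x : ℂ)) ^ ht b * ∏ i ∈ idx s b, (1 - z ^ (ℓ ⬝ᵥ v i) * (z ^ a * (x : ℂ)))⁻¹)))
      (𝓝[<] 1) (𝓝 ((if F.card = 2 then 1 else 0) * (z ^ (ℓ ⬝ᵥ latPt v 0 b) *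
        ((z ^ a) ^ ht b * ∏ i ∈ F', (1 - z ^ (ℓ ⬝ᵥ v i + a))⁻¹)))) := by
    have h1 : ContinuousAt (fun x : ℝ => z ^ (ℓ ⬝ᵥ latPt v 0 b) *
        ((z ^ a * (x : ℂ)) ^ ht b * ∏ i ∈ F', (1 - z ^ (ℓ ⬝ᵥ v i + a) * (x : ℂ))⁻¹)) 1 := by
      refine continuousAt_const.mul (ContinuousAt.mul (by fun_prop) ?_)
      refine tendsto_finsetProd _ fun i hi => ?_
      refine ContinuousAt.inv₀ (by fun_prop) ?_
      have : z ^ (ℓ ⬝ᵥ v i + a) ≠ 1 := fun h =>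
        (Finset.mem_filter.1 hi).2 ((hz.zpow_eq_one_iff_dvd _).1 h)
      simpa [sub_eq_zero] using this.symm
    have h2 := h1.tendsto.mono_left (nhdsWithin_le_nhds (s := Set.Iio 1))
    simp only [Complex.ofReal_one, mul_one] at h2
    refine ((tendsto_pole F.card hFcard).mul h2).congr fun x => ?_
    rw [hprod]; ring
  convert hlim using 2
  by_cases hex : ∃ κ ∈ Finset.univ.image fun i => ℓ ⬝ᵥ v i, (p : ℤ) ∣ κ + a
  · obtain ⟨κ, hκ, hdvd⟩ := hex
    obtain ⟨e1, e2⟩ := hcard κ hκ hdvd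
    rw [Finset.sum_eq_single κ, if_pos hdvd, poleTerm, ← e1, ← e2]
    · split_ifs
      · have hzκ : z ^ (-κ) = z ^ a := by
          have h1 := (hz.zpow_eq_one_iff_dvd _).2 hdvd
          rw [zpow_add₀ hz0, zpow_natCast] at h1
          rw [zpow_neg]
          exact inv_eq_of_mul_eq_one_right h1
        have h2 : z ^ (ℓ ⬝ᵥ latPt v 0 b - κ * ht b) =
            z ^ (ℓ ⬝ᵥ latPt v 0 b) * (z ^ a) ^ ht b := by
          rw [sub_eq_add_neg, zpow_add₀ hz0, ← neg_mul, zpow_mul, hzκ, zpow_natCast]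
        rw [one_mul, h2, mul_assoc]
        congr 2
        refine Finset.prod_congr rfl fun i _ => ?_
        have h3 : z ^ (ℓ ⬝ᵥ v i - κ) = z ^ (ℓ ⬝ᵥ v i) * z ^ a := by
          rw [sub_eq_add_neg (ℓ ⬝ᵥ v i) κ, zpow_add₀ hz0, hzκ]
        rw [h3, hone]
      · simp
    · intro κ' hκ' hne
      rw [if_neg]
      intro hdvd'
      obtain ⟨i, -, rfl⟩ := Finset.mem_image.1 hκ
      obtain ⟨j, -, rfl⟩ := Finset.mem_image.1 hκ'
      refine hne (hpk j i ?_)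
      have := dvd_sub hdvd' hdvd
      rwa [add_sub_add_right_eq_sub] at this
    · exact fun h => absurd hκ h
  · have hF0 : F = ∅ := by
      refine Finset.eq_empty_of_forall_notMem fun i hi => hex ⟨_, ?_, (Finset.mem_filter.1 hi).2⟩
      exact Finset.mem_image_of_mem _ (Finset.mem_univ i)
    rw [Finset.sum_eq_zero, hF0]
    · simp
    · intro κ hκ
      rw [if_neg fun h => hex ⟨κ, hκ, h⟩]

theorem poleSum_congr {v : Fin r → Fin d → ℤ} {s s' : Fin r} {ℓ ℓ' : Fin d → ℤ} {p : ℕ}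
    (hp : 0 < p) {z z' : ℂ} (hz : IsPrimitiveRoot z p) (hz' : IsPrimitiveRoot z' p)
    (hpk : ∀ i j, (p : ℤ) ∣ ℓ ⬝ᵥ v i - ℓ ⬝ᵥ v j → ℓ ⬝ᵥ v i = ℓ ⬝ᵥ v j)
    (hfib : ∀ b ∈ Box v s 0, ∀ κ, (fib v s ℓ b κ).card ≤ 2)
    (hpk' : ∀ i j, (p : ℤ) ∣ ℓ' ⬝ᵥ v i - ℓ' ⬝ᵥ v j → ℓ' ⬝ᵥ v i = ℓ' ⬝ᵥ v j)
    (hfib' : ∀ b ∈ Box v s' 0, ∀ κ, (fib v s' ℓ' b κ).card ≤ 2)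
    (h : ∀ n, p ∣ n → charSum v n ℓ z = charSum v n ℓ' z') :
    poleSum v s ℓ z = poleSum v s' ℓ' z' := by
  refine tendsto_nhds_unique_of_eventuallyEq (tendsto_filtGen hp hz hpk hfib)
    (tendsto_filtGen hp hz' hpk' hfib') ?_
  have hpos : ∀ᶠ x : ℝ in 𝓝[<] 1, 0 < x :=
    mem_nhdsWithin_of_mem_nhds (lt_mem_nhds one_pos)
  filter_upwards [self_mem_nhdsWithin, hpos] with x hx hx0
  rw [filtGen_congr hp.ne' hz hz' _ h]
  rw [Complex.norm_real, Real.norm_eq_abs, abs_of_pos hx0]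
  exact hx

end GeneratingFunction

section Constancy

variable {d r : ℕ}

theorem Gen.exists_smul {v : Fin r → Fin d → ℤ} {e ℓ : Fin d → ℤ} (hg : Gen v e ℓ) {i j : Fin r}
    (h : ℓ ⬝ᵥ v i = ℓ ⬝ᵥ v j) : ∃ σ : ℝ, castVec (v i) = castVec (v j) + σ • castVec e := by
  rcases hg.2 i j (by rw [dotProduct_sub, h, sub_self]) with h1 | h1
  · exact ⟨0, by simp [h1]⟩
  · obtain ⟨σ, hσ⟩ := par_castVec h1
    exact ⟨σ, by rw [← hσ, castVec_sub]; abel⟩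

theorem comb_single (v : Fin r → Fin d → ℤ) (i : Fin r) (a : ℝ) :
    comb v (Pi.single i a) = a • castVec (v i) := by
  simp [comb, Fintype.linearCombination_apply_single]

theorem fib_card_le {v : Fin r → Fin d → ℤ} {e ℓ : Fin d → ℤ} (hg : Gen v e ℓ) {s : Fin r}
    {w : Fin d → ℝ} {b : Fin r → ℝ} (hb : b ∈ Box v s w) (κ : ℤ) : (fib v s ℓ b κ).card ≤ 2 := by
  by_contra! hcard
  obtain ⟨i, hi, m, hm, j, hj, him, hij, hmj⟩ := Finset.two_lt_card.1 hcard
  simp only [fib, Finset.mem_filter] at hi hm hj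
  have key : ∀ α β : ℝ, α • castVec (v i) + β • castVec (v m) = (α + β) • castVec (v j) →
      α = 0 ∧ β = 0 := by
    intro α β h
    have h0 := (Adm_idx hb).eq_zero (μ := Pi.single i α + Pi.single m β - Pi.single j (α + β))
      (by rw [map_sub, map_add, comb_single, comb_single, comb_single, h, sub_self])
      (by simp [Finset.sum_add_distrib, Finset.sum_sub_distrib]) (by
        intro n hn
        have h1 : n ≠ i := by rintro rfl; exact hn (Finset.mem_coe.2 hi.1)
        have h2 : n ≠ m := by rintro rfl; exact hn (Finset.mem_coe.2 hm.1)
        have h3 : n ≠ j := by rintro rfl; exact hn (Finset.mem_coe.2 hj.1)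
        simp [h1, h2, h3])
    have h1 := congrFun h0 i
    have h2 := congrFun h0 m
    simp [him, him.symm, hij, hmj] at h1 h2
    exact ⟨h1, h2⟩
  obtain ⟨σ, hσ⟩ := hg.exists_smul (hi.2.trans hj.2.symm)
  obtain ⟨τ, hτ⟩ := hg.exists_smul (hm.2.trans hj.2.symm)
  have h1 := key τ (-σ) (by rw [hσ, hτ]; module)
  have h2 := key 1 0 (by rw [hσ, neg_eq_zero.1 h1.2]; module)
  exact one_ne_zero h2.1

open Polynomial in
/-- `f` is a rational function without poles on `D`. -/
def RatOn (D : Set ℂ) (f : ℂ → ℂ) : Prop :=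
  ∃ F G : ℂ[X], (∀ z ∈ D, G.eval z ≠ 0) ∧ ∀ z ∈ D, f z * G.eval z = F.eval z

theorem RatOn.const (D : Set ℂ) (a : ℂ) : RatOn D fun _ => a :=
  ⟨Polynomial.C a, 1, by simp, by simp⟩

theorem RatOn.id (D : Set ℂ) : RatOn D fun z => z :=
  ⟨Polynomial.X, 1, by simp, by simp⟩

theorem RatOn.add {D : Set ℂ} {f g : ℂ → ℂ} (hf : RatOn D f) (hg : RatOn D g) :
    RatOn D fun z => f z + g z := by
  obtain ⟨F, G, h1, h2⟩ := hf
  obtain ⟨F', G', h1', h2'⟩ := hg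
  refine ⟨F * G' + F' * G, G * G', fun z hz => ?_, fun z hz => ?_⟩
  · rw [Polynomial.eval_mul]; exact mul_ne_zero (h1 z hz) (h1' z hz)
  · rw [Polynomial.eval_mul, Polynomial.eval_add, Polynomial.eval_mul, Polynomial.eval_mul,
      ← h2 z hz, ← h2' z hz]
    ring

theorem RatOn.mul {D : Set ℂ} {f g : ℂ → ℂ} (hf : RatOn D f) (hg : RatOn D g) :
    RatOn D fun z => f z * g z := by
  obtain ⟨F, G, h1, h2⟩ := hf
  obtain ⟨F', G', h1', h2'⟩ := hg
  refine ⟨F * F', G * G', fun z hz => ?_, fun z hz => ?_⟩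
  · rw [Polynomial.eval_mul]; exact mul_ne_zero (h1 z hz) (h1' z hz)
  · rw [Polynomial.eval_mul, Polynomial.eval_mul, ← h2 z hz, ← h2' z hz]
    ring

theorem RatOn.inv {D : Set ℂ} {f : ℂ → ℂ} (hf : RatOn D f) (h0 : ∀ z ∈ D, f z ≠ 0) :
    RatOn D fun z => (f z)⁻¹ := by
  obtain ⟨F, G, h1, h2⟩ := hf
  refine ⟨G, F, fun z hz => ?_, fun z hz => ?_⟩
  · rw [← h2 z hz]; exact mul_ne_zero (h0 z hz) (h1 z hz)
  · rw [← h2 z hz, inv_mul_cancel_left₀ (h0 z hz)]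

theorem RatOn.sum {D : Set ℂ} {ι : Type*} {S : Finset ι} {f : ι → ℂ → ℂ}
    (hf : ∀ i ∈ S, RatOn D (f i)) : RatOn D fun z => ∑ i ∈ S, f i z := by
  induction S using Finset.cons_induction with
  | empty => simpa using RatOn.const D 0
  | cons i S hi ih =>
    simp only [Finset.sum_cons]
    exact (hf i (by simp)).add (ih fun j hj => hf j (by simp [hj]))

theorem RatOn.prod {D : Set ℂ} {ι : Type*} {S : Finset ι} {f : ι → ℂ → ℂ}
    (hf : ∀ i ∈ S, RatOn D (f i)) : RatOn D fun z => ∏ i ∈ S, f i z := by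
  induction S using Finset.cons_induction with
  | empty => simpa using RatOn.const D 1
  | cons i S hi ih =>
    simp only [Finset.prod_cons]
    exact (hf i (by simp)).mul (ih fun j hj => hf j (by simp [hj]))

theorem RatOn.zpow {D : Set ℂ} (hD : ∀ z ∈ D, z ≠ 0) (m : ℤ) : RatOn D fun z => z ^ m := by
  have hpow : ∀ n : ℕ, RatOn D fun z => z ^ n := fun n =>
    ⟨Polynomial.X ^ n, 1, by simp, by simp⟩
  rcases Int.eq_nat_or_neg m with ⟨n, rfl | rfl⟩
  · simpa using hpow n
  · simpa using (hpow n).inv fun z hz => pow_ne_zero n (hD z hz)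

/-- A rational function that takes equal values at the primitive `p`-th roots of unity for all
large primes `p` is constant. -/
theorem RatOn.exists_eq_const {D : Set ℂ} {f : ℂ → ℂ} (h : RatOn D f) (N : ℕ)
    (hD : ∀ p : ℕ, p.Prime → N < p → ∀ z, IsPrimitiveRoot z p → z ∈ D)
    (hf : ∀ p : ℕ, p.Prime → N < p → ∀ z z', IsPrimitiveRoot z p → IsPrimitiveRoot z' p →
      f z = f z') : ∃ c, ∀ z ∈ D, f z = c := by
  obtain ⟨F, G, h1, h2⟩ := h
  obtain ⟨p, hpN, hp⟩ := Nat.exists_infinite_primes (N + max F.natDegree G.natDegree + 2)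
  have hp0 : NeZero p := ⟨hp.ne_zero⟩
  obtain ⟨ζ, hζ⟩ : ∃ ζ : ℂ, IsPrimitiveRoot ζ p := ⟨_, Complex.isPrimitiveRoot_exp p hp.ne_zero⟩
  have hFG : F - Polynomial.C (f ζ) * G = 0 := by
    refine Polynomial.eq_zero_of_natDegree_lt_card_of_eval_eq_zero' _ (primitiveRoots p ℂ) ?_ ?_
    · intro z hz
      rw [mem_primitiveRoots hp.pos] at hz
      have hzD := hD p hp (by omega) z hz
      rw [Polynomial.eval_sub, Polynomial.eval_mul, Polynomial.eval_C, ← h2 z hzD,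
        hf p hp (by omega) z ζ hz hζ, sub_self]
    · rw [Complex.card_primitiveRoots, Nat.totient_prime hp]
      have h3 : (F - Polynomial.C (f ζ) * G).natDegree ≤ max F.natDegree G.natDegree :=
        (Polynomial.natDegree_sub_le _ _).trans
          (max_le_max le_rfl (Polynomial.natDegree_C_mul_le _ _))
      omega
  refine ⟨f ζ, fun z hz => mul_right_cancel₀ (h1 z hz) ?_⟩
  rw [h2 z hz, sub_eq_zero.1 hFG, Polynomial.eval_mul, Polynomial.eval_C]

/-- The points at which `poleSum` has no pole. -/
def regular (v : Fin r → Fin d → ℤ) (ℓ : Fin d → ℤ) : Set ℂ :=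
  {z | z ≠ 0 ∧ ∀ i j, ℓ ⬝ᵥ v i ≠ ℓ ⬝ᵥ v j → z ^ (ℓ ⬝ᵥ v i - ℓ ⬝ᵥ v j) ≠ 1}

theorem ratOn_poleSum (v : Fin r → Fin d → ℤ) (s : Fin r) (ℓ : Fin d → ℤ) :
    RatOn (regular v ℓ) (poleSum v s ℓ) := by
  refine RatOn.sum fun b _ => RatOn.sum fun κ hκ => ?_
  obtain ⟨j, -, rfl⟩ := Finset.mem_image.1 hκ
  unfold poleTerm
  by_cases h : (fib v s ℓ b (ℓ ⬝ᵥ v j)).card = 2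
  · simp only [if_pos h]
    refine (RatOn.zpow (fun z hz => hz.1) _).mul (RatOn.prod fun i hi => RatOn.inv ?_ ?_)
    · have h1 := (RatOn.const (regular v ℓ) 1).add ((RatOn.const _ (-1)).mul
        (RatOn.zpow (fun z hz => hz.1) (ℓ ⬝ᵥ v i - ℓ ⬝ᵥ v j)))
      simpa [← sub_eq_add_neg] using h1
    · intro z hz
      rw [sub_ne_zero]
      exact (hz.2 i j (Finset.mem_filter.1 hi).2).symm
  · simp only [if_neg h]
    exact RatOn.const _ 0

/-- An upper bound for the differences of the values of `ℓ`. -/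
def spread (v : Fin r → Fin d → ℤ) (ℓ : Fin d → ℤ) : ℕ :=
  ∑ i, ∑ j, (ℓ ⬝ᵥ v i - ℓ ⬝ᵥ v j).natAbs

theorem eq_of_dvd_of_spread_lt {v : Fin r → Fin d → ℤ} {ℓ : Fin d → ℤ} {p : ℕ}
    (hp : spread v ℓ < p) (i j : Fin r) (h : (p : ℤ) ∣ ℓ ⬝ᵥ v i - ℓ ⬝ᵥ v j) :
    ℓ ⬝ᵥ v i = ℓ ⬝ᵥ v j := by
  have h1 : (ℓ ⬝ᵥ v i - ℓ ⬝ᵥ v j).natAbs ≤ spread v ℓ :=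
    (Finset.single_le_sum (f := fun j => (ℓ ⬝ᵥ v i - ℓ ⬝ᵥ v j).natAbs)
      (fun _ _ => Nat.zero_le _) (Finset.mem_univ j)).trans
      (Finset.single_le_sum (f := fun i => ∑ j, (ℓ ⬝ᵥ v i - ℓ ⬝ᵥ v j).natAbs)
      (fun _ _ => Nat.zero_le _) (Finset.mem_univ i))
  exact sub_eq_zero.1 (Int.eq_zero_of_abs_lt_dvd h (by rw [Int.abs_eq_natAbs]; omega))

theorem mem_regular {v : Fin r → Fin d → ℤ} {ℓ : Fin d → ℤ} {p : ℕ} (hp : 0 < p)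
    (hpk : ∀ i j, (p : ℤ) ∣ ℓ ⬝ᵥ v i - ℓ ⬝ᵥ v j → ℓ ⬝ᵥ v i = ℓ ⬝ᵥ v j) {z : ℂ}
    (hz : IsPrimitiveRoot z p) : z ∈ regular v ℓ :=
  ⟨hz.ne_zero hp.ne', fun i j hij h => hij (hpk i j ((hz.zpow_eq_one_iff_dvd _).1 h))⟩

theorem exists_poleSum_eq {v : Fin r → Fin d → ℤ} (hv : GCDCount v) {e ℓ : Fin d → ℤ}
    (hg : Gen v e ℓ) (s : Fin r) : ∃ c, ∀ z ∈ regular v ℓ, poleSum v s ℓ z = c := by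
  refine (ratOn_poleSum v s ℓ).exists_eq_const (spread v ℓ)
    (fun p hp hN z hz => mem_regular hp.pos (eq_of_dvd_of_spread_lt hN) hz)
    fun p hp hN z z' hz hz' => ?_
  have hpk := eq_of_dvd_of_spread_lt hN
  have hfib := fun b (hb : b ∈ Box v s 0) κ => fib_card_le hg hb κ
  refine poleSum_congr hp.pos hz hz' hpk hfib hpk hfib fun n hn => ?_
  have hp0 : NeZero p := ⟨hp.ne_zero⟩
  obtain ⟨j, -, hj, rfl⟩ := hz.isPrimitiveRoot_iff.1 hz'
  exact (charSum_pow hv hp hj.symm hn ℓ hz.pow_eq_one).symm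

end Constancy

section PoleLimit

open Filter Topology

variable {d r : ℕ}

theorem tendsto_rpow_atTop_zero {c : ℝ} (hc : c < 0) :
    Tendsto (fun x : ℝ => x ^ c) atTop (𝓝 0) := by
  simpa using tendsto_rpow_neg_atTop (neg_pos.2 hc)

theorem tendsto_factor {b δ : ℝ} (hb : b ∈ Set.Icc (0 : ℝ) 1) (hδ : δ ≠ 0) :
    ∃ L : ℝ, Tendsto (fun x : ℝ => x ^ (b * δ) * (1 - x ^ δ)⁻¹) atTop (𝓝 L) ∧
      ((0 < δ ∧ b < 1) ∨ (δ < 0 ∧ 0 < b) → L = 0) := by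
  rcases lt_or_gt_of_ne hδ with h | h
  · have h1 : Tendsto (fun x : ℝ => (1 - x ^ δ)⁻¹) atTop (𝓝 1) := by
      have := ((tendsto_rpow_atTop_zero h).const_sub 1).inv₀ (by norm_num)
      simpa using this
    rcases hb.1.eq_or_lt with h0 | h0
    · refine ⟨1, by simpa [← h0] using h1, ?_⟩
      rintro (h2 | h2)
      · linarith [h2.1]
      · linarith [h2.2]
    · refine ⟨0, ?_, fun _ => rfl⟩
      simpa using (tendsto_rpow_atTop_zero (mul_neg_of_pos_of_neg h0 h)).mul h1
  · have h1 : Tendsto (fun x : ℝ => (x ^ (-δ) - 1)⁻¹) atTop (𝓝 (-1)) := by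
      have := ((tendsto_rpow_atTop_zero (neg_lt_zero.2 h)).sub_const 1).inv₀ (by norm_num)
      simpa using this
    have heq : (fun x : ℝ => x ^ ((b - 1) * δ) * (x ^ (-δ) - 1)⁻¹) =ᶠ[atTop]
        fun x => x ^ (b * δ) * (1 - x ^ δ)⁻¹ := by
      filter_upwards [eventually_gt_atTop 0] with x hx
      have h2 : x ^ ((b - 1) * δ) = x ^ (b * δ) * (x ^ δ)⁻¹ := by
        rw [sub_mul, one_mul, sub_eq_add_neg, Real.rpow_add hx, Real.rpow_neg hx.le]
      have h3 : 0 < x ^ δ := Real.rpow_pos_of_pos hx δ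
      rw [h2, Real.rpow_neg hx.le, mul_assoc, ← mul_inv, mul_sub, mul_inv_cancel₀ h3.ne', mul_one]
    rcases hb.2.eq_or_lt with h0 | h0
    · refine ⟨-1, Tendsto.congr' heq (by simpa [h0] using h1), ?_⟩
      rintro (h2 | h2)
      · linarith [h2.2]
      · linarith [h2.1]
    · refine ⟨0, Tendsto.congr' heq ?_, fun _ => rfl⟩
      simpa using (tendsto_rpow_atTop_zero (mul_neg_of_neg_of_pos (sub_neg.2 h0) h)).mul h1

theorem cast_dotProduct_latPt {v : Fin r → Fin d → ℤ} {s : Fin r} {b : Fin r → ℝ}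
    (hb : b ∈ Box v s 0) (ℓ : Fin d → ℤ) :
    ((ℓ ⬝ᵥ latPt v 0 b : ℤ) : ℝ) = ∑ i, b i * ((ℓ ⬝ᵥ v i : ℤ) : ℝ) := by
  rw [← castVec_dotProduct, castVec_latPt hb, zero_add, dotProduct_comb]
  simp only [castVec_dotProduct]

theorem mem_idx {s : Fin r} {b : Fin r → ℝ} {i : Fin r} : i ∈ idx s b ↔ b i ≠ 0 ∨ i = s := by
  simp [idx]

theorem poleTerm_ofReal {v : Fin r → Fin d → ℤ} {s : Fin r} {b : Fin r → ℝ}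
    (hb : b ∈ Box v s 0) (ℓ : Fin d → ℤ) (κ : ℤ) {x : ℝ} (hx : 0 < x) :
    poleTerm v s ℓ x b κ = if (fib v s ℓ b κ).card = 2 then
      ((∏ i ∈ (idx s b).filter (fun i => ℓ ⬝ᵥ v i ≠ κ),
        x ^ (b i * ((ℓ ⬝ᵥ v i - κ : ℤ) : ℝ)) * (1 - x ^ ((ℓ ⬝ᵥ v i - κ : ℤ) : ℝ))⁻¹ : ℝ) : ℂ)
      else 0 := by
  unfold poleTerm
  split_ifs with h
  · rw [Finset.prod_mul_distrib, ← Real.rpow_sum_of_pos hx]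
    have h1 : ∑ i ∈ (idx s b).filter (fun i => ℓ ⬝ᵥ v i ≠ κ), b i * ((ℓ ⬝ᵥ v i - κ : ℤ) : ℝ) =
        ((ℓ ⬝ᵥ latPt v 0 b - κ * ht b : ℤ) : ℝ) := by
      rw [Finset.sum_subset (Finset.subset_univ _)]
      · push_cast
        rw [cast_dotProduct_latPt hb, cast_ht hb, Finset.mul_sum, ← Finset.sum_sub_distrib]
        exact Finset.sum_congr rfl fun i _ => by ring
      · intro i _ hi
        rw [Finset.mem_filter, mem_idx, not_and_or] at hi
        rcases hi with hi | hi
        · push Not at hi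
          rw [hi.1, zero_mul]
        · push Not at hi
          rw [hi, sub_self, Int.cast_zero, mul_zero]
    rw [h1]
    simp only [Real.rpow_intCast]
    push_cast
    rfl
  · rfl

theorem tendsto_poleTerm {v : Fin r → Fin d → ℤ} {s : Fin r} {b : Fin r → ℝ}
    (hb : b ∈ Box v s 0) {ℓ : Fin d → ℤ} (hs : Top v ℓ s) (κ : ℤ) :
    Tendsto (fun x : ℝ => poleTerm v s ℓ x b κ) atTop
      (𝓝 (if (fib v s ℓ b κ).card = 2 ∧ ∀ i ∈ idx s b, ℓ ⬝ᵥ v i = κ then 1 else 0)) := by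
  refine Tendsto.congr' (f₁ := _) ((eventually_gt_atTop (0 : ℝ)).mono fun x hx =>
    (poleTerm_ofReal hb ℓ κ hx).symm) ?_
  by_cases hc : (fib v s ℓ b κ).card = 2
  swap
  · simp [hc]
  simp only [hc, if_true, true_and]
  set S := (idx s b).filter fun i => ℓ ⬝ᵥ v i ≠ κ with hS
  split_ifs with hall
  · have : S = ∅ := Finset.filter_eq_empty_iff.2 fun i hi => not_not.2 (hall i hi)
    simp [this]
  · have hL : ∀ i, ∃ L : ℝ, i ∈ S →
        Tendsto (fun x : ℝ => x ^ (b i * ((ℓ ⬝ᵥ v i - κ : ℤ) : ℝ)) *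
          (1 - x ^ ((ℓ ⬝ᵥ v i - κ : ℤ) : ℝ))⁻¹) atTop (𝓝 L) ∧
        ((0 < ((ℓ ⬝ᵥ v i - κ : ℤ) : ℝ) ∧ b i < 1) ∨ (((ℓ ⬝ᵥ v i - κ : ℤ) : ℝ) < 0 ∧ 0 < b i) →
          L = 0) := fun i => by
      by_cases hi : i ∈ S
      · obtain ⟨L, h1, h2⟩ := tendsto_factor (hb.1 i) (δ := ((ℓ ⬝ᵥ v i - κ : ℤ) : ℝ)) (by
          have := (Finset.mem_filter.1 hi).2
          exact_mod_cast sub_ne_zero.2 this)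
        exact ⟨L, fun _ => ⟨h1, h2⟩⟩
      · exact ⟨0, fun h => absurd h hi⟩
    choose L hL using hL
    have hlim := tendsto_finsetProd S fun i hi => (hL i hi).1
    have hzero : ∏ i ∈ S, L i = 0 := by
      have hsidx : s ∈ idx s b := mem_idx.2 (Or.inr rfl)
      rw [Finset.prod_eq_zero_iff]
      by_cases hκ : ℓ ⬝ᵥ v s = κ
      · push Not at hall
        obtain ⟨i, hi, hik⟩ := hall
        have hiS : i ∈ S := Finset.mem_filter.2 ⟨hi, hik⟩
        refine ⟨i, hiS, (hL i hiS).2 (Or.inr ⟨?_, ?_⟩)⟩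
        · have h1 := hs i
          have : ℓ ⬝ᵥ v i - κ < 0 := by omega
          exact_mod_cast this
        · rcases mem_idx.1 hi with h | h
          · exact lt_of_le_of_ne (hb.1 i).1 h.symm
          · rw [h] at hik
            exact absurd hκ hik
      · have hsS : s ∈ S := Finset.mem_filter.2 ⟨hsidx, hκ⟩
        refine ⟨s, hsS, (hL s hsS).2 (Or.inl ⟨?_, hb.2.1⟩)⟩
        obtain ⟨j, hj⟩ : (fib v s ℓ b κ).Nonempty := Finset.card_pos.1 (by omega)
        have h1 := hs j
        rw [(Finset.mem_filter.1 hj).2] at h1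
        have : 0 < ℓ ⬝ᵥ v s - κ := by omega
        exact_mod_cast this
    rw [hzero] at hlim
    exact_mod_cast (Complex.continuous_ofReal.tendsto 0).comp hlim

open Classical in
/-- The number of box elements supported on a pair of maximizers of `ℓ`. -/
def edgeBox (v : Fin r → Fin d → ℤ) (s : Fin r) (ℓ : Fin d → ℤ) : ℕ :=
  ((Box_finite v s 0).toFinset.filter fun b => (idx s b).card = 2 ∧
    ∀ i ∈ idx s b, ℓ ⬝ᵥ v i = ℓ ⬝ᵥ v s).card

theorem tendsto_poleSum {v : Fin r → Fin d → ℤ} {s : Fin r} {ℓ : Fin d → ℤ} (hs : Top v ℓ s) :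
    Tendsto (fun x : ℝ => poleSum v s ℓ x) atTop (𝓝 (edgeBox v s ℓ)) := by
  classical
  have h := tendsto_finsetSum (Box_finite v s 0).toFinset fun b hb =>
    tendsto_finsetSum (Finset.univ.image fun i => ℓ ⬝ᵥ v i) fun κ _ =>
      tendsto_poleTerm (by simpa using hb) hs κ
  simp only [poleSum]
  convert h using 2
  rw [edgeBox, Finset.card_filter, Nat.cast_sum]
  refine Finset.sum_congr rfl fun b _ => ?_
  have hsidx : s ∈ idx s b := mem_idx.2 (Or.inr rfl)
  rw [Finset.sum_eq_single (ℓ ⬝ᵥ v s)]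
  · have : ((fib v s ℓ b (ℓ ⬝ᵥ v s)).card = 2 ∧ ∀ i ∈ idx s b, ℓ ⬝ᵥ v i = ℓ ⬝ᵥ v s) ↔
        (idx s b).card = 2 ∧ ∀ i ∈ idx s b, ℓ ⬝ᵥ v i = ℓ ⬝ᵥ v s :=
      and_congr_left fun hall => by rw [fib, Finset.filter_true_of_mem hall]
    simp only [this]
    push_cast
    rfl
  · intro κ _ hκ
    rw [if_neg]
    exact fun h => hκ (h.2 s hsidx).symm
  · exact fun h => absurd (Finset.mem_image_of_mem _ (Finset.mem_univ s)) h

theorem poleSum_eq_edgeBox {v : Fin r → Fin d → ℤ} (hv : GCDCount v) {e ℓ : Fin d → ℤ}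
    (hg : Gen v e ℓ) {s : Fin r} (hs : Top v ℓ s) {z : ℂ} (hz : z ∈ regular v ℓ) :
    poleSum v s ℓ z = edgeBox v s ℓ := by
  obtain ⟨c, hc⟩ := exists_poleSum_eq hv hg s
  rw [hc z hz]
  refine tendsto_nhds_unique (Tendsto.congr' ?_ tendsto_const_nhds) (tendsto_poleSum hs)
  filter_upwards [eventually_gt_atTop 1] with x hx
  refine (hc x ⟨?_, fun i j hij h => ?_⟩).symm
  · exact_mod_cast (by linarith : (0 : ℝ) < x).ne'
  · have h1 : x ^ (ℓ ⬝ᵥ v i - ℓ ⬝ᵥ v j) = 1 := by exact_mod_cast h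
    rw [zpow_eq_one_iff_right₀ (by linarith) hx.ne'] at h1
    exact hij (sub_eq_zero.1 h1)

end PoleLimit

section FaceCount

variable {d r : ℕ}

theorem zero_mem_Box (v : Fin r → Fin d → ℤ) (s : Fin r) : 0 ∈ Box v s 0 := by
  obtain ⟨l, hl, -, hsum, ha⟩ := exists_adm v s (l₀ := 0) fun _ => le_rfl
  have hl0 : l = 0 := by
    ext i
    simp only [Pi.zero_apply, Finset.sum_const_zero] at hsum
    exact (Finset.sum_eq_zero_iff_of_nonneg fun i _ => hl i).1 hsum i (Finset.mem_univ i)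
  rw [hl0] at ha
  exact ⟨fun _ => ⟨le_rfl, zero_le_one⟩, by simp, ha, ⟨0, by ext; simp [castVec]⟩, 0, by simp⟩

theorem ht_eq_zero_iff {v : Fin r → Fin d → ℤ} {s : Fin r} {b : Fin r → ℝ}
    (hb : b ∈ Box v s 0) : ht b = 0 ↔ b = 0 := by
  constructor
  · intro h
    have h1 := cast_ht hb
    rw [h, Nat.cast_zero] at h1
    ext i
    exact (Finset.sum_eq_zero_iff_of_nonneg fun i _ => (hb.1 i).1).1 h1.symm i (Finset.mem_univ i)
  · rintro rfl
    simp [ht]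

theorem dotProduct_latPt_eq_iff {v : Fin r → Fin d → ℤ} {s : Fin r} {b : Fin r → ℝ}
    (hb : b ∈ Box v s 0) {ℓ : Fin d → ℤ} (hs : Top v ℓ s) (h1 : ht b = 1) :
    ℓ ⬝ᵥ latPt v 0 b = ℓ ⬝ᵥ v s ↔ ∀ i ∈ idx s b, ℓ ⬝ᵥ v i = ℓ ⬝ᵥ v s := by
  have hsum : ∑ i, b i = 1 := by rw [← cast_ht hb, h1, Nat.cast_one]
  have hval := cast_dotProduct_latPt hb ℓ
  constructor
  · intro h i hi
    rcases mem_idx.1 hi with hi | hi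
    · have := eq_of_weighted_max (f := fun i => ((ℓ ⬝ᵥ v i : ℤ) : ℝ)) (l := b)
        (M := ((ℓ ⬝ᵥ v s : ℤ) : ℝ)) ⟨fun i => (hb.1 i).1, hsum⟩
        (fun i _ => by exact_mod_cast hs i) (by rw [← hval, h]) hi
      exact_mod_cast this
    · rw [hi]
  · intro h
    have h2 : ∑ i, b i * ((ℓ ⬝ᵥ v i : ℤ) : ℝ) = ∑ i, b i * ((ℓ ⬝ᵥ v s : ℤ) : ℝ) :=
      Finset.sum_congr rfl fun i _ => by
        by_cases hi : b i = 0
        · simp [hi]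
        · rw [h i (mem_idx.2 (Or.inl hi))]
    rw [h2, ← Finset.sum_mul, hsum, one_mul] at hval
    exact_mod_cast hval

theorem latPt_zero (v : Fin r → Fin d → ℤ) : latPt v 0 0 = 0 := by
  ext k
  simp [latPt]

open Classical in
theorem card_face {v : Fin r → Fin d → ℤ} {e ℓ : Fin d → ℤ} (hg : Gen v e ℓ) {s : Fin r}
    (hs : Top v ℓ s) :
    ((pts_finite v 0 1).toFinset.filter fun x => ℓ ⬝ᵥ x = ℓ ⬝ᵥ v s).card =
      edgeBox v s ℓ + 1 := by
  have h0 : (0 : Fin r → ℝ) ∈ (Box_finite v s 0).toFinset := by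
    simpa using zero_mem_Box v s
  have hone : ∑ b ∈ (Box_finite v s 0).toFinset, (if b = 0 then 1 else 0) = 1 := by
    rw [Finset.sum_ite_eq' _ _ _, if_pos h0]
  refine Eq.trans ?_ (congrArg (edgeBox v s ℓ + ·) hone)
  rw [Finset.card_filter, sum_pts v s, edgeBox, Finset.card_filter, ← Finset.sum_add_distrib]
  refine Finset.sum_congr rfl fun b hb => ?_
  replace hb : b ∈ Box v s 0 := by simpa using hb
  have hcard : ht b < (idx s b).card := ht_lt_card hb
  by_cases hb0 : b = 0
  · subst hb0
    have hidx : idx s (0 : Fin r → ℝ) = {s} := by ext i; simp [mem_idx]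
    have hht : ht (0 : Fin r → ℝ) = 0 := (ht_eq_zero_iff hb).2 rfl
    have hpi : ({s} : Finset (Fin r)).piAntidiag 1 = {Pi.single s 1} := by
      ext m
      simp only [Finset.mem_piAntidiag, Finset.sum_singleton, Finset.mem_singleton]
      constructor
      · rintro ⟨h1, h2⟩
        ext i
        by_cases his : i = s
        · simp [his, h1]
        · have : m i = 0 := by
            by_contra h
            exact his (h2 i h)
          simp [his, this]
      · rintro rfl
        refine ⟨by simp, fun i hi => ?_⟩
        by_contra his
        exact hi (by simp [his])
    have hsingle : ∑ i, (Pi.single s 1 : Fin r → ℕ) i • v i = v s := by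
      rw [Finset.sum_eq_single s]
      · simp
      · intro i _ his
        simp [his]
      · simp
    rw [hidx, hht, if_pos (Nat.zero_le _), Nat.sub_zero, hpi, Finset.sum_singleton, hsingle,
      latPt_zero, zero_add]
    simp
  · have hpos : ht b ≠ 0 := fun h => hb0 ((ht_eq_zero_iff hb).1 h)
    rw [if_neg hb0, add_zero]
    by_cases h1 : ht b = 1
    · rw [h1, if_pos le_rfl, Nat.sub_self, Finset.piAntidiag_zero, Finset.sum_singleton]
      have hiff := dotProduct_latPt_eq_iff hb hs h1
      have h2 : (∀ i ∈ idx s b, ℓ ⬝ᵥ v i = ℓ ⬝ᵥ v s) → (idx s b).card = 2 := fun h => by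
        have h3 := fib_card_le hg hb (ℓ ⬝ᵥ v s)
        rw [fib, Finset.filter_true_of_mem h] at h3
        omega
      simp only [Pi.zero_apply, zero_smul, Finset.sum_const_zero, add_zero, hiff]
      refine if_congr ⟨fun h => ⟨h2 h, h⟩, fun h => h.2⟩ rfl rfl
    · rw [if_neg (by omega), Finset.sum_empty, if_neg]
      rintro ⟨h2, -⟩
      omega

/-- The lattice points on the segment from `0` to `τ • e`. -/
def segPts (e : Fin d → ℤ) (τ : ℝ) : Set (Fin d → ℤ) :=
  {y | ∃ s ∈ Set.Icc 0 τ, castVec y = s • castVec e}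

theorem face_eq_image {v : Fin r → Fin d → ℤ} {e ℓ : Fin d → ℤ} (he : e ≠ 0) (hg : Gen v e ℓ)
    {i j : Fin r} (hi : LexTop v ℓ e i) (hj : LexTop v ℓ (-e) j) {τ : ℝ}
    (hτ : castVec (v i - v j) = τ • castVec e) (hτ0 : 0 ≤ τ) :
    {x ∈ pts v 0 1 | ℓ ⬝ᵥ x = ℓ ⬝ᵥ v j} = (fun y => y + v j) '' segPts e τ := by
  have hee : 0 < castVec e ⬝ᵥ castVec e := by
    rw [castVec_dotProduct]
    exact_mod_cast dotProduct_self_pos_int he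
  have hvi : castVec (v i) = castVec (v j) + τ • castVec e := by
    rw [← hτ, castVec_sub]; abel
  ext x
  constructor
  · rintro ⟨⟨l, hl, hsum, hx⟩, hℓx⟩
    rw [zero_add] at hx
    have hl' : l ∈ stdSimplex ℝ (Fin r) := ⟨hl, by simpa using hsum⟩
    have hmax : ∀ m, castVec ℓ ⬝ᵥ castVec (v m) ≤ castVec ℓ ⬝ᵥ comb v l := fun m => by
      rw [← hx, castVec_dotProduct, castVec_dotProduct, hℓx]
      exact_mod_cast hj.1 m
    obtain ⟨s, hs⟩ := exists_smul_of_top hg hl' hmax hj.1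
    have hbound : ∀ c : Fin d → ℝ, ∀ M : ℝ, (∀ m, Top v ℓ m → c ⬝ᵥ castVec (v m) ≤ M) →
        c ⬝ᵥ comb v l ≤ M := fun c M h => by
      rw [dotProduct_comb]
      calc ∑ m, l m * (c ⬝ᵥ castVec (v m)) ≤ ∑ m, l m * M := by
            refine Finset.sum_le_sum fun m _ => ?_
            by_cases hm : l m = 0
            · simp [hm]
            · exact mul_le_mul_of_nonneg_left (h m (top_of_max hl' hmax hm)) (hl m)
        _ = M := by rw [← Finset.sum_mul, hl'.2, one_mul]
    have h1 := hbound (castVec e) (castVec e ⬝ᵥ castVec (v i)) fun m hm => by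
      rw [castVec_dotProduct, castVec_dotProduct]
      exact_mod_cast hi.2 m hm
    have h2 := hbound (castVec (-e)) (castVec (-e) ⬝ᵥ castVec (v j)) fun m hm => by
      rw [castVec_dotProduct, castVec_dotProduct]
      exact_mod_cast hj.2 m hm
    have hneg : castVec (-e) = -castVec e := by ext k; simp [castVec]
    rw [hs, hvi, dotProduct_add, dotProduct_add, dotProduct_smul, dotProduct_smul, smul_eq_mul,
      smul_eq_mul] at h1
    rw [hs, hneg, neg_dotProduct, neg_dotProduct, dotProduct_add, dotProduct_smul,
      smul_eq_mul] at h2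
    refine ⟨x - v j, ⟨s, ⟨?_, ?_⟩, ?_⟩, sub_add_cancel _ _⟩
    · exact nonneg_of_mul_nonneg_left (by linarith) hee
    · exact le_of_mul_le_mul_right (by linarith) hee
    · rw [castVec_sub, hx, hs, add_sub_cancel_left]
  · rintro ⟨y, ⟨s, hs, hy⟩, rfl⟩
    beta_reduce
    have hℓy : ℓ ⬝ᵥ y = 0 := by
      have : castVec ℓ ⬝ᵥ castVec y = 0 := by
        rw [hy, dotProduct_smul, castVec_dotProduct, hg.1, Int.cast_zero, smul_zero]
      rw [castVec_dotProduct] at this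
      exact_mod_cast this
    refine ⟨?_, by rw [dotProduct_add, hℓy, zero_add]⟩
    obtain ⟨t, ht, hts⟩ : ∃ t ∈ Set.Icc (0 : ℝ) 1, s = t * τ := by
      rcases hτ0.eq_or_lt with h | h
      · exact ⟨0, by simp, by rw [zero_mul]; linarith [hs.1, hs.2]⟩
      · exact ⟨s / τ, ⟨div_nonneg hs.1 h.le, (div_le_one h).2 hs.2⟩, by field_simp⟩
    refine ⟨Pi.single j (1 - t) + Pi.single i t, fun m => ?_, ?_, ?_⟩
    · refine add_nonneg ?_ ?_
      · exact (Pi.single_nonneg (α := fun _ : Fin r => ℝ)).2 (sub_nonneg.2 ht.2) m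
      · exact (Pi.single_nonneg (α := fun _ : Fin r => ℝ)).2 ht.1 m
    · simp [Finset.sum_add_distrib]
    · rw [castVec_add, hy, map_add, comb_single, comb_single, hvi, hts]
      module

theorem exists_nonneg_smul {v : Fin r → Fin d → ℤ} {e ℓ : Fin d → ℤ} (he : e ≠ 0)
    (hg : Gen v e ℓ) {i j : Fin r} (hi : LexTop v ℓ e i) (hj : LexTop v ℓ (-e) j) :
    ∃ τ : ℝ, 0 ≤ τ ∧ castVec (v i - v j) = τ • castVec e := by
  obtain ⟨τ, hτ⟩ := hg.exists_smul (le_antisymm (hj.1 i) (hi.1 j))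
  have hτ' : castVec (v i - v j) = τ • castVec e := by rw [castVec_sub, hτ, add_sub_cancel_left]
  refine ⟨τ, ?_, hτ'⟩
  have hee : 0 < castVec e ⬝ᵥ castVec e := by
    rw [castVec_dotProduct]
    exact_mod_cast dotProduct_self_pos_int he
  have h1 : 0 ≤ castVec e ⬝ᵥ castVec (v i - v j) := by
    rw [castVec_dotProduct, dotProduct_sub]
    exact_mod_cast sub_nonneg.2 (hi.2 j hj.1)
  rw [hτ', dotProduct_smul, smul_eq_mul] at h1
  exact nonneg_of_mul_nonneg_left h1 hee

theorem le_of_segPts_ncard {e x' : Fin d → ℤ} (he : e ≠ 0) {τ τ' : ℝ}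
    (hx' : castVec x' = τ' • castVec e) (hτ' : 0 ≤ τ') (hfin : (segPts e τ').Finite)
    (h : (segPts e τ).ncard = (segPts e τ').ncard) : τ' ≤ τ := by
  by_contra! hlt
  have hsub : segPts e τ ⊆ segPts e τ' := by
    rintro y ⟨s, hs, hy⟩
    exact ⟨s, ⟨hs.1, hs.2.trans hlt.le⟩, hy⟩
  have heq := Set.eq_of_subset_of_ncard_le hsub h.ge hfin
  have hmem : x' ∈ segPts e τ' := ⟨τ', ⟨hτ', le_rfl⟩, hx'⟩
  rw [← heq] at hmem
  obtain ⟨s, hs, hy⟩ := hmem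
  have hne : castVec e ≠ 0 := fun h0 => he (castVec_injective (h0.trans (by ext; simp [castVec])))
  have := smul_left_injective ℝ hne (hx'.symm.trans hy)
  linarith [hs.2, show τ' = s from this]

theorem ncard_face {v : Fin r → Fin d → ℤ} {e ℓ : Fin d → ℤ} (hg : Gen v e ℓ) {s : Fin r}
    (hs : Top v ℓ s) :
    {x ∈ pts v 0 1 | ℓ ⬝ᵥ x = ℓ ⬝ᵥ v s}.ncard = edgeBox v s ℓ + 1 := by
  classical
  rw [← card_face hg hs, ← Set.ncard_coe_finset]
  congr 1
  ext x
  simp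

theorem segPts_finite_ncard {v : Fin r → Fin d → ℤ} {e ℓ : Fin d → ℤ} (he : e ≠ 0)
    (hg : Gen v e ℓ) {i j : Fin r} (hi : LexTop v ℓ e i) (hj : LexTop v ℓ (-e) j) {τ : ℝ}
    (hτ : castVec (v i - v j) = τ • castVec e) (hτ0 : 0 ≤ τ) :
    (segPts e τ).Finite ∧ (segPts e τ).ncard = edgeBox v j ℓ + 1 := by
  have h := face_eq_image he hg hi hj hτ hτ0
  have hinj : Function.Injective fun y : Fin d → ℤ => y + v j := add_left_injective _
  constructor
  · refine Set.Finite.of_finite_image ?_ (hinj.injOn (s := segPts e τ))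
    rw [← h]
    exact (pts_finite v 0 1).subset fun x hx => hx.1
  · rw [← Set.ncard_image_of_injective _ hinj, ← h, ncard_face hg hj.1]

/-- The number of box elements on a face does not depend on the functional. -/
theorem edgeBox_eq {v : Fin r → Fin d → ℤ} (hv : GCDCount v) {e ℓ ℓ' : Fin d → ℤ}
    (hg : Gen v e ℓ) (hg' : Gen v e ℓ') {s s' : Fin r} (hs : Top v ℓ s) (hs' : Top v ℓ' s') :
    edgeBox v s ℓ = edgeBox v s' ℓ' := by
  obtain ⟨p, hpN, hp⟩ := Nat.exists_infinite_primes (spread v ℓ + 1)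
  obtain ⟨q, hqN, hq⟩ := Nat.exists_infinite_primes (spread v ℓ' + p + 1)
  have hpk := eq_of_dvd_of_spread_lt (v := v) (ℓ := ℓ) (p := p) (by omega)
  have hqk := eq_of_dvd_of_spread_lt (v := v) (ℓ := ℓ') (p := q) (by omega)
  have hcop : IsCoprime (p : ℤ) (q : ℤ) :=
    Nat.isCoprime_iff_coprime.2 ((Nat.coprime_primes hp hq).2 (by omega))
  obtain ⟨a, c, hac⟩ := hcop
  set m : Fin d → ℤ := ℓ + (p : ℤ) • (a • (ℓ' - ℓ)) with hm
  have hm' : m = ℓ' + (q : ℤ) • (c • (ℓ - ℓ')) := by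
    ext k
    have h1 : (1 - a * p - c * q) * (ℓ' k - ℓ k) = 0 := by rw [← hac]; ring
    simp only [hm, Pi.add_apply, Pi.smul_apply, Pi.sub_apply, smul_eq_mul]
    linear_combination -h1
  have hdvd : ∀ (ℓ₁ x : Fin d → ℤ) (n : ℕ), m = ℓ₁ + (n : ℤ) • x → ∀ i j,
      (n : ℤ) ∣ m ⬝ᵥ v i - m ⬝ᵥ v j → (n : ℤ) ∣ ℓ₁ ⬝ᵥ v i - ℓ₁ ⬝ᵥ v j := by
    intro ℓ₁ x n h i j hn
    have h2 : ∀ y, m ⬝ᵥ y = ℓ₁ ⬝ᵥ y + n * (x ⬝ᵥ y) := fun y => by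
      rw [h, add_dotProduct, smul_dotProduct, smul_eq_mul]
    rw [h2, h2] at hn
    obtain ⟨q, hq⟩ := hn
    exact ⟨q - (x ⬝ᵥ v i - x ⬝ᵥ v j), by linear_combination hq⟩
  have hgm : Gen v e m := by
    refine ⟨?_, fun i j h => hg.2 i j ?_⟩
    · rw [hm, add_dotProduct, smul_dotProduct, smul_dotProduct, sub_dotProduct, hg.1, hg'.1]
      simp
    · rw [dotProduct_sub] at h ⊢
      exact sub_eq_zero.2 (hpk i j (hdvd _ _ p hm i j (by rw [h]; exact dvd_zero _)))
  have hmk : ∀ i j, m ⬝ᵥ v i = m ⬝ᵥ v j ↔ v i = v j ∨ Par (v i - v j) e := by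
    intro i j
    constructor
    · intro h
      exact hgm.2 i j (by rw [dotProduct_sub, h, sub_self])
    · rintro (h | h)
      · rw [h]
      · have := h.dotProduct_eq_zero hgm.1
        rw [dotProduct_sub] at this
        linarith
  have hmp : ∀ ℓ₁ : Fin d → ℤ, Gen v e ℓ₁ → ∀ i j, ℓ₁ ⬝ᵥ v i = ℓ₁ ⬝ᵥ v j →
      m ⬝ᵥ v i = m ⬝ᵥ v j := fun ℓ₁ h i j hij =>
    (hmk i j).2 (h.2 i j (by rw [dotProduct_sub, hij, sub_self]))
  obtain ⟨t, ht⟩ := exists_top v s.pos m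
  have key : ∀ (ℓ₁ x : Fin d → ℤ) (s₁ : Fin r) (n : ℕ), n.Prime → Gen v e ℓ₁ → Top v ℓ₁ s₁ →
      (∀ i j, (n : ℤ) ∣ ℓ₁ ⬝ᵥ v i - ℓ₁ ⬝ᵥ v j → ℓ₁ ⬝ᵥ v i = ℓ₁ ⬝ᵥ v j) →
      m = ℓ₁ + (n : ℤ) • x → edgeBox v s₁ ℓ₁ = edgeBox v t m := by
    intro ℓ₁ x s₁ n hn hg₁ hs₁ hnk h
    have hnm := fun i j hij => hmp ℓ₁ hg₁ i j (hnk i j (hdvd ℓ₁ x n h i j hij))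
    obtain ⟨ζ, hζ⟩ : ∃ ζ : ℂ, IsPrimitiveRoot ζ n := ⟨_, Complex.isPrimitiveRoot_exp n hn.ne_zero⟩
    have h1 := poleSum_congr hn.pos hζ hζ hnk (fun b hb κ => fib_card_le hg₁ (s := s₁) hb κ) hnm
      (fun b hb κ => fib_card_le hgm (s := t) hb κ) fun N _ =>
        (charSum_congr v N hζ.pow_eq_one h).symm
    rw [poleSum_eq_edgeBox hv hg₁ hs₁ (mem_regular hn.pos hnk hζ),
      poleSum_eq_edgeBox hv hgm ht (mem_regular hn.pos hnm hζ)] at h1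
    exact_mod_cast h1
  exact (key ℓ _ s p hp hg hs hpk hm).trans (key ℓ' _ s' q hq hg' hs' hqk hm').symm

theorem edgeProp_of_gcdCount {v : Fin r → Fin d → ℤ} (hv : GCDCount v) : EdgeProp v := by
  intro e he ℓ ℓ' i j i' j' hg hg' hi hj hi' hj'
  obtain ⟨τ, hτ0, hτ⟩ := exists_nonneg_smul he hg hi hj
  obtain ⟨τ', hτ0', hτ'⟩ := exists_nonneg_smul he hg' hi' hj'
  obtain ⟨hfin, hcard⟩ := segPts_finite_ncard he hg hi hj hτ hτ0
  obtain ⟨hfin', hcard'⟩ := segPts_finite_ncard he hg' hi' hj' hτ' hτ0'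
  have h : (segPts e τ).ncard = (segPts e τ').ncard := by
    rw [hcard, hcard', edgeBox_eq hv hg hg' hj.1 hj'.1]
  have h1 := le_of_segPts_ncard he hτ' hτ0' hfin' h
  have h2 := le_of_segPts_ncard he hτ hτ0 hfin h.symm
  refine castVec_injective ?_
  rw [hτ, hτ', le_antisymm h2 h1]

end FaceCount

end ZonotopeGCD

/-- A lattice polytope `P` is a zonotope iff for every `c ∈ ℚ^d` the
Ehrhart quasi-polynomial `L_{c+P}` satisfies the GCD-property with respect to the
period `den(c)`. -/
theorem zonotope_iff_gcd_property
    (d : ℕ) (P : Set (Fin d → ℝ)) (hP : IsLatticePolytope P) :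
    IsZonotope P ↔ ∀ c : Fin d → ℚ, GCDProperty (ehr P c) (denv c) := by
  obtain ⟨r, v, hr, rfl⟩ := ZonotopeGCD.exists_enum hP
  constructor
  · rintro ⟨n, u, p, h⟩ c
    obtain ⟨n', u', p', h'⟩ :=
      ZonotopeGCD.zonotope_of_edgeProp hr (ZonotopeGCD.edgeProp_of_zonotope h)
    exact ZonotopeGCD.gcdProperty_of_zonotopeZ hr h' c
  · intro h
    obtain ⟨n, u, p, h'⟩ := ZonotopeGCD.zonotope_of_edgeProp hr
      (ZonotopeGCD.edgeProp_of_gcdCount fun c => (ZonotopeGCD.gcdProperty_iff hr c).1 (h c))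
    exact ⟨n, fun i => castVec (u i), castVec p, h'⟩
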